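/- Every 4-dicritical digraph on n vertices has at least (10/3)n − 4/3 arcs, with equality if and only if it is 4-Ore; moreover, if it is not 4-Ore, it has at least (10/3)n − 1 arcs. -/

import Mathlib

/-- A (finite) digraph on vertices drawn from `ℕ`. -/
structure Dgr where
  verts : Finset ℕ
  Adj : ℕ → ℕ → Prop
  adj_mem : ∀ ⦃u v : ℕ⦄, Adj u v → u ∈ verts ∧ v ∈ verts
  adj_irrefl : ∀ v, ¬ Adj v v

namespace Dgr

/-- number of vertices -/
def nV (D : Dgr) : ℕ := D.verts.card

/-- number of arcs -/
noncomputable def nA (D : Dgr) : ℕ := {p : ℕ × ℕ | D.Adj p.1 p.2}.ncard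

/-- subdigraph relation -/
def Subd (H D : Dgr) : Prop := H.verts ⊆ D.verts ∧ ∀ ⦃u v : ℕ⦄, H.Adj u v → D.Adj u v

def ProperSubd (H D : Dgr) : Prop := Subd H D ∧ ¬ Subd D H

/-- a relation is acyclic: no directed cycle through any vertex -/
def Acy (R : ℕ → ℕ → Prop) : Prop := ∀ v, ¬ Relation.TransGen R v v

/-- a `k`-dicolouring: each colour class induces an acyclic subdigraph -/
def IsDicol (D : Dgr) {k : ℕ} (φ : ℕ → Fin k) : Prop :=
  Acy (fun u v => D.Adj u v ∧ φ u = φ v)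

def Dicolourable (D : Dgr) (k : ℕ) : Prop := ∃ φ : ℕ → Fin k, D.IsDicol φ

/-- the dichromatic number -/
noncomputable def dichr (D : Dgr) : ℕ := sInf {k | D.Dicolourable k}

/-- `k`-dicritical digraphs -/
def Dicritical (k : ℕ) (D : Dgr) : Prop :=
  D.dichr = k ∧ ∀ H : Dgr, ProperSubd H D → H.dichr < k

def Bidirected (D : Dgr) : Prop := ∀ ⦃u v : ℕ⦄, D.Adj u v → D.Adj v u

def Oriented (D : Dgr) : Prop := ∀ ⦃u v : ℕ⦄, D.Adj u v → ¬ D.Adj v u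

/-- being a bidirected complete digraph on `n` vertices -/
def IsBidirComplete (n : ℕ) (D : Dgr) : Prop :=
  D.verts.card = n ∧ ∀ u ∈ D.verts, ∀ v ∈ D.verts, u ≠ v → D.Adj u v

/-- a packing of digons (2-sets) and bidirected triangles (3-sets) -/
def IsPacking (D : Dgr) (P : Finset (Finset ℕ)) : Prop :=
  (∀ s ∈ P, (s.card = 2 ∨ s.card = 3) ∧ s ⊆ D.verts ∧
      ∀ u ∈ s, ∀ v ∈ s, u ≠ v → D.Adj u v) ∧
  (P : Set (Finset ℕ)).Pairwise Disjoint

/-- `T(D)`: the maximum of `d + 2t` over packings of `d` digons and `t` bidirected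
triangles; a digon contributes `card - 1 = 1`, a triangle `card - 1 = 2`. -/
noncomputable def TT (D : Dgr) : ℕ :=
  sSup {t | ∃ P : Finset (Finset ℕ), D.IsPacking P ∧ t = ∑ s ∈ P, (s.card - 1)}

/-- vertex deletion -/
def del (D : Dgr) (x : ℕ) : Dgr where
  verts := D.verts.erase x
  Adj u v := D.Adj u v ∧ u ≠ x ∧ v ≠ x
  adj_mem := by
    intro u v h
    exact ⟨Finset.mem_erase.2 ⟨h.2.1, (D.adj_mem h.1).1⟩,
           Finset.mem_erase.2 ⟨h.2.2, (D.adj_mem h.1).2⟩⟩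
  adj_irrefl := fun v h => D.adj_irrefl v h.1

/-- induced subdigraph on a set `S` of vertices -/
def induce (D : Dgr) (S : Finset ℕ) : Dgr where
  verts := D.verts ∩ S
  Adj u v := D.Adj u v ∧ u ∈ S ∧ v ∈ S
  adj_mem := by
    intro u v h
    exact ⟨Finset.mem_inter.2 ⟨(D.adj_mem h.1).1, h.2.1⟩,
           Finset.mem_inter.2 ⟨(D.adj_mem h.1).2, h.2.2⟩⟩
  adj_irrefl := fun v h => D.adj_irrefl v h.1

/-- adding a digon between two (distinct, existing) vertices -/
def addDigon (D : Dgr) (x y : ℕ) : Dgr where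
  verts := D.verts
  Adj u v := D.Adj u v ∨
    (x ≠ y ∧ x ∈ D.verts ∧ y ∈ D.verts ∧ ((u = x ∧ v = y) ∨ (u = y ∧ v = x)))
  adj_mem := by
    intro u v h
    rcases h with h | ⟨_, hx, hy, h | h⟩
    · exact D.adj_mem h
    · exact ⟨h.1 ▸ hx, h.2 ▸ hy⟩
    · exact ⟨h.1 ▸ hy, h.2 ▸ hx⟩
  adj_irrefl := by
    intro v h
    rcases h with h | ⟨hxy, _, _, h | h⟩
    · exact D.adj_irrefl v h
    · exact hxy (h.1.symm.trans h.2)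
    · exact hxy (h.2.symm.trans h.1)

/-- removing the digon `[x,y]` (both arcs) -/
def delDigon (D : Dgr) (x y : ℕ) : Dgr where
  verts := D.verts
  Adj u v := D.Adj u v ∧ ¬(u = x ∧ v = y) ∧ ¬(u = y ∧ v = x)
  adj_mem := by intro u v h; exact D.adj_mem h.1
  adj_irrefl := fun v h => D.adj_irrefl v h.1

/-- `D` is an Ore-composition of `D1` (digon side, replaced digon `[x,y]`) and
`D2` (split side, split vertex `z`). -/
def IsOreComp (D1 D2 D : Dgr) : Prop :=
  Bidirected D1 ∧ Bidirected D2 ∧ Disjoint D1.verts D2.verts ∧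
  ∃ (x y z : ℕ) (Z1 Z2 : Set ℕ),
    x ∈ D1.verts ∧ y ∈ D1.verts ∧ x ≠ y ∧ D1.Adj x y ∧
    z ∈ D2.verts ∧
    Z1 ∪ Z2 = {w | D2.Adj z w} ∧ Disjoint Z1 Z2 ∧ Z1.Nonempty ∧ Z2.Nonempty ∧
    D.verts = D1.verts ∪ D2.verts.erase z ∧
    (∀ u v, D.Adj u v ↔
      (D1.Adj u v ∧ ¬(u = x ∧ v = y) ∧ ¬(u = y ∧ v = x)) ∨
      (D2.Adj u v ∧ u ≠ z ∧ v ≠ z) ∨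
      (u = x ∧ v ∈ Z1 ∧ D2.Adj z v) ∨ (v = x ∧ u ∈ Z1 ∧ D2.Adj u z) ∨
      (u = y ∧ v ∈ Z2 ∧ D2.Adj z v) ∨ (v = y ∧ u ∈ Z2 ∧ D2.Adj u z))

/-- degree of a vertex: in-degree plus out-degree -/
noncomputable def deg (D : Dgr) (v : ℕ) : ℕ :=
  {u | D.Adj v u}.ncard + {u | D.Adj u v}.ncard

end Dgr

open Dgr

/-- the class of 4-Ore digraphs -/
inductive IsOre4 : Dgr → Prop
  | k4 : ∀ D : Dgr, IsBidirComplete 4 D → IsOre4 D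
  | comp : ∀ D1 D2 D : Dgr, IsOre4 D1 → IsOre4 D2 → IsOreComp D1 D2 D → IsOre4 D

namespace Dgr

/-- an emerald: a bidirected triangle all of whose vertices have degree 6 in `D` -/
def IsEmerald (D : Dgr) (s : Finset ℕ) : Prop :=
  s.card = 3 ∧ s ⊆ D.verts ∧ (∀ u ∈ s, ∀ v ∈ s, u ≠ v → D.Adj u v) ∧
  ∀ v ∈ s, D.deg v = 6

/-- a diamond: a bidirected `K4` minus a digon `[x,y]`, the two other vertices
having degree 6 in `D` -/
def IsDiamond (D : Dgr) (s : Finset ℕ) : Prop :=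
  s.card = 4 ∧ s ⊆ D.verts ∧ ∃ x ∈ s, ∃ y ∈ s, x ≠ y ∧
    (∀ u ∈ s, ∀ v ∈ s, u ≠ v → ¬(u = x ∧ v = y) → ¬(u = y ∧ v = x) → D.Adj u v) ∧
    (∀ v ∈ s, v ≠ x → v ≠ y → D.deg v = 6)

/-- boundary of an induced subdigraph given by its vertex set `S` -/
def bdry (D : Dgr) (S : Finset ℕ) : Set ℕ :=
  {v | v ∈ S ∧ ∃ u ∈ D.verts, u ∉ S ∧ (D.Adj u v ∨ D.Adj v u)}

/-- Ore-collapsible induced subdigraph, given by its vertex set -/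
def OreCollapsible (D : Dgr) (S : Finset ℕ) : Prop :=
  S ⊆ D.verts ∧ S.card < D.verts.card ∧
  ∃ u v : ℕ, u ≠ v ∧ D.bdry S = {u, v} ∧ IsOre4 ((D.induce S).addDigon u v)

/-- the potential of a digraph, with respect to parameters ε and δ -/
noncomputable def pot (D : Dgr) (ε δ : ℝ) : ℝ :=
  (10/3 + ε) * (D.nV : ℝ) - (D.nA : ℝ) - δ * (D.TT : ℝ)

end Dgr

noncomputable section PfSection
open scoped Classical
namespace Pf
open Dgr

theorem dgr_ext {D E : Dgr} (hv : D.verts = E.verts) (ha : ∀ u v, D.Adj u v ↔ E.Adj u v) : D = E := by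
  cases D with
  | mk V A _ _ =>
    cases E with
    | mk V' A' _ _ =>
      simp only at hv ha
      subst hv
      have : A = A' := by
        funext u v
        exact propext (ha u v)
      subst this
      rfl

/-- 3-dicolourability, via a rank function -/
def Col (A : ℕ → ℕ → Prop) : Prop :=
  ∃ φ : ℕ → Fin 3, ∃ f : ℕ → ℕ, ∀ u v, A u v → φ u = φ v → f u < f v

/-- proper 3-colourability -/
def PC (A : ℕ → ℕ → Prop) : Prop :=
  ∃ φ : ℕ → Fin 3, ∀ u v, A u v → φ u ≠ φ v

theorem Col.mono {A B : ℕ → ℕ → Prop} (h : Col B) (hAB : ∀ u v, A u v → B u v) : Col A := by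
  obtain ⟨φ, f, hf⟩ := h
  exact ⟨φ, f, fun u v ha => hf u v (hAB u v ha)⟩

theorem PC.col {A : ℕ → ℕ → Prop} (h : PC A) : Col A := by
  obtain ⟨φ, hf⟩ := h
  exact ⟨φ, fun _ => 0, fun u v ha he => absurd he (hf u v ha)⟩

theorem Col.pc {A : ℕ → ℕ → Prop} (h : Col A) (hs : ∀ u v, A u v → A v u) : PC A := by
  obtain ⟨φ, f, hf⟩ := h
  refine ⟨φ, fun u v ha he => ?_⟩
  have h1 := hf u v ha he
  have h2 := hf v u (hs _ _ ha) he.symm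
  omega

theorem PC.mono {A B : ℕ → ℕ → Prop} (h : PC B) (hAB : ∀ u v, A u v → B u v) : PC A := by
  obtain ⟨φ, hf⟩ := h
  exact ⟨φ, fun u v ha => hf u v (hAB u v ha)⟩

/-- a rank function into any preorder suffices -/
theorem col_of_rank {α : Type*} [Preorder α] (V : Finset ℕ) {A : ℕ → ℕ → Prop}
    (hA : ∀ u v, A u v → u ∈ V) (φ : ℕ → Fin 3) (f : ℕ → α)
    (h : ∀ u v, A u v → φ u = φ v → f u < f v) : Col A := by
  refine ⟨φ, fun v => (V.filter (fun u => f u < f v)).card, fun u v ha he => ?_⟩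
  have hlt := h u v ha he
  apply Finset.card_lt_card
  rw [Finset.ssubset_iff_of_subset]
  · refine ⟨u, ?_, ?_⟩
    · simp [hA u v ha, hlt]
    · simp
  · intro w hw
    simp only [Finset.mem_filter] at hw ⊢
    exact ⟨hw.1, hw.2.trans hlt⟩

theorem col_of_acy (D : Dgr) (φ : ℕ → Fin 3) (h : D.IsDicol φ) : Col D.Adj := by
  refine ⟨φ, fun v => (D.verts.filter (fun u =>
    Relation.TransGen (fun a b => D.Adj a b ∧ φ a = φ b) u v)).card, fun u v ha he => ?_⟩
  apply Finset.card_lt_card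
  rw [Finset.ssubset_iff_of_subset]
  · refine ⟨u, ?_, ?_⟩
    · simp only [Finset.mem_filter]
      exact ⟨(D.adj_mem ha).1, Relation.TransGen.single ⟨ha, he⟩⟩
    · simp only [Finset.mem_filter, not_and]
      intro _
      exact h u
  · intro w hw
    simp only [Finset.mem_filter] at hw ⊢
    exact ⟨hw.1, hw.2.tail ⟨ha, he⟩⟩

theorem dicolourable_of_col (D : Dgr) (h : Col D.Adj) : D.Dicolourable 3 := by
  obtain ⟨φ, f, hf⟩ := h
  refine ⟨φ, fun v hv => ?_⟩
  have key : ∀ u v, Relation.TransGen (fun a b => D.Adj a b ∧ φ a = φ b) u v → f u < f v := by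
    intro u v h
    induction h with
    | single h => exact hf _ _ h.1 h.2
    | tail _ h ih => exact ih.trans (hf _ _ h.1 h.2)
  exact lt_irrefl _ (key v v hv)

def Crit (D : Dgr) : Prop := ¬ Col D.Adj ∧ ∀ H : Dgr, ProperSubd H D → Col H.Adj

theorem dicolourable_some (D : Dgr) : ∃ k, D.Dicolourable k := by
  refine ⟨D.verts.sup id + 1, fun v => Fin.ofNat _ v, fun v hv => ?_⟩
  have : ∀ u v, ¬ (D.Adj u v ∧ Fin.ofNat (D.verts.sup id + 1) u = Fin.ofNat _ v) := by
    rintro u v ⟨h, he⟩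
    obtain ⟨hu, hv⟩ := D.adj_mem h
    have h1 : u ≤ D.verts.sup id := Finset.le_sup (f := id) hu
    have h2 : v ≤ D.verts.sup id := Finset.le_sup (f := id) hv
    rw [Fin.ext_iff] at he
    simp only [Fin.ofNat] at he
    rw [Nat.mod_eq_of_lt (by omega), Nat.mod_eq_of_lt (by omega)] at he
    subst he
    exact D.adj_irrefl _ h
  cases hv with
  | single h => exact this _ _ h
  | tail _ h => exact this _ _ h

theorem dicolourable_mono (D : Dgr) {k l : ℕ} (hkl : k ≤ l) (h : D.Dicolourable k) :
    D.Dicolourable l := by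
  obtain ⟨φ, hφ⟩ := h
  refine ⟨fun v => Fin.castLE hkl (φ v), fun v hv => hφ v ?_⟩
  refine Relation.TransGen.lift id ?_ v v hv
  rintro a b ⟨h1, h2⟩
  exact ⟨h1, by simpa using h2⟩

theorem crit_of_dicritical {D : Dgr} (h : Dicritical 4 D) : Crit D := by
  obtain ⟨h1, h2⟩ := h
  constructor
  · intro hc
    have := dicolourable_of_col D hc
    have h3 : D.dichr ≤ 3 := Nat.sInf_le this
    omega
  · intro H hH
    have h3 := h2 H hH
    have h4 : H.Dicolourable H.dichr := Nat.sInf_mem (dicolourable_some H)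
    obtain ⟨φ, hφ⟩ := dicolourable_mono H (show H.dichr ≤ 3 by omega) h4
    exact col_of_acy H φ hφ

/-- helper digraph -/
def mkD (V : Finset ℕ) (A : ℕ → ℕ → Prop) : Dgr where
  verts := V
  Adj u v := u ∈ V ∧ v ∈ V ∧ u ≠ v ∧ A u v
  adj_mem := fun _ _ h => ⟨h.1, h.2.1⟩
  adj_irrefl := fun _ h => h.2.2.1 rfl

/-- arcs inside a set -/
def ar (A : ℕ → ℕ → Prop) (S : Finset ℕ) : Finset (ℕ × ℕ) :=
  (S ×ˢ S).filter (fun p => A p.1 p.2)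

theorem mem_ar {A : ℕ → ℕ → Prop} {S : Finset ℕ} {p : ℕ × ℕ} :
    p ∈ ar A S ↔ p.1 ∈ S ∧ p.2 ∈ S ∧ A p.1 p.2 := by
  simp [ar, and_assoc]

def pt (A : ℕ → ℕ → Prop) (S : Finset ℕ) : ℤ := 10 * (S.card : ℤ) - 3 * ((ar A S).card : ℤ)

theorem exists_crit_sub (D : Dgr) (h : ¬ Col D.Adj) : ∃ K, Crit K ∧ Subd K D := by
  generalize hn : D.verts.card + (ar D.Adj D.verts).card = n
  induction n using Nat.strong_induction_on generalizing D with
  | _ n ih =>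
    by_cases hc : Crit D
    · exact ⟨D, hc, fun _ h => h, fun _ _ h => h⟩
    · have : ∃ H, ProperSubd H D ∧ ¬ Col H.Adj := by
        by_contra hh
        push Not at hh
        exact hc ⟨h, hh⟩
      obtain ⟨H, ⟨hs, hns⟩, hH⟩ := this
      have hsub : ar H.Adj H.verts ⊆ ar D.Adj D.verts := by
        intro p hp
        rw [mem_ar] at hp ⊢
        exact ⟨hs.1 hp.1, hs.1 hp.2.1, hs.2 hp.2.2⟩
      have h1 := Finset.card_le_card hsub
      have h2 := Finset.card_le_card hs.1
      have hlt : H.verts.card + (ar H.Adj H.verts).card < n := by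
        by_contra hge
        have e1 : H.verts = D.verts := Finset.eq_of_subset_of_card_le hs.1 (by omega)
        have e2 : ar H.Adj H.verts = ar D.Adj D.verts :=
          Finset.eq_of_subset_of_card_le hsub (by omega)
        apply hns
        refine ⟨e1.symm ▸ Finset.Subset.refl _, fun u v huv => ?_⟩
        have : (u, v) ∈ ar D.Adj D.verts := mem_ar.2 ⟨(D.adj_mem huv).1, (D.adj_mem huv).2, huv⟩
        rw [← e2, mem_ar] at this
        exact this.2.2
      obtain ⟨K, hK, hKs⟩ := ih _ hlt H hH rfl
      exact ⟨K, hK, hKs.1.trans hs.1, fun u v h => hs.2 (hKs.2 h)⟩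

theorem exists_crit (V : Finset ℕ) (A : ℕ → ℕ → Prop)
    (h : ¬ Col (fun u v => u ∈ V ∧ v ∈ V ∧ u ≠ v ∧ A u v)) :
    ∃ K, Crit K ∧ K.verts ⊆ V ∧ ∀ u v, K.Adj u v → A u v := by
  obtain ⟨K, hK, h1, h2⟩ := exists_crit_sub (mkD V A) h
  exact ⟨K, hK, h1, fun u v h => (h2 h).2.2.2⟩

theorem Crit.col_lt {D : Dgr} (h : Crit D) {B : ℕ → ℕ → Prop} (hB : ∀ u v, B u v → D.Adj u v)
    {a b : ℕ} (hab : D.Adj a b) (hn : ¬ B a b) : Col B := by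
  have := h.2 (mkD D.verts B) ⟨⟨fun _ h => h, fun u v h => hB u v h.2.2.2⟩,
    fun hs => hn (hs.2 hab).2.2.2⟩
  refine this.mono (fun u v huv => ?_)
  have h1 := hB u v huv
  have h2 := D.adj_mem h1
  refine ⟨h2.1, h2.2, ?_, huv⟩
  rintro rfl
  exact D.adj_irrefl _ h1

theorem Crit.col_on {D : Dgr} (h : Crit D) {R : Finset ℕ} {v : ℕ} (hv : v ∈ D.verts) (hR : v ∉ R) :
    Col (fun a b => D.Adj a b ∧ a ∈ R ∧ b ∈ R) := by
  have := h.2 (D.induce R) ⟨⟨Finset.inter_subset_left, fun u v h => h.1⟩,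
    fun hs => hR (Finset.mem_inter.1 (hs.1 hv)).2⟩
  exact this

theorem crit_of {D : Dgr} (h : ¬ Col D.Adj)
    (h1 : ∀ u v, D.Adj u v → Col (fun a b => D.Adj a b ∧ ¬ (a = u ∧ b = v)))
    (h2 : ∀ v ∈ D.verts, ∃ u, D.Adj v u) : Crit D := by
  refine ⟨h, fun H hH => ?_⟩
  by_cases hx : ∃ u v, D.Adj u v ∧ ¬ H.Adj u v
  · obtain ⟨u, v, huv, hn⟩ := hx
    refine (h1 u v huv).mono (fun a b hab => ⟨hH.1.2 hab, ?_⟩)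
    rintro ⟨rfl, rfl⟩
    exact hn hab
  · push Not at hx
    exfalso
    apply hH.2
    refine ⟨fun v hv => ?_, fun u v huv => hx u v huv⟩
    obtain ⟨u, hu⟩ := h2 v hv
    exact (H.adj_mem (hx _ _ hu)).1

def rev (D : Dgr) : Dgr where
  verts := D.verts
  Adj u v := D.Adj v u
  adj_mem := fun _ _ h => ⟨(D.adj_mem h).2, (D.adj_mem h).1⟩
  adj_irrefl := fun v h => D.adj_irrefl v h

theorem rev_rev (D : Dgr) : rev (rev D) = D := rfl

theorem col_swap (D : Dgr) (h : Col D.Adj) : Col (rev D).Adj := by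
  obtain ⟨φ, f, hf⟩ := h
  refine col_of_rank (α := ℕᵒᵈ) D.verts (fun u v h => (D.adj_mem h).2) φ
    (fun v => OrderDual.toDual (f v)) (fun u v h he => ?_)
  exact OrderDual.toDual_lt_toDual.2 (hf v u h he.symm)

theorem Crit.rev {D : Dgr} (h : Crit D) : Crit (rev D) := by
  refine ⟨fun hc => h.1 (col_swap _ hc), fun H hH => ?_⟩
  refine col_swap (Pf.rev H) (h.2 (Pf.rev H) ⟨⟨hH.1.1, fun u v h => hH.1.2 h⟩, fun hs => ?_⟩)
  exact hH.2 ⟨hs.1, fun u v h => hs.2 h⟩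

theorem Crit.nonempty {D : Dgr} (h : Crit D) : D.verts.Nonempty := by
  rw [Finset.nonempty_iff_ne_empty]
  intro he
  apply h.1
  refine ⟨fun _ => 0, fun _ => 0, fun u v huv => ?_⟩
  have := (D.adj_mem huv).1
  rw [he] at this
  simp at this

def outN (D : Dgr) (v : ℕ) : Finset ℕ := D.verts.filter (fun u => D.Adj v u)
def inN (D : Dgr) (v : ℕ) : Finset ℕ := D.verts.filter (fun u => D.Adj u v)

theorem mem_outN {D : Dgr} {u v : ℕ} : u ∈ outN D v ↔ D.Adj v u := by
  simp only [outN, Finset.mem_filter, and_iff_right_iff_imp]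
  exact fun h => (D.adj_mem h).2

theorem mem_inN {D : Dgr} {u v : ℕ} : u ∈ inN D v ↔ D.Adj u v := by
  simp only [inN, Finset.mem_filter, and_iff_right_iff_imp]
  exact fun h => (D.adj_mem h).1

theorem exists_colour (T : Finset (Fin 3)) (h : T.card < 3) : ∃ c, c ∉ T := by
  by_contra hh
  push Not at hh
  have : T = Finset.univ := Finset.eq_univ_iff_forall.2 hh
  rw [this] at h
  simp at h

theorem Crit.out_ge {D : Dgr} (h : Crit D) {v : ℕ} (hv : v ∈ D.verts) : 3 ≤ (outN D v).card := by
  by_contra hlt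
  push Not at hlt
  obtain ⟨φ, f, hf⟩ := h.col_on (R := D.verts.erase v) hv (by simp)
  obtain ⟨c, hc⟩ := exists_colour ((outN D v).image φ) (lt_of_le_of_lt Finset.card_image_le hlt)
  apply h.1
  refine ⟨fun u => if u = v then c else φ u, fun u => if u = v then D.verts.sup f + 1 else f u,
    fun a b hab => ?_⟩
  have hm := D.adj_mem hab
  have hne : a ≠ b := by
    rintro rfl
    exact D.adj_irrefl _ hab
  by_cases ha : a = v
  · subst ha
    have hb : b ≠ a := hne.symm
    simp only [if_true, if_neg hb]
    intro he
    exact absurd (Finset.mem_image.2 ⟨b, mem_outN.2 hab, he.symm⟩) hc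
  · by_cases hb : b = v
    · subst hb
      simp only [if_true, if_neg ha]
      intro _
      have := Finset.le_sup (f := f) hm.1
      omega
    · simp only [if_neg ha, if_neg hb]
      exact hf a b ⟨hab, Finset.mem_erase.2 ⟨ha, hm.1⟩, Finset.mem_erase.2 ⟨hb, hm.2⟩⟩

theorem Crit.in_ge {D : Dgr} (h : Crit D) {v : ℕ} (hv : v ∈ D.verts) : 3 ≤ (inN D v).card :=
  h.rev.out_ge (v := v) hv

theorem outN_sub (D : Dgr) (v : ℕ) : outN D v ⊆ D.verts.erase v := by
  intro u hu
  rw [mem_outN] at hu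
  refine Finset.mem_erase.2 ⟨?_, (D.adj_mem hu).2⟩
  rintro rfl
  exact D.adj_irrefl _ hu

theorem Crit.four_le {D : Dgr} (h : Crit D) : 4 ≤ D.verts.card := by
  obtain ⟨v, hv⟩ := h.nonempty
  have h1 := h.out_ge hv
  have h2 := Finset.card_le_card (outN_sub D v)
  rw [Finset.card_erase_of_mem hv] at h2
  omega

theorem Crit.k4 {D : Dgr} (h : Crit D) (h4 : D.verts.card = 4) : IsBidirComplete 4 D := by
  refine ⟨h4, fun u hu v hv huv => ?_⟩
  have h1 := h.out_ge hu
  have h2 : outN D u = D.verts.erase u := by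
    apply Finset.eq_of_subset_of_card_le (outN_sub D u)
    rw [Finset.card_erase_of_mem hu]
    omega
  have : v ∈ outN D u := by
    rw [h2]
    exact Finset.mem_erase.2 ⟨huv.symm, hv⟩
  exact mem_outN.1 this

theorem ar_nA (D : Dgr) : D.nA = (ar D.Adj D.verts).card := by
  unfold Dgr.nA
  rw [← Set.ncard_coe_finset]
  congr 1
  ext p
  simp only [Set.mem_ofPred_eq, Finset.mem_coe, mem_ar]
  exact ⟨fun h => ⟨(D.adj_mem h).1, (D.adj_mem h).2, h⟩, fun h => h.2.2⟩

/-! counting -/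

theorem ar_mono {A B : ℕ → ℕ → Prop} {S : Finset ℕ}
    (h : ∀ u ∈ S, ∀ v ∈ S, A u v → B u v) : ar A S ⊆ ar B S := by
  intro p hp
  rw [mem_ar] at hp ⊢
  exact ⟨hp.1, hp.2.1, h _ hp.1 _ hp.2.1 hp.2.2⟩

theorem pt_mono {A B : ℕ → ℕ → Prop} {S : Finset ℕ}
    (h : ∀ u ∈ S, ∀ v ∈ S, A u v → B u v) : pt B S ≤ pt A S := by
  have := Finset.card_le_card (ar_mono h)
  unfold pt
  omega

theorem pt_congr {A B : ℕ → ℕ → Prop} {S : Finset ℕ}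
    (h : ∀ u ∈ S, ∀ v ∈ S, (A u v ↔ B u v)) : pt B S = pt A S :=
  le_antisymm (pt_mono fun u hu v hv => (h u hu v hv).1) (pt_mono fun u hu v hv => (h u hu v hv).2)

theorem pt_le_add {A B : ℕ → ℕ → Prop} {S : Finset ℕ} (F : Finset (ℕ × ℕ))
    (h : ∀ u ∈ S, ∀ v ∈ S, A u v → B u v ∨ (u, v) ∈ F) : pt B S ≤ pt A S + 3 * (F.card : ℤ) := by
  have h1 : ar A S ⊆ ar B S ∪ F := by
    intro p hp
    rw [mem_ar] at hp
    rw [Finset.mem_union, mem_ar]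
    rcases h _ hp.1 _ hp.2.1 hp.2.2 with h | h
    · exact Or.inl ⟨hp.1, hp.2.1, h⟩
    · exact Or.inr h
  have h2 := (Finset.card_le_card h1).trans (Finset.card_union_le _ _)
  unfold pt
  omega

theorem pt_insert {A : ℕ → ℕ → Prop} (hA : ∀ v, ¬ A v v) {S : Finset ℕ} {y : ℕ} (hy : y ∉ S) :
    pt A (insert y S) = pt A S + 10 -
      3 * (((S.filter (fun v => A y v)).card : ℤ) + ((S.filter (fun v => A v y)).card : ℤ)) := by
  have h1 : ar A (insert y S) = (ar A S ∪ (S.filter (fun v => A y v)).image (fun v => (y, v))) ∪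
      (S.filter (fun v => A v y)).image (fun v => (v, y)) := by
    ext ⟨a, b⟩
    simp only [mem_ar, Finset.mem_union, Finset.mem_image, Finset.mem_filter, Finset.mem_insert,
      Prod.mk.injEq]
    constructor
    · rintro ⟨rfl | ha, rfl | hb, h⟩
      · exact absurd h (hA _)
      · exact Or.inl (Or.inr ⟨b, ⟨hb, h⟩, rfl, rfl⟩)
      · exact Or.inr ⟨a, ⟨ha, h⟩, rfl, rfl⟩
      · exact Or.inl (Or.inl ⟨ha, hb, h⟩)
    · rintro ((⟨ha, hb, h⟩ | ⟨v, ⟨hv, h⟩, rfl, rfl⟩) | ⟨v, ⟨hv, h⟩, rfl, rfl⟩)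
      · exact ⟨Or.inr ha, Or.inr hb, h⟩
      · exact ⟨Or.inl rfl, Or.inr hv, h⟩
      · exact ⟨Or.inr hv, Or.inl rfl, h⟩
  have h2 : (ar A (insert y S)).card = (ar A S).card + (S.filter (fun v => A y v)).card +
      (S.filter (fun v => A v y)).card := by
    rw [h1, Finset.card_union_of_disjoint, Finset.card_union_of_disjoint,
      Finset.card_image_of_injective, Finset.card_image_of_injective]
    · intro a b h
      simpa using h
    · intro a b h
      simpa using h
    · rw [Finset.disjoint_left]
      rintro ⟨a, b⟩ h h'
      simp only [mem_ar, Finset.mem_image, Finset.mem_filter, Prod.mk.injEq] at h h'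
      obtain ⟨v, _, rfl, rfl⟩ := h'
      exact hy h.1
    · rw [Finset.disjoint_left]
      rintro ⟨a, b⟩ h h'
      simp only [mem_ar, Finset.mem_image, Finset.mem_filter, Prod.mk.injEq, Finset.mem_union] at h h'
      obtain ⟨v, hv, rfl, rfl⟩ := h'
      rcases h with h | ⟨w, hw, h3, h4⟩
      · exact hy h.2.1
      · subst h4
        exact hy hw.1
  unfold pt
  rw [h2, Finset.card_insert_of_notMem hy]
  push_cast
  ring

theorem pt_singleton {A : ℕ → ℕ → Prop} (hA : ∀ v, ¬ A v v) (a : ℕ) : pt A {a} = 10 := by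
  have : ar A {a} = ∅ := by
    ext ⟨u, v⟩
    simp only [mem_ar, Finset.mem_singleton, Finset.notMem_empty, iff_false]
    rintro ⟨rfl, rfl, h⟩
    exact hA _ h
  simp [pt, this]

theorem ar_card_le {A : ℕ → ℕ → Prop} (hA : ∀ v, ¬ A v v) (S : Finset ℕ) :
    (ar A S).card + S.card ≤ S.card * S.card := by
  have h1 : ar A S ⊆ S.offDiag := by
    intro p hp
    rw [mem_ar] at hp
    rw [Finset.mem_offDiag]
    refine ⟨hp.1, hp.2.1, fun he => ?_⟩
    have := hp.2.2
    rw [he] at this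
    exact hA _ this
  have := Finset.card_le_card h1
  rw [Finset.offDiag_card] at this
  have h2 : S.card ≤ S.card * S.card := Nat.le_mul_self _
  omega

theorem pt_small {A : ℕ → ℕ → Prop} (hA : ∀ v, ¬ A v v) {S : Finset ℕ} (h0 : S.Nonempty)
    (h3 : S.card ≤ 3) : 10 ≤ pt A S := by
  have h1 := ar_card_le hA S
  have h2 := h0.card_pos
  unfold pt
  generalize S.card = k at *
  interval_cases k <;> omega

/-- five digons on four vertices -/
theorem pt_five {A : ℕ → ℕ → Prop} {a b c d : ℕ}
    (hab : a ≠ b) (hac : a ≠ c) (had : a ≠ d) (hbc : b ≠ c) (hbd : b ≠ d) (hcd : c ≠ d)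
    (h1 : A a b) (h1' : A b a) (h2 : A a c) (h2' : A c a) (h3 : A b c) (h3' : A c b)
    (h4 : A b d) (h4' : A d b) (h5 : A c d) (h5' : A d c) :
    pt A {a, b, c, d} ≤ 10 := by
  have e : ({(a,b),(b,a),(a,c),(c,a),(b,c),(c,b),(b,d),(d,b),(c,d),(d,c)} : Finset (ℕ × ℕ)) ⊆
      ar A {a, b, c, d} := by
    intro p hp
    simp only [Finset.mem_insert, Finset.mem_singleton] at hp
    rw [mem_ar]
    rcases hp with rfl|rfl|rfl|rfl|rfl|rfl|rfl|rfl|rfl|rfl <;> simp [*]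
  have h6 := Finset.card_le_card e
  have h7 : ({(a,b),(b,a),(a,c),(c,a),(b,c),(c,b),(b,d),(d,b),(c,d),(d,c)} :
      Finset (ℕ × ℕ)).card = 10 := by
    have := hab.symm; have := hac.symm; have := had.symm; have := hbc.symm; have := hbd.symm
    have := hcd.symm
    simp [*]
  have h8 : ({a, b, c, d} : Finset ℕ).card = 4 := by simp [*]
  unfold pt
  omega

theorem perm_to (a b : Fin 3) : ∃ σ : Equiv.Perm (Fin 3), σ a = b := ⟨Equiv.swap a b, by simp⟩

/-- the boundary -/
def Bd (D : Dgr) (R : Finset ℕ) (v : ℕ) : Prop :=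
  v ∈ R ∧ ∃ w ∈ D.verts, w ∉ R ∧ (D.Adj v w ∨ D.Adj w v)

theorem Crit.two_bd {D : Dgr} (h : Crit D) {R : Finset ℕ} (hR : R ⊆ D.verts) (hne : R ≠ D.verts)
    (h2 : 2 ≤ R.card) : ∃ u v, u ≠ v ∧ Bd D R u ∧ Bd D R v := by
  by_contra hcon
  push Not at hcon
  have hu : ∃ u ∈ R, ∀ v, Bd D R v → v = u := by
    by_cases hb : ∃ u, Bd D R u
    · obtain ⟨u, hu⟩ := hb
      refine ⟨u, hu.1, fun v hv => ?_⟩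
      by_contra hne
      exact hcon v u hne hv hu
    · push Not at hb
      obtain ⟨u, hu⟩ := Finset.card_pos.1 (show 0 < R.card by omega)
      exact ⟨u, hu, fun v hv => absurd hv (hb v)⟩
  obtain ⟨u, huR, hub⟩ := hu
  obtain ⟨w, hw, hwR⟩ : ∃ w ∈ D.verts, w ∉ R := by
    by_contra hh
    push Not at hh
    exact hne (Finset.Subset.antisymm hR hh)
  obtain ⟨φ1, f1, h1⟩ := h.col_on hw hwR
  obtain ⟨t, ht, htu⟩ : ∃ t ∈ R, t ≠ u := by
    by_contra hh
    push Not at hh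
    have : R ⊆ {u} := fun x hx => by simp [hh x hx]
    have := Finset.card_le_card this
    simp at this
    omega
  obtain ⟨φ2, f2, h2⟩ := h.col_on (R := insert u (D.verts \ R)) (v := t) (hR ht) (by simp [htu, ht])
  obtain ⟨σ, hσ⟩ := perm_to (φ2 u) (φ1 u)
  apply h.1
  refine ⟨fun v => if v ∈ R then φ1 v else σ (φ2 v),
    fun v => if v ∈ R then f1 v + f2 u else f2 v + f1 u, fun a b hab => ?_⟩
  have hm := D.adj_mem hab
  by_cases ha : a ∈ R <;> by_cases hb : b ∈ R <;> simp only [ha, hb, if_true, if_false]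
  · intro he
    have := h1 a b ⟨hab, ha, hb⟩ he
    omega
  · have : a = u := hub a ⟨ha, b, hm.2, hb, Or.inl hab⟩
    subst this
    intro he
    rw [← hσ] at he
    have := h2 a b ⟨hab, by simp, by simp [hb, hm.2]⟩ (σ.injective he)
    omega
  · have : b = u := hub b ⟨hb, a, hm.1, ha, Or.inr hab⟩
    subst this
    intro he
    rw [← hσ] at he
    have := h2 a b ⟨hab, by simp [ha, hm.1], by simp⟩ (σ.injective he)
    omega
  · intro he
    have := h2 a b ⟨hab, by simp [ha, hm.1], by simp [hb, hm.2]⟩ (σ.injective he)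
    omega

end Pf
end PfSection

noncomputable section PfSection
open scoped Classical
namespace Pf
open Dgr

/-- arcs within `S` but not inside `R` -/
def arO (A : ℕ → ℕ → Prop) (R S : Finset ℕ) : Finset (ℕ × ℕ) :=
  (ar A S).filter (fun p => ¬ (p.1 ∈ R ∧ p.2 ∈ R))

theorem mem_arO {A : ℕ → ℕ → Prop} {R S : Finset ℕ} {p : ℕ × ℕ} :
    p ∈ arO A R S ↔ (p.1 ∈ S ∧ p.2 ∈ S ∧ A p.1 p.2) ∧ ¬ (p.1 ∈ R ∧ p.2 ∈ R) := by
  simp [arO, mem_ar]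

theorem ar_split (A : ℕ → ℕ → Prop) {R S : Finset ℕ} (h : R ⊆ S) :
    (ar A S).card = (ar A R).card + (arO A R S).card := by
  have h1 : ar A R = (ar A S).filter (fun p => (p.1 ∈ R ∧ p.2 ∈ R)) := by
    ext p
    simp only [mem_ar, Finset.mem_filter]
    constructor
    · rintro ⟨h1, h2, h3⟩
      exact ⟨⟨h h1, h h2, h3⟩, h1, h2⟩
    · rintro ⟨⟨_, _, h3⟩, h1, h2⟩
      exact ⟨h1, h2, h3⟩
  rw [h1, arO, Finset.card_filter_add_card_filter_not]

def lab (R : Finset ℕ) (φ : ℕ → Fin 3) (N v : ℕ) : ℕ := if v ∈ R then N + (φ v : ℕ) else v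

theorem lab_in {R : Finset ℕ} {φ : ℕ → Fin 3} {N v : ℕ} (h : v ∈ R) : lab R φ N v = N + (φ v : ℕ) :=
  if_pos h

theorem lab_out {R : Finset ℕ} {φ : ℕ → Fin 3} {N v : ℕ} (h : v ∉ R) : lab R φ N v = v :=
  if_neg h

def XX (W : Dgr) (N : ℕ) : Finset ℕ := W.verts.filter (fun x => N ≤ x)
def YY (W : Dgr) (N : ℕ) : Finset ℕ := W.verts.filter (fun x => ¬ N ≤ x)

structure Ext (G : Dgr) (R : Finset ℕ) (φ : ℕ → Fin 3) (N : ℕ) (W : Dgr) : Prop where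
  crit : Crit W
  sub : R ⊆ G.verts
  lt : ∀ v ∈ G.verts, v < N
  low : ∀ x ∈ W.verts, ¬ N ≤ x → x ∈ G.verts ∧ x ∉ R
  high : ∀ x ∈ W.verts, N ≤ x → x < N + 3
  adj : ∀ x y, W.Adj x y → ¬ (N ≤ x ∧ N ≤ y) →
    ∃ u v, G.Adj u v ∧ ¬ (u ∈ R ∧ v ∈ R) ∧ lab R φ N u = x ∧ lab R φ N v = y
  ne : (XX W N).Nonempty

theorem exists_ext {G : Dgr} (hG : Crit G) {R : Finset ℕ} (hR : R ⊆ G.verts) (hRne : R.Nonempty)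
    (φ : ℕ → Fin 3) (f : ℕ → ℕ)
    (hf : ∀ u v, u ∈ R → v ∈ R → G.Adj u v → φ u = φ v → f u < f v) :
    ∃ N W, Ext G R φ N W ∧ W.verts.card + R.card ≤ G.verts.card + 3 := by
  obtain ⟨N, hN⟩ : ∃ N, ∀ v ∈ G.verts, v < N :=
    ⟨G.verts.sup id + 1, fun v hv => Nat.lt_succ_of_le (Finset.le_sup (f := id) hv)⟩
  set A : ℕ → ℕ → Prop := fun x y => (N ≤ x ∧ N ≤ y) ∨
    ∃ u v, G.Adj u v ∧ ¬ (u ∈ R ∧ v ∈ R) ∧ lab R φ N u = x ∧ lab R φ N v = y with hA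
  set V : Finset ℕ := (G.verts \ R) ∪ Finset.Ico N (N + 3) with hV
  have hlV : ∀ v ∈ G.verts, lab R φ N v ∈ V := by
    intro v hv
    by_cases h : v ∈ R
    · rw [lab_in h, hV, Finset.mem_union, Finset.mem_Ico]
      have := (φ v).2
      omega
    · rw [lab_out h, hV, Finset.mem_union, Finset.mem_sdiff]
      exact Or.inl ⟨hv, h⟩
  have hnc : ¬ Col (fun u v => u ∈ V ∧ v ∈ V ∧ u ≠ v ∧ A u v) := by
    rintro ⟨ψ, g, hg⟩
    apply hG.1
    refine col_of_rank (α := ℕ ×ₗ ℕ) G.verts (fun u v h => (G.adj_mem h).1)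
      (fun v => ψ (lab R φ N v)) (fun v => toLex (g (lab R φ N v), f v)) ?_
    intro u v huv he
    have hm := G.adj_mem huv
    have hne : u ≠ v := by
      rintro rfl
      exact G.adj_irrefl _ huv
    rw [Prod.Lex.toLex_lt_toLex]
    by_cases hl : lab R φ N u = lab R φ N v
    · right
      refine ⟨by rw [hl], ?_⟩
      by_cases hu : u ∈ R <;> by_cases hv : v ∈ R
      · rw [lab_in hu, lab_in hv] at hl
        exact hf u v hu hv huv (Fin.ext (by omega))
      · rw [lab_in hu, lab_out hv] at hl
        have := hN v hm.2
        omega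
      · rw [lab_out hu, lab_in hv] at hl
        have := hN u hm.1
        omega
      · rw [lab_out hu, lab_out hv] at hl
        exact absurd hl hne
    · left
      refine hg _ _ ⟨hlV u hm.1, hlV v hm.2, hl, ?_⟩ he
      by_cases hb : u ∈ R ∧ v ∈ R
      · left
        rw [lab_in hb.1, lab_in hb.2]
        omega
      · right
        exact ⟨u, v, huv, hb, rfl, rfl⟩
  obtain ⟨W, hW, hWV, hWA⟩ := exists_crit V A hnc
  have low : ∀ x ∈ W.verts, ¬ N ≤ x → x ∈ G.verts ∧ x ∉ R := by
    intro x hx hlt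
    have := hWV hx
    rw [hV, Finset.mem_union, Finset.mem_sdiff, Finset.mem_Ico] at this
    rcases this with h | h
    · exact h
    · omega
  refine ⟨N, W, ⟨hW, hR, hN, low, ?_, ?_, ?_⟩, ?_⟩
  · intro x hx hge
    have := hWV hx
    rw [hV, Finset.mem_union, Finset.mem_sdiff, Finset.mem_Ico] at this
    rcases this with h | h
    · have := hN x h.1
      omega
    · omega
  · intro x y hxy hn
    rcases hWA x y hxy with h | h
    · exact absurd h hn
    · exact h
  · by_contra hne
    rw [Finset.not_nonempty_iff_eq_empty] at hne
    have hlow : ∀ x ∈ W.verts, ¬ N ≤ x := by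
      intro x hx hge
      have : x ∈ XX W N := Finset.mem_filter.2 ⟨hx, hge⟩
      rw [hne] at this
      simp at this
    obtain ⟨r, hr⟩ := hRne
    apply hW.1
    refine (hG.col_on (R := G.verts.erase r) (hR hr) (by simp)).mono ?_
    intro x y hxy
    have hm := W.adj_mem hxy
    have hx := hlow x hm.1
    have hy := hlow y hm.2
    rcases hWA x y hxy with h | ⟨u, v, huv, hb, h1, h2⟩
    · omega
    · have hu : u ∉ R := fun h => by
        rw [lab_in h] at h1
        omega
      have hv : v ∉ R := fun h => by
        rw [lab_in h] at h2
        omega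
      rw [lab_out hu] at h1
      rw [lab_out hv] at h2
      subst h1 h2
      refine ⟨huv, Finset.mem_erase.2 ⟨?_, (G.adj_mem huv).1⟩,
        Finset.mem_erase.2 ⟨?_, (G.adj_mem huv).2⟩⟩
      · rintro rfl
        exact hu hr
      · rintro rfl
        exact hv hr
  · have h1 := Finset.card_le_card hWV
    have h2 : V.card ≤ (G.verts \ R).card + 3 := by
      refine (Finset.card_union_le _ _).trans ?_
      simp
    rw [Finset.card_sdiff_of_subset hR] at h2
    have := Finset.card_le_card hR
    omega

section
variable {G W : Dgr} {R : Finset ℕ} {φ : ℕ → Fin 3} {N : ℕ}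

theorem mem_XX {x : ℕ} : x ∈ XX W N ↔ x ∈ W.verts ∧ N ≤ x := by simp [XX]
theorem mem_YY {x : ℕ} : x ∈ YY W N ↔ x ∈ W.verts ∧ ¬ N ≤ x := by simp [YY]

theorem Ext.img (h : Ext G R φ N W) : arO W.Adj (XX W N) W.verts ⊆
    (arO G.Adj R (R ∪ YY W N)).image (fun p => (lab R φ N p.1, lab R φ N p.2)) := by
  rintro ⟨x, y⟩ hp
  rw [mem_arO] at hp
  obtain ⟨⟨hx, hy, hxy⟩, hn⟩ := hp
  simp only [mem_XX] at hn hx hy hxy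
  obtain ⟨u, v, huv, hb, rfl, rfl⟩ := h.adj x y hxy (fun hh => hn ⟨⟨hx, hh.1⟩, hy, hh.2⟩)
  rw [Finset.mem_image]
  refine ⟨(u, v), ?_, rfl⟩
  rw [mem_arO]
  refine ⟨⟨?_, ?_, huv⟩, hb⟩
  · rw [Finset.mem_union]
    by_cases hu : u ∈ R
    · exact Or.inl hu
    · rw [lab_out hu] at hx
      have := h.lt u (G.adj_mem huv).1
      exact Or.inr (mem_YY.2 ⟨hx, by omega⟩)
  · rw [Finset.mem_union]
    by_cases hu : v ∈ R
    · exact Or.inl hu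
    · rw [lab_out hu] at hy
      have := h.lt v (G.adj_mem huv).2
      exact Or.inr (mem_YY.2 ⟨hy, by omega⟩)

theorem Ext.card_le (h : Ext G R φ N W) : (arO W.Adj (XX W N) W.verts).card ≤
    (arO G.Adj R (R ∪ YY W N)).card :=
  (Finset.card_le_card h.img).trans Finset.card_image_le

theorem Ext.X_le (h : Ext G R φ N W) : (XX W N).card ≤ 3 := by
  have : XX W N ⊆ Finset.Ico N (N + 3) := by
    intro x hx
    rw [mem_XX] at hx
    rw [Finset.mem_Ico]
    exact ⟨hx.2, h.high x hx.1 hx.2⟩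
  simpa using Finset.card_le_card this

theorem Ext.pt_eq (h : Ext G R φ N W) :
    pt G.Adj (R ∪ YY W N) + 3 * ((arO G.Adj R (R ∪ YY W N)).card : ℤ)
      - 3 * ((arO W.Adj (XX W N) W.verts).card : ℤ) =
    pt G.Adj R + pt W.Adj W.verts - 10 * ((XX W N).card : ℤ) + 3 * ((ar W.Adj (XX W N)).card : ℤ) := by
  have h1 := ar_split G.Adj (Finset.subset_union_left : R ⊆ R ∪ YY W N)
  have hs : XX W N ⊆ W.verts := Finset.filter_subset _ _
  have h2 := ar_split W.Adj hs
  have h3 : (R ∪ YY W N).card = R.card + (YY W N).card := by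
    apply Finset.card_union_of_disjoint
    rw [Finset.disjoint_left]
    intro x hx hy
    rw [mem_YY] at hy
    exact (h.low x hy.1 hy.2).2 hx
  have h4 : (XX W N).card + (YY W N).card = W.verts.card :=
    Finset.card_filter_add_card_filter_not _
  unfold pt
  omega

/-- The main inequality, with its cases -/
theorem Ext.cases (h : Ext G R φ N W) :
    ((XX W N).card = 1 ∧ pt G.Adj (R ∪ YY W N) + 3 * ((arO G.Adj R (R ∪ YY W N)).card : ℤ)
      - 3 * ((arO W.Adj (XX W N) W.verts).card : ℤ) = pt G.Adj R + pt W.Adj W.verts - 10) ∨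
    ((XX W N).card = 2 ∧ pt G.Adj (R ∪ YY W N) + 3 * ((arO G.Adj R (R ∪ YY W N)).card : ℤ)
      - 3 * ((arO W.Adj (XX W N) W.verts).card : ℤ) ≤ pt G.Adj R + pt W.Adj W.verts - 14) ∨
    ((XX W N).card = 3 ∧ pt G.Adj (R ∪ YY W N) + 3 * ((arO G.Adj R (R ∪ YY W N)).card : ℤ)
      - 3 * ((arO W.Adj (XX W N) W.verts).card : ℤ) =
       pt G.Adj R + pt W.Adj W.verts - 30 + 3 * ((ar W.Adj (XX W N)).card : ℤ) ∧
       (ar W.Adj (XX W N)).card ≤ 6) := by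
  have h1 := h.pt_eq
  have h2 := ar_card_le W.adj_irrefl (XX W N)
  have h3 := h.ne.card_pos
  have h4 := h.X_le
  generalize (XX W N).card = k at *
  interval_cases k
  · left
    omega
  · right; left
    omega
  · right; right
    omega

theorem Ext.surj (h : Ext G R φ N W)
    (he : (arO G.Adj R (R ∪ YY W N)).card ≤ (arO W.Adj (XX W N) W.verts).card)
    (hV : R ∪ YY W N = G.verts) {u v : ℕ} (huv : G.Adj u v) (hn : ¬ (u ∈ R ∧ v ∈ R)) :
    W.Adj (lab R φ N u) (lab R φ N v) := by
  have h1 : arO W.Adj (XX W N) W.verts =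
    (arO G.Adj R (R ∪ YY W N)).image (fun p => (lab R φ N p.1, lab R φ N p.2)) :=
    Finset.eq_of_subset_of_card_le h.img (Finset.card_image_le.trans he)
  have h2 : (u, v) ∈ arO G.Adj R (R ∪ YY W N) := by
    rw [mem_arO, hV]
    exact ⟨⟨(G.adj_mem huv).1, (G.adj_mem huv).2, huv⟩, hn⟩
  have h3 := Finset.mem_image_of_mem (fun p : ℕ × ℕ => (lab R φ N p.1, lab R φ N p.2)) h2
  rw [← h1, mem_arO] at h3
  exact h3.1.2.2

theorem Ext.inj (h : Ext G R φ N W)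
    (he : (arO G.Adj R (R ∪ YY W N)).card ≤ (arO W.Adj (XX W N) W.verts).card)
    (hV : R ∪ YY W N = G.verts) {u v u' v' : ℕ} (huv : G.Adj u v) (hn : ¬ (u ∈ R ∧ v ∈ R))
    (huv' : G.Adj u' v') (hn' : ¬ (u' ∈ R ∧ v' ∈ R)) (e1 : lab R φ N u = lab R φ N u')
    (e2 : lab R φ N v = lab R φ N v') : u = u' ∧ v = v' := by
  have h0 : ((arO G.Adj R (R ∪ YY W N)).image (fun p => (lab R φ N p.1, lab R φ N p.2))).card =
    (arO G.Adj R (R ∪ YY W N)).card :=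
    le_antisymm Finset.card_image_le (he.trans (Finset.card_le_card h.img))
  rw [Finset.card_image_iff] at h0
  have h2 : (u, v) ∈ arO G.Adj R (R ∪ YY W N) := by
    rw [mem_arO, hV]
    exact ⟨⟨(G.adj_mem huv).1, (G.adj_mem huv).2, huv⟩, hn⟩
  have h3 : (u', v') ∈ arO G.Adj R (R ∪ YY W N) := by
    rw [mem_arO, hV]
    exact ⟨⟨(G.adj_mem huv').1, (G.adj_mem huv').2, huv'⟩, hn'⟩
  have := h0 h2 h3 (by simp [e1, e2])
  simpa using this

/-- if nothing extra and only one label is used, all boundary vertices have the same colour -/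
theorem Ext.same (h : Ext G R φ N W)
    (he : (arO G.Adj R (R ∪ YY W N)).card ≤ (arO W.Adj (XX W N) W.verts).card)
    (hV : R ∪ YY W N = G.verts) (h1 : (XX W N).card = 1) {u v : ℕ} (hu : Bd G R u) (hv : Bd G R v) :
    φ u = φ v := by
  obtain ⟨z, hz⟩ := Finset.card_eq_one.1 h1
  have key : ∀ u, Bd G R u → N + (φ u : ℕ) = z := by
    rintro u ⟨hu, w, hw, hwR, ha⟩
    have : lab R φ N u ∈ XX W N := by
      rw [mem_XX]
      refine ⟨?_, by rw [lab_in hu]; omega⟩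
      rcases ha with ha | ha
      · exact (W.adj_mem (h.surj he hV ha (fun hh => hwR hh.2))).1
      · exact (W.adj_mem (h.surj he hV ha (fun hh => hwR hh.1))).2
    rw [hz, Finset.mem_singleton, lab_in hu] at this
    exact this
  have h2 := key u hu
  have h3 := key v hv
  exact Fin.ext (by omega)

end

def IHp (m : ℕ) : Prop := ∀ K, Crit K → K.verts.card < m →
  pt K.Adj K.verts ≤ 4 ∧ (4 ≤ pt K.Adj K.verts → IsOre4 K)

theorem P1 {G : Dgr} (hG : Crit G) (ih : IHp G.verts.card) (hp : 4 ≤ pt G.Adj G.verts)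
    {R : Finset ℕ} (hR : R ⊆ G.verts) (hne : R.Nonempty) (hpr : R ≠ G.verts) :
    10 ≤ pt G.Adj R := by
  by_contra hlt
  push Not at hlt
  set F := G.verts.powerset.filter (fun S => S ≠ G.verts ∧ 4 ≤ S.card) with hF
  have hRF : R ∈ F := by
    rw [hF, Finset.mem_filter, Finset.mem_powerset]
    refine ⟨hR, hpr, ?_⟩
    by_contra h3
    have := pt_small G.adj_irrefl hne (by omega)
    omega
  obtain ⟨S, hS, hmin⟩ := Finset.exists_min_image F (fun S => pt G.Adj S) ⟨R, hRF⟩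
  have hle := hmin R hRF
  rw [hF, Finset.mem_filter, Finset.mem_powerset] at hS
  obtain ⟨hSV, hSne, hS4⟩ := hS
  obtain ⟨w, hw, hwS⟩ : ∃ w ∈ G.verts, w ∉ S := by
    by_contra hh
    push Not at hh
    exact hSne (Finset.Subset.antisymm hSV hh)
  obtain ⟨φ, f, hf⟩ := hG.col_on hw hwS
  obtain ⟨N, W, hE, hc⟩ := exists_ext hG hSV (Finset.card_pos.1 (by omega)) φ f
    (fun u v hu hv h => hf u v ⟨h, hu, hv⟩)
  have hW := (ih W hE.crit (by omega)).1
  have hcl := hE.card_le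
  have hfin : pt G.Adj (S ∪ YY W N) ≤ pt G.Adj S - 6 := by
    rcases hE.cases with h | h | h <;> omega
  by_cases hV : S ∪ YY W N = G.verts
  · rw [hV] at hfin
    omega
  · have : S ∪ YY W N ∈ F := by
      rw [hF, Finset.mem_filter, Finset.mem_powerset]
      refine ⟨Finset.union_subset hSV ?_, hV, hS4.trans (Finset.card_le_card Finset.subset_union_left)⟩
      intro x hx
      rw [mem_YY] at hx
      exact (hE.low x hx.1 hx.2).1
    have := hmin _ this
    omega

end Pf
end PfSection

noncomputable section PfSection
open scoped Classical
namespace Pf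
open Dgr

/-- Ore composition, unpacked -/
structure OC (D1 D2 D : Dgr) (x y z : ℕ) (Z1 Z2 : Set ℕ) : Prop where
  b1 : Bidirected D1
  b2 : Bidirected D2
  disj : ∀ v, v ∈ D1.verts → v ∉ D2.verts
  hx : x ∈ D1.verts
  hy : y ∈ D1.verts
  hne : x ≠ y
  hxy : D1.Adj x y
  hz : z ∈ D2.verts
  hZ : ∀ w, D2.Adj z w ↔ (w ∈ Z1 ∨ w ∈ Z2)
  dZ : ∀ w, w ∈ Z1 → w ∉ Z2
  n1 : ∃ w, w ∈ Z1
  n2 : ∃ w, w ∈ Z2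
  verts : ∀ v, v ∈ D.verts ↔ (v ∈ D1.verts ∨ (v ∈ D2.verts ∧ v ≠ z))
  adj : ∀ u v, D.Adj u v ↔
      (D1.Adj u v ∧ ¬(u = x ∧ v = y) ∧ ¬(u = y ∧ v = x)) ∨
      (D2.Adj u v ∧ u ≠ z ∧ v ≠ z) ∨
      (u = x ∧ v ∈ Z1) ∨ (v = x ∧ u ∈ Z1) ∨
      (u = y ∧ v ∈ Z2) ∨ (v = y ∧ u ∈ Z2)

theorem oc_of {D1 D2 D : Dgr} (h : IsOreComp D1 D2 D) : ∃ x y z Z1 Z2, OC D1 D2 D x y z Z1 Z2 := by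
  obtain ⟨b1, b2, hd, x, y, z, Z1, Z2, hx, hy, hne, hxy, hz, hZ, dZ, n1, n2, hv, ha⟩ := h
  have hZ' : ∀ w, D2.Adj z w ↔ (w ∈ Z1 ∨ w ∈ Z2) := by
    intro w
    have : w ∈ Z1 ∪ Z2 ↔ w ∈ {w | D2.Adj z w} := by rw [hZ]
    rw [Set.mem_union] at this
    exact this.symm
  refine ⟨x, y, z, Z1, Z2, b1, b2, fun v h1 h2 => Finset.disjoint_left.1 hd h1 h2, hx, hy, hne, hxy,
    hz, hZ', fun w h1 h2 => Set.disjoint_left.1 dZ h1 h2, n1, n2, ?_, ?_⟩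
  · intro v
    rw [hv, Finset.mem_union, Finset.mem_erase]
    tauto
  · intro u v
    rw [ha]
    have i1 : ∀ w, w ∈ Z1 → D2.Adj z w := fun w h => (hZ' w).2 (Or.inl h)
    have i2 : ∀ w, w ∈ Z2 → D2.Adj z w := fun w h => (hZ' w).2 (Or.inr h)
    have j1 : ∀ w, w ∈ Z1 → D2.Adj w z := fun w h => b2 (i1 w h)
    have j2 : ∀ w, w ∈ Z2 → D2.Adj w z := fun w h => b2 (i2 w h)
    rw [and_iff_left_of_imp (i1 v), and_iff_left_of_imp (i2 v), and_iff_left_of_imp (j1 u),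
      and_iff_left_of_imp (j2 u)]

namespace OC
variable {D1 D2 D : Dgr} {x y z : ℕ} {Z1 Z2 : Set ℕ}

theorem symm (h : OC D1 D2 D x y z Z1 Z2) : OC D1 D2 D y x z Z2 Z1 where
  b1 := h.b1
  b2 := h.b2
  disj := h.disj
  hx := h.hy
  hy := h.hx
  hne := h.hne.symm
  hxy := h.b1 h.hxy
  hz := h.hz
  hZ := fun w => by rw [h.hZ, or_comm]
  dZ := fun w h2 h1 => h.dZ w h1 h2
  n1 := h.n2
  n2 := h.n1
  verts := h.verts
  adj := fun u v => by rw [h.adj]; tauto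

theorem Z1_mem (h : OC D1 D2 D x y z Z1 Z2) {w : ℕ} (hw : w ∈ Z1) : w ∈ D2.verts ∧ w ≠ z ∧ w ∉ D1.verts := by
  have h1 : D2.Adj z w := (h.hZ w).2 (Or.inl hw)
  refine ⟨(D2.adj_mem h1).2, ?_, fun h2 => h.disj w h2 (D2.adj_mem h1).2⟩
  rintro rfl
  exact D2.adj_irrefl _ h1

theorem bidir (h : OC D1 D2 D x y z Z1 Z2) : Bidirected D := by
  intro u v huv
  rw [h.adj] at huv ⊢
  have h1 := @h.b1 u v
  have h2 := @h.b2 u v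
  tauto

theorem adj11 (h : OC D1 D2 D x y z Z1 Z2) {u v : ℕ} (hu : u ∈ D1.verts) (hv : v ∈ D1.verts) :
    D.Adj u v ↔ (D1.Adj u v ∧ ¬(u = x ∧ v = y) ∧ ¬(u = y ∧ v = x)) := by
  rw [h.adj]
  have a1 : ¬ D2.Adj u v := fun h1 => h.disj u hu (D2.adj_mem h1).1
  have a2 : u ∉ Z1 := fun h1 => (h.Z1_mem h1).2.2 hu
  have a3 : v ∉ Z1 := fun h1 => (h.Z1_mem h1).2.2 hv
  have a4 : u ∉ Z2 := fun h1 => (h.symm.Z1_mem h1).2.2 hu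
  have a5 : v ∉ Z2 := fun h1 => (h.symm.Z1_mem h1).2.2 hv
  tauto

theorem adj22 (h : OC D1 D2 D x y z Z1 Z2) {u v : ℕ} (hu : u ∉ D1.verts) (hv : v ∉ D1.verts) :
    D.Adj u v ↔ (D2.Adj u v ∧ u ≠ z ∧ v ≠ z) := by
  rw [h.adj]
  have a1 : ¬ D1.Adj u v := fun h1 => hu (D1.adj_mem h1).1
  have a2 : u ≠ x := fun e => hu (e ▸ h.hx)
  have a3 : v ≠ x := fun e => hv (e ▸ h.hx)
  have a4 : u ≠ y := fun e => hu (e ▸ h.hy)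
  have a5 : v ≠ y := fun e => hv (e ▸ h.hy)
  tauto

theorem adj12 (h : OC D1 D2 D x y z Z1 Z2) {u v : ℕ} (hu : u ∈ D1.verts) (hv : v ∉ D1.verts) :
    D.Adj u v ↔ ((u = x ∧ v ∈ Z1) ∨ (u = y ∧ v ∈ Z2)) := by
  rw [h.adj]
  have a1 : ¬ D1.Adj u v := fun h1 => hv (D1.adj_mem h1).2
  have a3 : v ≠ x := fun e => hv (e ▸ h.hx)
  have a5 : v ≠ y := fun e => hv (e ▸ h.hy)
  have a2 : ¬ D2.Adj u v := fun h1 => h.disj u hu (D2.adj_mem h1).1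
  tauto

theorem sub1 (h : OC D1 D2 D x y z Z1 Z2) : D1.verts ⊆ D.verts := fun v hv => (h.verts v).2 (Or.inl hv)

theorem sub2 (h : OC D1 D2 D x y z Z1 Z2) : D2.verts.erase z ⊆ D.verts := fun v hv => by
  rw [Finset.mem_erase] at hv
  exact (h.verts v).2 (Or.inr hv.symm)

theorem z_notin (h : OC D1 D2 D x y z Z1 Z2) : z ∉ D1.verts := fun h1 => h.disj z h1 h.hz

/-- retraction -/
def tau (D1 : Dgr) (z u : ℕ) : ℕ := if u ∈ D1.verts then z else u

theorem tau_adj (h : OC D1 D2 D x y z Z1 Z2) {u v : ℕ} (huv : D.Adj u v)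
    (hn : ¬ (u ∈ D1.verts ∧ v ∈ D1.verts)) : D2.Adj (tau D1 z u) (tau D1 z v) := by
  by_cases hu : u ∈ D1.verts <;> by_cases hv : v ∈ D1.verts <;> simp only [tau, hu, hv, if_true, if_false]
  · exact absurd ⟨hu, hv⟩ hn
  · rw [h.adj12 hu hv] at huv
    rw [h.hZ]
    tauto
  · have := h.bidir huv
    rw [h.adj12 hv hu] at this
    apply h.b2
    rw [h.hZ]
    tauto
  · rw [h.adj22 hu hv] at huv
    exact huv.1

theorem tau_inj_r (h : OC D1 D2 D x y z Z1 Z2) {u v v' : ℕ} (huv : D.Adj u v) (huv' : D.Adj u v')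
    (hu : u ∉ D1.verts) (he : tau D1 z v = tau D1 z v') : v = v' := by
  have hv := (D.adj_mem huv).2
  have hv' := (D.adj_mem huv').2
  by_cases h1 : v ∈ D1.verts <;> by_cases h2 : v' ∈ D1.verts <;>
    simp only [tau, h1, h2, if_true, if_false] at he
  · have a1 := h.bidir huv
    have a2 := h.bidir huv'
    rw [h.adj12 h1 hu] at a1
    rw [h.adj12 h2 hu] at a2
    have := h.dZ u
    rcases a1 with a1 | a1 <;> rcases a2 with a2 | a2
    · rw [a1.1, a2.1]
    · exact absurd a2.2 (this a1.2)
    · exact absurd a1.2 (this a2.2)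
    · rw [a1.1, a2.1]
  · rw [h.verts] at hv'
    tauto
  · rw [h.verts] at hv
    tauto
  · exact he

theorem tau_surj_r (h : OC D1 D2 D x y z Z1 Z2) {u w : ℕ} (huw : D2.Adj u w) (hu : u ≠ z) :
    ∃ v, D.Adj u v ∧ tau D1 z v = w := by
  have hm := D2.adj_mem huw
  have hu1 : u ∉ D1.verts := fun h1 => h.disj u h1 hm.1
  by_cases hw : w = z
  · subst hw
    have := h.b2 huw
    rw [h.hZ] at this
    rcases this with h1 | h1
    · refine ⟨x, (h.adj _ _).2 ?_, by simp [tau, h.hx]⟩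
      tauto
    · refine ⟨y, (h.adj _ _).2 ?_, by simp [tau, h.hy]⟩
      tauto
  · have hw1 : w ∉ D1.verts := fun h1 => h.disj w h1 hm.2
    exact ⟨w, (h.adj22 hu1 hw1).2 ⟨huw, hu, hw⟩, by simp [tau, hw1]⟩

theorem deg2 (h : OC D1 D2 D x y z Z1 Z2) {u : ℕ} (hu : u ∈ D2.verts) (huz : u ≠ z) :
    (outN D u).card = (outN D2 u).card := by
  have hu1 : u ∉ D1.verts := fun h1 => h.disj u h1 hu
  refine Finset.card_bij (fun v _ => tau D1 z v) ?_ ?_ ?_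
  · intro v hv
    rw [mem_outN] at hv ⊢
    have := h.tau_adj hv (fun hh => hu1 hh.1)
    simpa [tau, hu1] using this
  · intro v hv v' hv' he
    rw [mem_outN] at hv hv'
    exact h.tau_inj_r hv hv' hu1 he
  · intro w hw
    rw [mem_outN] at hw
    obtain ⟨v, hv, he⟩ := h.tau_surj_r hw huz
    exact ⟨v, mem_outN.2 hv, he⟩

theorem arO_card (h : OC D1 D2 D x y z Z1 Z2) :
    (arO D.Adj D1.verts D.verts).card = (ar D2.Adj D2.verts).card := by
  refine Finset.card_bij (fun p _ => (tau D1 z p.1, tau D1 z p.2)) ?_ ?_ ?_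
  · rintro ⟨u, v⟩ hp
    rw [mem_arO] at hp
    have := h.tau_adj hp.1.2.2 hp.2
    rw [mem_ar]
    exact ⟨(D2.adj_mem this).1, (D2.adj_mem this).2, this⟩
  · rintro ⟨u, v⟩ hp ⟨u', v'⟩ hp' he
    rw [mem_arO] at hp hp'
    simp only [Prod.mk.injEq] at he hp hp'
    obtain ⟨⟨_, _, huv⟩, hn⟩ := hp
    obtain ⟨⟨_, _, huv'⟩, hn'⟩ := hp'
    have zz : ∀ w ∈ D.verts, w ∉ D1.verts → w ≠ z := by
      intro w hw hw1
      rw [h.verts] at hw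
      tauto
    by_cases hu : u ∈ D1.verts
    · have hv : v ∉ D1.verts := fun h1 => hn ⟨hu, h1⟩
      have e2 : v = v' := by
        by_cases hv' : v' ∈ D1.verts
        · have := he.2
          simp only [tau, hv, hv', if_true, if_false] at this
          exact absurd this (zz v (D.adj_mem huv).2 hv)
        · have := he.2
          simpa only [tau, hv, hv', if_true, if_false] using this
      subst e2
      exact Prod.ext (h.tau_inj_r (h.bidir huv) (h.bidir huv') hv he.1) rfl
    · have e1 : u = u' := by
        by_cases hu' : u' ∈ D1.verts
        · have := he.1
          simp only [tau, hu, hu', if_true, if_false] at this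
          exact absurd this (zz u (D.adj_mem huv).1 hu)
        · have := he.1
          simpa only [tau, hu, hu', if_true, if_false] using this
      subst e1
      exact Prod.ext rfl (h.tau_inj_r huv huv' hu he.2)
  · rintro ⟨u, w⟩ hp
    rw [mem_ar] at hp
    obtain ⟨hu, hw, huw⟩ := hp
    simp only at hu hw huw
    by_cases huz : u = z
    · have hwz : w ≠ z := by
        rintro rfl
        exact D2.adj_irrefl _ (huz ▸ huw)
      have hw1 : w ∉ D1.verts := fun h1 => h.disj w h1 hw
      obtain ⟨v, hv, he⟩ := h.tau_surj_r (h.b2 huw) hwz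
      refine ⟨(v, w), ?_, by simp only [he]; simp [tau, hw1]⟩
      rw [mem_arO]
      exact ⟨⟨(D.adj_mem hv).2, (D.adj_mem hv).1, h.bidir hv⟩, fun hh => hw1 hh.2⟩
    · have hu1 : u ∉ D1.verts := fun h1 => h.disj u h1 hu
      obtain ⟨v, hv, he⟩ := h.tau_surj_r huw huz
      refine ⟨(u, v), ?_, by simp only [he]; simp [tau, hu1]⟩
      rw [mem_arO]
      exact ⟨⟨(D.adj_mem hv).1, (D.adj_mem hv).2, hv⟩, fun hh => hu1 hh.1⟩

theorem ar1 (h : OC D1 D2 D x y z Z1 Z2) :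
    (ar D.Adj D1.verts).card + 2 = (ar D1.Adj D1.verts).card := by
  have h1 : ar D1.Adj D1.verts = insert (x, y) (insert (y, x) (ar D.Adj D1.verts)) := by
    ext ⟨u, v⟩
    simp only [Finset.mem_insert, mem_ar, Prod.mk.injEq]
    constructor
    · rintro ⟨hu, hv, ha⟩
      rw [h.adj11 hu hv]
      tauto
    · rintro (⟨rfl, rfl⟩ | ⟨rfl, rfl⟩ | ⟨hu, hv, ha⟩)
      · exact ⟨h.hx, h.hy, h.hxy⟩
      · exact ⟨h.hy, h.hx, h.b1 h.hxy⟩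
      · rw [h.adj11 hu hv] at ha
        exact ⟨hu, hv, ha.1⟩
  have h2 : (y, x) ∉ ar D.Adj D1.verts := by
    rw [mem_ar]
    rintro ⟨hu, hv, ha⟩
    rw [h.adj11 hu hv] at ha
    simp at ha
  have h3 : (x, y) ∉ insert (y, x) (ar D.Adj D1.verts) := by
    rw [Finset.mem_insert, mem_ar]
    rintro (he | ⟨hu, hv, ha⟩)
    · simp only [Prod.mk.injEq] at he
      exact h.hne he.1
    · rw [h.adj11 hu hv] at ha
      simp at ha
  rw [h1, Finset.card_insert_of_notMem h3, Finset.card_insert_of_notMem h2]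

theorem pt1 (h : OC D1 D2 D x y z Z1 Z2) : pt D.Adj D1.verts = pt D1.Adj D1.verts + 6 := by
  have := h.ar1
  unfold pt
  omega

theorem card_verts (h : OC D1 D2 D x y z Z1 Z2) : D.verts.card + 1 = D1.verts.card + D2.verts.card := by
  have h1 : D.verts = D1.verts ∪ D2.verts.erase z := by
    ext v
    rw [h.verts, Finset.mem_union, Finset.mem_erase]
    tauto
  rw [h1, Finset.card_union_of_disjoint, Finset.card_erase_of_mem h.hz]
  · have := Finset.card_pos.2 ⟨z, h.hz⟩
    omega
  · rw [Finset.disjoint_left]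
    intro v hv hv2
    exact h.disj v hv (Finset.mem_erase.1 hv2).2

theorem pt_eq (h : OC D1 D2 D x y z Z1 Z2) :
    pt D.Adj D.verts = pt D1.Adj D1.verts + pt D2.Adj D2.verts - 4 := by
  have h1 := h.ar1
  have h2 := h.arO_card
  have h3 := ar_split D.Adj h.sub1
  have h4 := h.card_verts
  unfold pt
  omega

theorem not_pc (h : OC D1 D2 D x y z Z1 Z2) (h1 : ¬ PC D1.Adj) (h2 : ¬ PC D2.Adj) : ¬ PC D.Adj := by
  rintro ⟨φ, hφ⟩
  by_cases he : φ x = φ y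
  · apply h2
    refine ⟨fun v => if v = z then φ x else φ v, fun u v huv => ?_⟩
    have key : ∀ w, D2.Adj z w → φ x ≠ φ w := by
      intro w hw
      rw [h.hZ] at hw
      rcases hw with hw | hw
      · exact hφ x w ((h.adj _ _).2 (by tauto))
      · rw [he]
        exact hφ y w ((h.adj _ _).2 (by tauto))
    by_cases hu : u = z
    · have hv : v ≠ z := by
        rintro rfl
        exact D2.adj_irrefl _ (hu ▸ huv)
      simp only [hu, hv, if_true, if_false]
      exact key v (hu ▸ huv)
    · by_cases hv : v = z
      · simp only [hu, hv, if_true, if_false]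
        exact (key u (h.b2 (hv ▸ huv))).symm
      · simp only [hu, hv, if_false]
        exact hφ u v ((h.adj _ _).2 (by tauto))
  · apply h1
    refine ⟨φ, fun u v huv => ?_⟩
    by_cases c1 : u = x ∧ v = y
    · rw [c1.1, c1.2]
      exact he
    · by_cases c2 : u = y ∧ v = x
      · rw [c2.1, c2.2]
        exact fun e => he e.symm
      · exact hφ u v ((h.adj _ _).2 (by tauto))

end OC

theorem k4_facts {D : Dgr} (h : IsBidirComplete 4 D) :
    Bidirected D ∧ pt D.Adj D.verts = 4 ∧ ¬ PC D.Adj ∧ ∀ v ∈ D.verts, (outN D v).card = 3 := by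
  obtain ⟨h4, ha⟩ := h
  have hne : ∀ u v, D.Adj u v → u ≠ v := by
    rintro u v h rfl
    exact D.adj_irrefl _ h
  refine ⟨fun u v huv => ha v (D.adj_mem huv).2 u (D.adj_mem huv).1 (hne u v huv).symm, ?_, ?_, ?_⟩
  · have : ar D.Adj D.verts = D.verts.offDiag := by
      ext ⟨u, v⟩
      rw [mem_ar, Finset.mem_offDiag]
      constructor
      · rintro ⟨h1, h2, h3⟩
        exact ⟨h1, h2, hne _ _ h3⟩
      · rintro ⟨h1, h2, h3⟩
        exact ⟨h1, h2, ha _ h1 _ h2 h3⟩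
    unfold pt
    rw [this, Finset.offDiag_card, h4]
    norm_num
  · rintro ⟨φ, hφ⟩
    have : ∃ x ∈ D.verts, ∃ y ∈ D.verts, x ≠ y ∧ φ x = φ y :=
      Finset.exists_ne_map_eq_of_card_lt_of_maps_to (t := Finset.univ) (by simp [h4]) (by simp)
    obtain ⟨x, hx, y, hy, hxy, he⟩ := this
    exact hφ x y (ha x hx y hy hxy) he
  · intro v hv
    have : outN D v = D.verts.erase v := by
      ext u
      rw [mem_outN, Finset.mem_erase]
      exact ⟨fun h => ⟨(hne _ _ h).symm, (D.adj_mem h).2⟩, fun h => ha v hv u h.2 h.1.symm⟩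
    rw [this, Finset.card_erase_of_mem hv, h4]

theorem ore_facts {D : Dgr} (h : IsOre4 D) :
    Bidirected D ∧ pt D.Adj D.verts = 4 ∧ ¬ PC D.Adj ∧ 4 ≤ D.verts.card := by
  induction h with
  | k4 D h =>
    obtain ⟨h1, h2, h3, h4⟩ := k4_facts h
    exact ⟨h1, h2, h3, h.1.ge⟩
  | comp D1 D2 D _ _ hc ih1 ih2 =>
    obtain ⟨x, y, z, Z1, Z2, oc⟩ := oc_of hc
    refine ⟨oc.bidir, ?_, oc.not_pc ih1.2.2.1 ih2.2.2.1, ih1.2.2.2.trans (Finset.card_le_card oc.sub1)⟩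
    rw [oc.pt_eq, ih1.2.1, ih2.2.1]
    norm_num

structure Em (G : Dgr) (T : Finset ℕ) : Prop where
  card : T.card = 3
  sub : T ⊆ G.verts
  adj : ∀ u ∈ T, ∀ v ∈ T, u ≠ v → G.Adj u v
  deg : ∀ v ∈ T, (outN G v).card = 3

theorem OC.em2 {D1 D2 D : Dgr} {x y z : ℕ} {Z1 Z2 : Set ℕ} (h : OC D1 D2 D x y z Z1 Z2)
    {T : Finset ℕ} (hT : Em D2 T) (hz : z ∉ T) : Em D T := by
  have hz' : ∀ u ∈ T, u ≠ z := fun u hu e => hz (e ▸ hu)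
  refine ⟨hT.card, fun v hv => h.sub2 (Finset.mem_erase.2 ⟨hz' v hv, hT.sub hv⟩), ?_, ?_⟩
  · intro u hu v hv huv
    exact (h.adj22 (fun h1 => h.disj u h1 (hT.sub hu)) (fun h1 => h.disj v h1 (hT.sub hv))).2
      ⟨hT.adj u hu v hv huv, hz' u hu, hz' v hv⟩
  · intro v hv
    rw [h.deg2 (hT.sub hv) (hz' v hv)]
    exact hT.deg v hv

theorem OC.pt2 {D1 D2 D : Dgr} {x y z : ℕ} {Z1 Z2 : Set ℕ} (h : OC D1 D2 D x y z Z1 Z2)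
    {S : Finset ℕ} (hS : S ⊆ D2.verts) (hz : z ∉ S) : S ⊆ D.verts ∧ pt D.Adj S = pt D2.Adj S := by
  have hz' : ∀ u ∈ S, u ≠ z := fun u hu e => hz (e ▸ hu)
  refine ⟨fun v hv => h.sub2 (Finset.mem_erase.2 ⟨hz' v hv, hS hv⟩), pt_congr ?_⟩
  intro u hu v hv
  rw [h.adj22 (fun h1 => h.disj u h1 (hS hu)) (fun h1 => h.disj v h1 (hS hv))]
  have := hz' u hu
  have := hz' v hv
  tauto

theorem L8 {G : Dgr} (h : IsOre4 G) : ∀ v, (∃ S ⊆ G.verts, v ∉ S ∧ 4 ≤ S.card ∧ pt G.Adj S ≤ 10) ∨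
    ∃ T, Em G T ∧ v ∉ T := by
  induction h with
  | k4 D h =>
    intro v
    right
    obtain ⟨h1, h2, h3, h4⟩ := k4_facts h
    have : 3 ≤ (D.verts.erase v).card := by
      have := Finset.pred_card_le_card_erase (s := D.verts) (a := v)
      rw [h.1] at this
      exact this
    obtain ⟨T, hT, hT3⟩ := Finset.exists_subset_card_eq this
    have hs : T ⊆ D.verts := hT.trans (Finset.erase_subset _ _)
    exact ⟨T, ⟨hT3, hs, fun u hu v hv => h.2 u (hs hu) v (hs hv), fun v hv => h4 v (hs hv)⟩,
      fun hv => by simpa using hT hv⟩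
  | comp D1 D2 D o1 o2 hc ih1 ih2 =>
    intro v
    obtain ⟨x, y, z, Z1, Z2, oc⟩ := oc_of hc
    by_cases hv : v ∈ D2.verts ∧ v ≠ z
    · left
      refine ⟨D1.verts, oc.sub1, fun h1 => oc.disj v h1 hv.1, (ore_facts o1).2.2.2, ?_⟩
      rw [oc.pt1, (ore_facts o1).2.1]
      norm_num
    · rcases ih2 z with ⟨S, hS, hz, h4, hp⟩ | ⟨T, hT, hz⟩
      · left
        obtain ⟨a, b⟩ := oc.pt2 hS hz
        refine ⟨S, a, fun hvS => hv ⟨hS hvS, fun e => hz (e ▸ hvS)⟩, h4, by rw [b]; exact hp⟩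
      · right
        exact ⟨T, oc.em2 hT hz, fun hvS => hv ⟨hT.sub hvS, fun e => hz (e ▸ hvS)⟩⟩

def C9 (G : Dgr) (T : Finset ℕ) : Prop :=
  (∃ S ⊆ G.verts, Disjoint S T ∧ 4 ≤ S.card ∧ pt G.Adj S ≤ 10) ∨ ∃ T', Em G T' ∧ Disjoint T' T

def Tri (G : Dgr) (T : Finset ℕ) : Prop :=
  T.card = 3 ∧ T ⊆ G.verts ∧ ∀ u ∈ T, ∀ v ∈ T, u ≠ v → G.Adj u v

theorem L9aux {D1 D2 D : Dgr} {x y z : ℕ} {Z1 Z2 : Set ℕ} (oc : OC D1 D2 D x y z Z1 Z2)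
    (o1 : IsOre4 D1) (ih : ∀ T, Tri D2 T → D2.verts.card = 4 ∨ C9 D2 T)
    {T : Finset ℕ} (hT : Tri D T) (hx : x ∈ T) {t : ℕ} (ht : t ∈ T) (ht1 : t ∉ D1.verts) : C9 D T := by
  obtain ⟨h3, hs, ha⟩ := hT
  have hyT : y ∉ T := by
    intro hy
    have := ha x hx y hy oc.hne
    rw [oc.adj11 oc.hx oc.hy] at this
    tauto
  have hother : ∀ s ∈ T, s ≠ x → s ∉ D1.verts := by
    intro s hs hsx hs1
    have hst : s ≠ t := by
      rintro rfl
      exact ht1 hs1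
    have := ha s hs t ht hst
    rw [oc.adj12 hs1 ht1] at this
    rcases this with h | h
    · exact hsx h.1
    · exact hyT (h.1 ▸ hs)
  have hZ1 : ∀ s ∈ T, s ≠ x → s ∈ Z1 := by
    intro s hs hsx
    have := ha x hx s hs hsx.symm
    rw [oc.adj12 oc.hx (hother s hs hsx)] at this
    rcases this with h | h
    · exact h.2
    · exact absurd h.1 oc.hne
  have hcard : (T.erase x).card = 2 := by rw [Finset.card_erase_of_mem hx, h3]
  have hzT : z ∉ T.erase x := by
    intro hz
    rw [Finset.mem_erase] at hz
    exact (oc.Z1_mem (hZ1 z hz.2 hz.1)).2.1 rfl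
  have hT' : Tri D2 (insert z (T.erase x)) := by
    refine ⟨by rw [Finset.card_insert_of_notMem hzT, hcard], ?_, ?_⟩
    · intro s hs
      rw [Finset.mem_insert, Finset.mem_erase] at hs
      rcases hs with rfl | hs
      · exact oc.hz
      · exact (oc.Z1_mem (hZ1 s hs.2 hs.1)).1
    · have key : ∀ s, s ∈ T → s ≠ x → D2.Adj z s := fun s hs hsx =>
        (oc.hZ s).2 (Or.inl (hZ1 s hs hsx))
      intro u hu v hv huv
      rw [Finset.mem_insert, Finset.mem_erase] at hu hv
      rcases hu with rfl | hu <;> rcases hv with rfl | hv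
      · exact absurd rfl huv
      · exact key v hv.2 hv.1
      · exact oc.b2 (key u hu.2 hu.1)
      · have := ha u hu.2 v hv.2 huv
        rw [oc.adj22 (hother u hu.2 hu.1) (hother v hv.2 hv.1)] at this
        exact this.1
  have hdis : ∀ S : Finset ℕ, S ⊆ D2.verts → Disjoint S (insert z (T.erase x)) → z ∉ S ∧ Disjoint S T := by
    intro S hS hd
    rw [Finset.disjoint_left] at hd
    refine ⟨fun h => hd h (by simp), ?_⟩
    rw [Finset.disjoint_left]
    intro s hsS hsT
    apply hd hsS
    rw [Finset.mem_insert, Finset.mem_erase]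
    refine Or.inr ⟨?_, hsT⟩
    rintro rfl
    exact oc.disj _ oc.hx (hS hsS)
  rcases ih _ hT' with h4 | ⟨S, hS, hd, h4, hp⟩ | ⟨T', hT', hd⟩
  · -- `D2` is complete on four vertices
    have hdis1 : ∀ S : Finset ℕ, S ⊆ D1.verts → x ∉ S → Disjoint S T := by
      intro S hS hxS
      rw [Finset.disjoint_left]
      intro s hsS hsT
      exact hother s hsT (fun e => hxS (e ▸ hsS)) (hS hsS)
    rcases L8 o1 x with ⟨S, hS, hxS, hS4, hp⟩ | ⟨T', hT', hxT'⟩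
    · left
      refine ⟨S, hS.trans oc.sub1, hdis1 S hS hxS, hS4, ?_⟩
      have : pt D.Adj S = pt D1.Adj S := by
        apply pt_congr
        intro u hu v hv
        rw [oc.adj11 (hS hu) (hS hv)]
        have : u ≠ x := fun e => hxS (e ▸ hu)
        have : v ≠ x := fun e => hxS (e ▸ hv)
        tauto
      rw [this]
      exact hp
    · right
      have hx' : ∀ u ∈ T', u ≠ x := fun u hu e => hxT' (e ▸ hu)
      refine ⟨T', ⟨hT'.card, hT'.sub.trans oc.sub1, ?_, ?_⟩, hdis1 T' hT'.sub hxT'⟩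
      · intro u hu v hv huv
        rw [oc.adj11 (hT'.sub hu) (hT'.sub hv)]
        have := hx' u hu
        have := hx' v hv
        have := hT'.adj u hu v hv huv
        tauto
      · intro v hv
        rw [← hT'.deg v hv]
        by_cases hvy : v = y
        · subst hvy
          -- `Z2` is a singleton
          obtain ⟨w, hw⟩ := oc.n2
          have hwuniq : ∀ w', w' ∈ Z2 → w' = w := by
            intro w' hw'
            by_contra hne
            have hsub : insert w' (insert w (insert z (T.erase x))) ⊆ D2.verts := by
              intro s hs
              rw [Finset.mem_insert, Finset.mem_insert] at hs
              rcases hs with rfl | rfl | hs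
              · exact (oc.symm.Z1_mem hw').1
              · exact (oc.symm.Z1_mem hw).1
              · exact ‹Tri D2 _›.2.1 hs
            have nin : ∀ w, w ∈ Z2 → w ∉ insert z (T.erase x) := by
              intro w hw hh
              rw [Finset.mem_insert, Finset.mem_erase] at hh
              rcases hh with rfl | hh
              · exact (oc.symm.Z1_mem hw).2.1 rfl
              · exact oc.dZ w (hZ1 w hh.2 hh.1) hw
            have := Finset.card_le_card hsub
            rw [Finset.card_insert_of_notMem, Finset.card_insert_of_notMem (nin w hw),
              Finset.card_insert_of_notMem hzT, hcard] at this
            · omega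
            · rw [Finset.mem_insert]
              rintro (h | h)
              · exact hne h
              · exact nin w' hw' h
          have e1 : outN D v = insert w ((outN D1 v).erase x) := by
            ext u
            rw [mem_outN, Finset.mem_insert, Finset.mem_erase, mem_outN]
            constructor
            · intro hu
              by_cases hu1 : u ∈ D1.verts
              · rw [oc.adj11 oc.hy hu1] at hu
                tauto
              · rw [oc.adj12 oc.hy hu1] at hu
                rcases hu with hu | hu
                · exact absurd hu.1.symm oc.hne
                · exact Or.inl (hwuniq u hu.2)
            · rintro (rfl | ⟨hux, hu⟩)
              · rw [oc.adj]
                tauto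
              · rw [oc.adj]
                have := oc.hne
                tauto
          have hxm : x ∈ outN D1 v := mem_outN.2 (oc.b1 oc.hxy)
          rw [e1, Finset.card_insert_of_notMem, Finset.card_erase_of_mem hxm]
          · have := Finset.card_pos.2 ⟨x, hxm⟩
            omega
          · intro hh
            rw [Finset.mem_erase, mem_outN] at hh
            exact (oc.symm.Z1_mem hw).2.2 (D1.adj_mem hh.2).2
        · congr 1
          ext u
          rw [mem_outN, mem_outN]
          have hvx := hx' v hv
          by_cases hu1 : u ∈ D1.verts
          · rw [oc.adj11 (hT'.sub hv) hu1]
            tauto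
          · rw [oc.adj12 (hT'.sub hv) hu1]
            have : ¬ D1.Adj v u := fun h => hu1 (D1.adj_mem h).2
            tauto
  · left
    obtain ⟨hz, hd'⟩ := hdis S hS hd
    obtain ⟨a, b⟩ := oc.pt2 hS hz
    exact ⟨S, a, hd', h4, by rw [b]; exact hp⟩
  · right
    obtain ⟨hz, hd'⟩ := hdis T' hT'.sub hd
    exact ⟨T', oc.em2 hT' hz, hd'⟩

theorem L9 {G : Dgr} (h : IsOre4 G) : ∀ T, Tri G T → G.verts.card = 4 ∨ C9 G T := by
  induction h with
  | k4 D h =>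
    intro T hT
    exact Or.inl h.1
  | comp D1 D2 D o1 o2 hc ih1 ih2 =>
    intro T hT
    right
    obtain ⟨x, y, z, Z1, Z2, oc⟩ := oc_of hc
    by_cases hsub : T ⊆ D1.verts
    · have hd : ∀ S : Finset ℕ, S ⊆ D2.verts → Disjoint S T := by
        intro S hS
        rw [Finset.disjoint_left]
        intro s hs hsT
        exact oc.disj s (hsub hsT) (hS hs)
      rcases L8 o2 z with ⟨S, hS, hz, h4, hp⟩ | ⟨T', hT', hz⟩
      · left
        obtain ⟨a, b⟩ := oc.pt2 hS hz
        exact ⟨S, a, hd S hS, h4, by rw [b]; exact hp⟩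
      · right
        exact ⟨T', oc.em2 hT' hz, hd T' hT'.sub⟩
    · rw [Finset.not_subset] at hsub
      obtain ⟨t, ht, ht1⟩ := hsub
      by_cases hx : x ∈ T
      · exact L9aux oc o1 ih2 hT hx ht ht1
      · by_cases hy : y ∈ T
        · exact L9aux oc.symm o1 ih2 hT hy ht ht1
        · left
          refine ⟨D1.verts, oc.sub1, ?_, (ore_facts o1).2.2.2, ?_⟩
          · rw [Finset.disjoint_left]
            intro s hs1 hsT
            have hst : s ≠ t := by
              rintro rfl
              exact ht1 hs1
            have := hT.2.2 s hsT t ht hst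
            rw [oc.adj12 hs1 ht1] at this
            rcases this with h | h
            · exact hx (h.1 ▸ hsT)
            · exact hy (h.1 ▸ hsT)
          · rw [oc.pt1, (ore_facts o1).2.1]
            norm_num

end Pf
end PfSection

noncomputable section PfSection
open scoped Classical
namespace Pf
open Dgr

theorem perm_two {a b c d : Fin 3} (h1 : a ≠ b) (h2 : c ≠ d) :
    ∃ σ : Equiv.Perm (Fin 3), σ a = c ∧ σ b = d := by
  revert a b c d
  decide

/-- the digraph induced on `S`, plus the digon `[x,y]` -/
def gS (G : Dgr) (S : Finset ℕ) (x y : ℕ) : Dgr :=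
  mkD S (fun u v => G.Adj u v ∨ (u = x ∧ v = y) ∨ (u = y ∧ v = x))

theorem gS_adj {G : Dgr} {S : Finset ℕ} {x y : ℕ} (hx : x ∈ S) (hy : y ∈ S) (hxy : x ≠ y) {u v : ℕ} :
    (gS G S x y).Adj u v ↔ ((G.Adj u v ∧ u ∈ S ∧ v ∈ S) ∨ (u = x ∧ v = y) ∨ (u = y ∧ v = x)) := by
  constructor
  · rintro ⟨h1, h2, h3, h4 | h4⟩
    · exact Or.inl ⟨h4, h1, h2⟩
    · exact Or.inr h4
  · rintro (⟨h1, h2, h3⟩ | ⟨rfl, rfl⟩ | ⟨rfl, rfl⟩)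
    · refine ⟨h2, h3, ?_, Or.inl h1⟩
      rintro rfl
      exact G.adj_irrefl _ h1
    · exact ⟨hx, hy, hxy, Or.inr (Or.inl ⟨rfl, rfl⟩)⟩
    · exact ⟨hy, hx, hxy.symm, Or.inr (Or.inr ⟨rfl, rfl⟩)⟩

structure Dec (G : Dgr) (S : Finset ℕ) (x y : ℕ) : Prop where
  sub : S ⊆ G.verts
  ne : S ≠ G.verts
  hx : x ∈ S
  hy : y ∈ S
  hxy : x ≠ y
  na : ¬ G.Adj x y
  cut : ∀ u ∈ S, ∀ v, v ∉ S → G.Adj u v → u = x ∨ u = y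
  npc : ¬ PC (gS G S x y).Adj

theorem ore_dec {G : Dgr} (h : IsOre4 G) : IsBidirComplete 4 G ∨ ∃ S x y, Dec G S x y := by
  cases h with
  | k4 _ h => exact Or.inl h
  | comp D1 D2 _ o1 o2 hc =>
    right
    obtain ⟨x, y, z, Z1, Z2, oc⟩ := oc_of hc
    refine ⟨D1.verts, x, y, oc.sub1, ?_, oc.hx, oc.hy, oc.hne, ?_, ?_, ?_⟩
    · intro he
      obtain ⟨w, hw⟩ := oc.n1
      have h1 := oc.Z1_mem hw
      have h2 : w ∈ G.verts := (oc.verts w).2 (Or.inr ⟨h1.1, h1.2.1⟩)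
      rw [← he] at h2
      exact h1.2.2 h2
    · rw [oc.adj11 oc.hx oc.hy]
      tauto
    · intro u hu v hv huv
      rw [oc.adj12 hu hv] at huv
      tauto
    · have : gS G D1.verts x y = D1 := by
        refine dgr_ext rfl (fun u v => ?_)
        rw [gS_adj oc.hx oc.hy oc.hne]
        constructor
        · rintro (⟨h1, h2, h3⟩ | ⟨rfl, rfl⟩ | ⟨rfl, rfl⟩)
          · exact ((oc.adj11 h2 h3).1 h1).1
          · exact oc.hxy
          · exact oc.b1 oc.hxy
        · intro h
          have hm := D1.adj_mem h
          rw [oc.adj11 hm.1 hm.2]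
          tauto
      rw [this]
      exact (ore_facts o1).2.2.1

namespace Dec
variable {G : Dgr} {S : Finset ℕ} {x y : ℕ}

theorem gadj (d : Dec G S x y) {u v : ℕ} :
    (gS G S x y).Adj u v ↔ ((G.Adj u v ∧ u ∈ S ∧ v ∈ S) ∨ (u = x ∧ v = y) ∨ (u = y ∧ v = x)) :=
  gS_adj d.hx d.hy d.hxy

theorem gbidir (d : Dec G S x y) (hb : Bidirected G) : Bidirected (gS G S x y) := by
  intro u v huv
  rw [d.gadj] at huv ⊢
  have := @hb u v
  tauto

theorem exists_out (d : Dec G S x y) : ∃ w ∈ G.verts, w ∉ S := by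
  by_contra hh
  push Not at hh
  exact d.ne (Finset.Subset.antisymm d.sub hh)

theorem glue (d : Dec G S x y) (hb : Bidirected G) {φ ψ : ℕ → Fin 3}
    (hφ : ∀ u v, G.Adj u v → ¬ (u ∈ S ∧ v ∈ S) → φ u ≠ φ v) (e1 : φ x = ψ x) (e2 : φ y = ψ y) :
    ∀ u v, G.Adj u v → ¬ (u ∈ S ∧ v ∈ S) →
      (if u ∈ S then ψ u else φ u) ≠ (if v ∈ S then ψ v else φ v) := by
  intro u v huv hn
  have h0 := hφ u v huv hn
  by_cases hu : u ∈ S <;> by_cases hv : v ∈ S <;> simp only [hu, hv, if_true, if_false]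
  · exact absurd ⟨hu, hv⟩ hn
  · rcases d.cut u hu v hv huv with rfl | rfl
    · rwa [← e1]
    · rwa [← e2]
  · rcases d.cut v hv u hu (hb huv) with rfl | rfl
    · rwa [← e1]
    · rwa [← e2]
  · exact h0

theorem force (d : Dec G S x y) (hG : Crit G) (hb : Bidirected G) {φ : ℕ → Fin 3}
    (hφ : ∀ u v, G.Adj u v → ¬ (u ∈ S ∧ v ∈ S) → φ u ≠ φ v) : φ x ≠ φ y := by
  intro he
  obtain ⟨w, hw, hwS⟩ := d.exists_out
  obtain ⟨ψ, hψ⟩ := (hG.col_on hw hwS).pc (fun u v h => ⟨hb h.1, h.2.2, h.2.1⟩)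
  have hxy : ψ x = ψ y := by
    by_contra hne
    apply d.npc
    refine ⟨ψ, fun u v huv => ?_⟩
    rw [d.gadj] at huv
    rcases huv with h | ⟨rfl, rfl⟩ | ⟨rfl, rfl⟩
    · exact hψ u v h
    · exact hne
    · exact fun e => hne e.symm
  obtain ⟨σ, hσ⟩ := perm_to (ψ x) (φ x)
  have hg := d.glue hb hφ (ψ := fun v => σ (ψ v)) hσ.symm (by rw [← he, ← hσ, hxy])
  apply hG.1
  refine PC.col ⟨fun v => if v ∈ S then σ (ψ v) else φ v, fun u v huv => ?_⟩
  by_cases hn : u ∈ S ∧ v ∈ S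
  · simp only [hn.1, hn.2, if_true]
    exact fun e => hψ u v ⟨huv, hn.1, hn.2⟩ (σ.injective e)
  · exact hg u v huv hn

theorem arc_in (d : Dec G S x y) : ∃ u v, G.Adj u v ∧ u ∈ S ∧ v ∈ S := by
  by_contra hh
  push Not at hh
  apply d.npc
  refine ⟨fun v => if v = x then 0 else 1, fun u v huv => ?_⟩
  rw [d.gadj] at huv
  have := d.hxy
  have := d.hxy.symm
  rcases huv with h | ⟨rfl, rfl⟩ | ⟨rfl, rfl⟩
  · exact absurd h.2.2 (hh u v h.1 h.2.1)
  · simp [*]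
  · simp [*]

theorem extend (d : Dec G S x y) (hG : Crit G) (hb : Bidirected G) {φ : ℕ → Fin 3}
    (hφ : φ x ≠ φ y) : ∃ φ' : ℕ → Fin 3, (∀ v ∈ S, φ' v = φ v) ∧
      ∀ u v, G.Adj u v → ¬ (u ∈ S ∧ v ∈ S) → φ' u ≠ φ' v := by
  obtain ⟨a, b, hab, ha, hb'⟩ := d.arc_in
  have hcol : Col (fun u v => G.Adj u v ∧ ¬ (u ∈ S ∧ v ∈ S)) :=
    hG.col_lt (fun u v h => h.1) hab (fun h => h.2 ⟨ha, hb'⟩)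
  obtain ⟨ψ, hψ⟩ := hcol.pc (fun u v h => ⟨hb h.1, fun hh => h.2 ⟨hh.2, hh.1⟩⟩)
  have hψ' : ∀ u v, G.Adj u v → ¬ (u ∈ S ∧ v ∈ S) → ψ u ≠ ψ v := fun u v h1 h2 => hψ u v ⟨h1, h2⟩
  have hne := d.force hG hb hψ'
  obtain ⟨σ, h1, h2⟩ := perm_two hne hφ
  refine ⟨fun v => if v ∈ S then φ v else σ (ψ v), fun v hv => by simp [hv], ?_⟩
  exact d.glue hb (φ := fun v => σ (ψ v)) (fun u v a1 a2 e => hψ' u v a1 a2 (σ.injective e)) h1 h2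

theorem crit (d : Dec G S x y) (hG : Crit G) (hb : Bidirected G) : Crit (gS G S x y) := by
  have hgb := d.gbidir hb
  refine crit_of (fun hc => d.npc (hc.pc (fun u v h => hgb h))) ?_ ?_
  · intro u v huv
    have key : PC (fun a b => (gS G S x y).Adj a b ∧ ¬ (a = u ∧ b = v) ∧ ¬ (a = v ∧ b = u)) := by
      rw [d.gadj] at huv
      by_cases hxy : (u = x ∧ v = y) ∨ (u = y ∧ v = x)
      · obtain ⟨w, hw, hwS⟩ := d.exists_out
        refine ((hG.col_on hw hwS).pc (fun u v h => ⟨hb h.1, h.2.2, h.2.1⟩)).mono ?_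
        rintro a b ⟨h1, h2, h3⟩
        rw [d.gadj] at h1
        rcases h1 with h1 | ⟨rfl, rfl⟩ | ⟨rfl, rfl⟩
        · exact h1
        · exfalso
          rcases hxy with ⟨rfl, rfl⟩ | ⟨rfl, rfl⟩
          · exact h2 ⟨rfl, rfl⟩
          · exact h3 ⟨rfl, rfl⟩
        · exfalso
          rcases hxy with ⟨rfl, rfl⟩ | ⟨rfl, rfl⟩
          · exact h3 ⟨rfl, rfl⟩
          · exact h2 ⟨rfl, rfl⟩
      · have huv' : G.Adj u v ∧ u ∈ S ∧ v ∈ S := by tauto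
        have hcol : Col (fun a b => G.Adj a b ∧ ¬ (a = u ∧ b = v) ∧ ¬ (a = v ∧ b = u)) :=
          hG.col_lt (fun u v h => h.1) huv'.1 (fun h => h.2.1 ⟨rfl, rfl⟩)
        obtain ⟨ψ, hψ⟩ := hcol.pc (fun a b h => ⟨hb h.1, fun hh => h.2.2 ⟨hh.2, hh.1⟩,
          fun hh => h.2.1 ⟨hh.2, hh.1⟩⟩)
        have hne := d.force hG hb (φ := ψ) (fun a b h1 h2 => hψ a b ⟨h1, by
          rintro ⟨rfl, rfl⟩
          exact h2 huv'.2, by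
          rintro ⟨rfl, rfl⟩
          exact h2 huv'.2.symm⟩)
        refine ⟨ψ, fun a b hab => ?_⟩
        obtain ⟨h1, h2⟩ := hab
        rw [d.gadj] at h1
        rcases h1 with h1 | ⟨rfl, rfl⟩ | ⟨rfl, rfl⟩
        · exact hψ a b ⟨h1.1, h2⟩
        · exact hne
        · exact hne.symm
    obtain ⟨φ, hφ⟩ := key
    refine ⟨φ, fun w => if w = u then 1 else 0, fun a b hab he => ?_⟩
    have huv' : u ≠ v := by
      rintro rfl
      exact (gS G S x y).adj_irrefl _ huv
    by_cases hc : a = v ∧ b = u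
    · obtain ⟨rfl, rfl⟩ := hc
      simp [huv'.symm]
    · exact absurd he (hφ a b ⟨hab.1, hab.2, hc⟩)
  · intro v hv
    by_cases hvx : v = x
    · exact ⟨y, d.gadj.2 (Or.inr (Or.inl ⟨hvx, rfl⟩))⟩
    by_cases hvy : v = y
    · exact ⟨x, d.gadj.2 (Or.inr (Or.inr ⟨hvy, rfl⟩))⟩
    have := hG.out_ge (d.sub hv)
    obtain ⟨u, hu⟩ := Finset.card_pos.1 (show 0 < (outN G v).card by omega)
    rw [mem_outN] at hu
    refine ⟨u, d.gadj.2 (Or.inl ⟨hu, hv, ?_⟩)⟩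
    by_contra huS
    rcases d.cut v hv u huS hu with h | h
    · exact hvx h
    · exact hvy h

theorem card_lt (d : Dec G S x y) : S.card < G.verts.card :=
  Finset.card_lt_card (Finset.ssubset_iff_subset_ne.2 ⟨d.sub, d.ne⟩)

theorem pts (d : Dec G S x y) (hG : Crit G) (hb : Bidirected G) (ih : IHp G.verts.card)
    (hp : pt G.Adj G.verts = 4) : pt G.Adj S = 10 ∧ pt (gS G S x y).Adj S = 4 ∧ IsOre4 (gS G S x y) ∧
      4 ≤ S.card := by
  have hc := d.crit hG hb
  have h1 := ih _ hc d.card_lt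
  have h2 := pt_le_add (A := (gS G S x y).Adj) (B := G.Adj) (S := S) {(x, y), (y, x)} (by
    intro u _ v _ h
    rw [d.gadj] at h
    simp only [Finset.mem_insert, Finset.mem_singleton, Prod.mk.injEq]
    tauto)
  have h3 : ((({(x, y), (y, x)} : Finset (ℕ × ℕ)).card : ℕ) : ℤ) ≤ 2 := by
    exact_mod_cast Finset.card_le_two
  have h4 := P1 hG ih hp.ge d.sub ⟨x, d.hx⟩ d.ne
  have h5 : (gS G S x y).verts = S := rfl
  rw [h5] at h1
  exact ⟨by omega, by omega, h1.2 (by omega), hc.four_le⟩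

end Dec

def hh (G : Dgr) (a b u v : ℕ) : Prop := G.Adj u v ∧ ¬(u = a ∧ v = b) ∧ ¬(u = b ∧ v = a)

theorem FT {m : ℕ} (ihm : IHp m) : ∀ k, ∀ G : Dgr, G.verts.card = k → Crit G → Bidirected G →
    pt G.Adj G.verts = 4 → G.verts.card < m → ∀ a b c, G.Adj a b → c ∈ G.verts → c ≠ a → c ≠ b →
    (∀ φ : ℕ → Fin 3, (∀ u v, hh G a b u v → φ u ≠ φ v) → φ a = φ c) →
    ∃ S ⊆ G.verts, S ≠ G.verts ∧ 4 ≤ S.card ∧ pt (hh G a b) S ≤ 10 := by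
  intro k
  induction k using Nat.strong_induction_on with
  | _ k IH =>
  intro G hk hG hb hp hm a b c hab hc hca hcb hf
  by_contra hno
  push Not at hno
  have ih : IHp G.verts.card := fun K hK hKc => ihm K hK (hKc.trans hm)
  have hbh : ∀ u v, hh G a b u v → hh G a b v u := by
    rintro u v ⟨h1, h2, h3⟩
    exact ⟨hb h1, fun h => h3 ⟨h.2, h.1⟩, fun h => h2 ⟨h.2, h.1⟩⟩
  have hne : a ≠ b := by
    rintro rfl
    exact G.adj_irrefl _ hab
  have hm1 := G.adj_mem hab
  have hf2 : ∀ φ : ℕ → Fin 3, (∀ u v, hh G a b u v → φ u ≠ φ v) → φ b = φ c := by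
    intro φ hφ
    rw [← hf φ hφ]
    by_contra hba
    apply hG.1
    refine PC.col ⟨φ, fun u v huv => ?_⟩
    by_cases c1 : u = a ∧ v = b
    · rw [c1.1, c1.2]
      exact fun e => hba e.symm
    · by_cases c2 : u = b ∧ v = a
      · rw [c2.1, c2.2]
        exact hba
      · exact hφ u v ⟨huv, c1, c2⟩
  have hdeg : ∀ p q, p ∈ G.verts → p ≠ q → p ≠ c →
      (∀ φ : ℕ → Fin 3, (∀ u v, hh G a b u v → φ u ≠ φ v) → φ q = φ c) →
      q ∈ G.verts → q ≠ c →
      3 ≤ (G.verts.filter (fun v => hh G a b p v)).card := by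
    intro p q hpV hpq hpc hfq hqV hqc
    have hnc : ¬ Col (fun u v => u ∈ G.verts ∧ v ∈ G.verts ∧ u ≠ v ∧
        (hh G a b u v ∨ (u = q ∧ v = c) ∨ (u = c ∧ v = q))) := by
      intro hcol
      obtain ⟨φ, hφ⟩ := hcol.pc (fun u v h => ⟨h.2.1, h.1, h.2.2.1.symm, by
        rcases h.2.2.2 with h | h | h
        · exact Or.inl (hbh _ _ h)
        · exact Or.inr (Or.inr h.symm)
        · exact Or.inr (Or.inl h.symm)⟩)
      refine hφ q c ⟨hqV, hc, hqc, Or.inr (Or.inl ⟨rfl, rfl⟩)⟩ (hfq φ (fun u v huv => ?_))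
      refine hφ u v ⟨(G.adj_mem huv.1).1, (G.adj_mem huv.1).2, ?_, Or.inl huv⟩
      rintro rfl
      exact G.adj_irrefl _ huv.1
    obtain ⟨K, hK, hKV, hKA⟩ := exists_crit _ _ hnc
    have hKV' : K.verts = G.verts := by
      by_contra hneK
      have h1 := hno K.verts hKV hneK hK.four_le
      have h2 := (ihm K hK (lt_of_le_of_lt (Finset.card_le_card hKV) hm)).1
      have h3 := pt_le_add (A := K.Adj) (B := hh G a b) (S := K.verts) {(q, c), (c, q)} (by
        intro u _ v _ h
        have := hKA u v h
        simp only [Finset.mem_insert, Finset.mem_singleton, Prod.mk.injEq]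
        exact this)
      have h4 : ((({(q, c), (c, q)} : Finset (ℕ × ℕ)).card : ℕ) : ℤ) ≤ 2 := by
        exact_mod_cast Finset.card_le_two
      omega
    refine (hK.out_ge (v := p) (hKV' ▸ hpV)).trans (Finset.card_le_card ?_)
    intro v hv
    rw [mem_outN] at hv
    rw [Finset.mem_filter]
    refine ⟨hKV (K.adj_mem hv).2, ?_⟩
    rcases hKA _ _ hv with h | h | h
    · exact h
    · exact absurd h.1 hpq
    · exact absurd h.1 hpc
  have hda := hdeg a b hm1.1 hne hca.symm hf2 hm1.2 hcb.symm
  have hdb := hdeg b a hm1.2 hne.symm hcb.symm hf hm1.1 hca.symm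
  -- a, b lie in every decomposition
  have cl1 : ∀ S x y, Dec G S x y → a ∈ S ∧ b ∈ S := by
    intro S x y d
    by_contra hn
    obtain ⟨h1, h2, h3, h4⟩ := d.pts hG hb ih hp
    have h5 := hno S d.sub d.ne h4
    have : pt (hh G a b) S = pt G.Adj S := by
      apply pt_congr
      intro u hu v hv
      constructor
      · intro h
        refine ⟨h, ?_, ?_⟩
        · rintro ⟨rfl, rfl⟩
          exact hn ⟨hu, hv⟩
        · rintro ⟨rfl, rfl⟩
          exact hn ⟨hv, hu⟩
      · exact fun h => h.1
    omega
  have cl2 : ∀ S x y, Dec G S x y → c ∉ S := by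
    intro S x y d hcS
    obtain ⟨haS, hbS⟩ := cl1 S x y d
    obtain ⟨h1, h2, h3, h4⟩ := d.pts hG hb ih hp
    have nab1 : ¬ (x = a ∧ y = b) := by
      rintro ⟨rfl, rfl⟩
      exact d.na hab
    have nab2 : ¬ (x = b ∧ y = a) := by
      rintro ⟨rfl, rfl⟩
      exact d.na (hb hab)
    obtain ⟨T, hTS, hTne, hT4, hTp⟩ := IH S.card (hk ▸ d.card_lt) (gS G S x y) rfl (d.crit hG hb)
      (d.gbidir hb) h2 (d.card_lt.trans hm) a b c (d.gadj.2 (Or.inl ⟨hab, haS, hbS⟩)) hcS hca hcb (by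
        intro φ hφ
        have hxy : φ x ≠ φ y := hφ x y ⟨d.gadj.2 (Or.inr (Or.inl ⟨rfl, rfl⟩)), nab1, nab2⟩
        obtain ⟨φ', e, hφ'⟩ := d.extend hG hb hxy
        rw [← e a haS, ← e c hcS]
        apply hf
        intro u v huv
        by_cases hn : u ∈ S ∧ v ∈ S
        · rw [e u hn.1, e v hn.2]
          exact hφ u v ⟨d.gadj.2 (Or.inl ⟨huv.1, hn⟩), huv.2⟩
        · exact hφ' u v huv.1 hn)
    change T ⊆ S at hTS
    change T ≠ S at hTne
    have hTV : T ≠ G.verts := by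
      rintro rfl
      exact hTne (Finset.Subset.antisymm hTS d.sub)
    by_cases hxyT : x ∈ T ∧ y ∈ T
    · have e1 : arO G.Adj S G.verts ⊆ arO (hh G a b) T (T ∪ (G.verts \ S)) := by
        rintro ⟨u, v⟩ hp
        rw [mem_arO] at hp ⊢
        obtain ⟨⟨hu, hv, huv⟩, hn⟩ := hp
        simp only at hu hv huv hn ⊢
        have key : ∀ u v, G.Adj u v → u ∈ G.verts → ¬ (u ∈ S ∧ v ∈ S) → u ∈ T ∪ (G.verts \ S) := by
          intro u v huv hu hn
          rw [Finset.mem_union, Finset.mem_sdiff]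
          by_cases huS : u ∈ S
          · left
            rcases d.cut u huS v (fun h => hn ⟨huS, h⟩) huv with rfl | rfl
            · exact hxyT.1
            · exact hxyT.2
          · exact Or.inr ⟨hu, huS⟩
        refine ⟨⟨key u v huv hu hn, key v u (hb huv) hv (fun h => hn h.symm), huv, ?_, ?_⟩,
          fun h => hn ⟨hTS h.1, hTS h.2⟩⟩
        · rintro ⟨rfl, rfl⟩
          exact hn ⟨haS, hbS⟩
        · rintro ⟨rfl, rfl⟩
          exact hn ⟨hbS, haS⟩
      have e2 := Finset.card_le_card e1
      have e3 := ar_split G.Adj d.sub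
      have e4 := ar_split (hh G a b) (Finset.subset_union_left : T ⊆ T ∪ (G.verts \ S))
      have e5 := pt_le_add (A := hh (gS G S x y) a b) (B := hh G a b) (S := T) {(x, y), (y, x)} (by
        intro u _ v _ h
        have h1 := d.gadj.1 h.1
        simp only [Finset.mem_insert, Finset.mem_singleton, Prod.mk.injEq]
        rcases h1 with h1 | h1
        · exact Or.inl ⟨h1.1, h.2⟩
        · exact Or.inr h1)
      have e6 : ((({(x, y), (y, x)} : Finset (ℕ × ℕ)).card : ℕ) : ℤ) ≤ 2 := by
        exact_mod_cast Finset.card_le_two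
      have e7 : (T ∪ (G.verts \ S)).card = T.card + (G.verts \ S).card := by
        apply Finset.card_union_of_disjoint
        rw [Finset.disjoint_left]
        intro v hv hv2
        exact (Finset.mem_sdiff.1 hv2).2 (hTS hv)
      have e8 := Finset.card_sdiff_add_card_eq_card d.sub
      have e9 := hno (T ∪ (G.verts \ S)) (Finset.union_subset (hTS.trans d.sub) Finset.sdiff_subset) (by
        intro he
        apply hTne
        apply Finset.Subset.antisymm hTS
        intro v hv
        have : v ∈ T ∪ (G.verts \ S) := by rw [he]; exact d.sub hv
        rw [Finset.mem_union, Finset.mem_sdiff] at this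
        tauto) (hT4.trans (Finset.card_le_card Finset.subset_union_left))
      unfold pt at *
      omega
    · have e1 := hno T (hTS.trans d.sub) hTV hT4
      have e2 : pt (hh G a b) T ≤ pt (hh (gS G S x y) a b) T := by
        apply pt_mono
        intro u hu v hv h
        refine ⟨?_, h.2⟩
        rcases d.gadj.1 h.1 with h1 | ⟨rfl, rfl⟩ | ⟨rfl, rfl⟩
        · exact h1.1
        · exact absurd ⟨hu, hv⟩ hxyT
        · exact absurd ⟨hv, hu⟩ hxyT
      omega
  have hore : IsOre4 G := (ihm G hG hm).2 hp.ge
  rcases ore_dec hore with h4 | ⟨S0, x0, y0, d0⟩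
  · have : G.verts.filter (fun v => hh G a b a v) ⊆ (G.verts.erase a).erase b := by
      intro v hv
      rw [Finset.mem_filter] at hv
      rw [Finset.mem_erase, Finset.mem_erase]
      refine ⟨fun e => hv.2.2.1 ⟨rfl, e⟩, ?_, hv.1⟩
      rintro rfl
      exact G.adj_irrefl _ hv.2.1
    have := Finset.card_le_card this
    rw [Finset.card_erase_of_mem (Finset.mem_erase.2 ⟨hne.symm, hm1.2⟩),
      Finset.card_erase_of_mem hm1.1, h4.1] at this
    omega
  · obtain ⟨S, hSF, hmin⟩ := Finset.exists_min_image
      (G.verts.powerset.filter (fun S => ∃ x y, Dec G S x y)) Finset.card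
      ⟨S0, Finset.mem_filter.2 ⟨Finset.mem_powerset.2 d0.sub, x0, y0, d0⟩⟩
    rw [Finset.mem_filter] at hSF
    obtain ⟨_, x, y, d⟩ := hSF
    have hcS := cl2 S x y d
    obtain ⟨haS, hbS⟩ := cl1 S x y d
    obtain ⟨h1, h2, h3, h4⟩ := d.pts hG hb ih hp
    rcases ore_dec h3 with hk4 | ⟨S', x', y', d'⟩
    · have hS4 : S.card = 4 := hk4.1
      have key : ∀ p q, p ∈ S → q ∈ S → p ≠ q → p ≠ x → p ≠ y → (∀ v, hh G a b p v → v ≠ q) →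
          (G.verts.filter (fun v => hh G a b p v)).card ≤ 2 := by
        intro p q hpS hqS hpq hpx hpy hpv
        have : G.verts.filter (fun v => hh G a b p v) ⊆ (S.erase p).erase q := by
          intro v hv
          rw [Finset.mem_filter] at hv
          rw [Finset.mem_erase, Finset.mem_erase]
          refine ⟨hpv v hv.2, ?_, ?_⟩
          · rintro rfl
            exact G.adj_irrefl _ hv.2.1
          · by_contra hvS
            rcases d.cut p hpS v hvS hv.2.1 with h | h
            · exact hpx h
            · exact hpy h
        have := Finset.card_le_card this
        rw [Finset.card_erase_of_mem (Finset.mem_erase.2 ⟨hpq.symm, hqS⟩),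
          Finset.card_erase_of_mem hpS, hS4] at this
        exact this
      by_cases hax : a = x ∨ a = y
      · have hbx : b ≠ x ∧ b ≠ y := by
          constructor
          · rintro rfl
            rcases hax with h | rfl
            · exact hne h
            · exact d.na (hb hab)
          · rintro rfl
            rcases hax with rfl | h
            · exact d.na hab
            · exact hne h
        have := key b a hbS haS hne.symm hbx.1 hbx.2 (fun v hv e => hv.2.2 ⟨rfl, e⟩)
        omega
      · push Not at hax
        have := key a b haS hbS hne hax.1 hax.2 (fun v hv e => hv.2.1 ⟨rfl, e⟩)
        omega
    · have hS'S : S' ⊆ S := d'.sub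
      have hS'ne : S' ≠ S := d'.ne
      have hna' : ¬ G.Adj x' y' := fun h => d'.na (d.gadj.2 (Or.inl ⟨h, hS'S d'.hx, hS'S d'.hy⟩))
      have hlt : S'.card < S.card := d'.card_lt
      by_cases hxyS : x ∈ S' ∧ y ∈ S'
      · have d'' : Dec G (S' ∪ (G.verts \ S)) x' y' := by
          refine ⟨Finset.union_subset (hS'S.trans d.sub) Finset.sdiff_subset, ?_,
            Finset.mem_union_left _ d'.hx, Finset.mem_union_left _ d'.hy, d'.hxy, hna', ?_, ?_⟩
          · intro he
            apply hS'ne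
            apply Finset.Subset.antisymm hS'S
            intro v hv
            have : v ∈ S' ∪ (G.verts \ S) := by rw [he]; exact d.sub hv
            rw [Finset.mem_union, Finset.mem_sdiff] at this
            tauto
          · intro u hu v hv huv
            rw [Finset.mem_union, Finset.mem_sdiff] at hu hv
            have hvS : v ∈ S := by
              by_contra hvS
              exact hv (Or.inr ⟨(G.adj_mem huv).2, hvS⟩)
            rcases hu with hu | hu
            · exact d'.cut u hu v (fun h => hv (Or.inl h)) (d.gadj.2 (Or.inl ⟨huv, hS'S hu, hvS⟩))
            · exfalso
              rcases d.cut v hvS u hu.2 (hb huv) with rfl | rfl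
              · exact hv (Or.inl hxyS.1)
              · exact hv (Or.inl hxyS.2)
          · rintro ⟨φ, hφ⟩
            have hφ' : ∀ u v, ((G.Adj u v ∧ u ∈ S' ∪ (G.verts \ S) ∧ v ∈ S' ∪ (G.verts \ S)) ∨
                (u = x' ∧ v = y') ∨ (u = y' ∧ v = x')) → φ u ≠ φ v := fun u v h =>
              hφ u v ((gS_adj (Finset.mem_union_left _ d'.hx) (Finset.mem_union_left _ d'.hy) d'.hxy).2 h)
            have hxy : φ x ≠ φ y := by
              apply d.force hG hb
              intro u v huv hn
              have key : ∀ u v, G.Adj u v → ¬ (u ∈ S ∧ v ∈ S) → u ∈ S' ∪ (G.verts \ S) := by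
                intro u v huv hn
                rw [Finset.mem_union, Finset.mem_sdiff]
                by_cases huS : u ∈ S
                · left
                  rcases d.cut u huS v (fun h => hn ⟨huS, h⟩) huv with rfl | rfl
                  · exact hxyS.1
                  · exact hxyS.2
                · exact Or.inr ⟨(G.adj_mem huv).1, huS⟩
              exact hφ' u v (Or.inl ⟨huv, key u v huv hn, key v u (hb huv) (fun h => hn h.symm)⟩)
            apply d'.npc
            refine ⟨φ, fun u v huv => ?_⟩
            rw [d'.gadj] at huv
            rcases huv with ⟨k1, k2, k3⟩ | h
            · rcases d.gadj.1 k1 with h | ⟨rfl, rfl⟩ | ⟨rfl, rfl⟩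
              · exact hφ' u v (Or.inl ⟨h.1, Finset.mem_union_left _ k2, Finset.mem_union_left _ k3⟩)
              · exact hxy
              · exact hxy.symm
            · exact hφ' u v (Or.inr h)
        exact cl2 _ _ _ d'' (Finset.mem_union_right _ (Finset.mem_sdiff.2 ⟨hc, hcS⟩))
      · have d'' : Dec G S' x' y' := by
          refine ⟨hS'S.trans d.sub, ?_, d'.hx, d'.hy, d'.hxy, hna', ?_, ?_⟩
          · intro he
            exact d.ne (Finset.Subset.antisymm d.sub (he ▸ hS'S))
          · intro u hu v hv huv
            by_cases hvS : v ∈ S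
            · exact d'.cut u hu v hv (d.gadj.2 (Or.inl ⟨huv, hS'S hu, hvS⟩))
            · rcases d.cut u (hS'S hu) v hvS huv with rfl | rfl
              · exact d'.cut u hu y (fun h => hxyS ⟨hu, h⟩) (d.gadj.2 (Or.inr (Or.inl ⟨rfl, rfl⟩)))
              · exact d'.cut u hu x (fun h => hxyS ⟨h, hu⟩) (d.gadj.2 (Or.inr (Or.inr ⟨rfl, rfl⟩)))
          · intro hpc
            apply d'.npc
            refine hpc.mono (fun u v huv => ?_)
            rw [d'.gadj] at huv
            rw [gS_adj d'.hx d'.hy d'.hxy]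
            rcases huv with ⟨k1, k2, k3⟩ | h
            · rcases d.gadj.1 k1 with h | ⟨rfl, rfl⟩ | ⟨rfl, rfl⟩
              · exact Or.inl ⟨h.1, k2, k3⟩
              · exact absurd ⟨k2, k3⟩ hxyS
              · exact absurd ⟨k3, k2⟩ hxyS
            · exact Or.inr h
        have := hmin S' (Finset.mem_filter.2 ⟨Finset.mem_powerset.2 d''.sub, x', y', d''⟩)
        omega

end Pf
end PfSection

noncomputable section PfSection
open scoped Classical
namespace Pf
open Dgr

/-- the context of a minimal counterexample -/
structure Ctx (D : Dgr) : Prop where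
  crit : Crit D
  p4 : 4 ≤ pt D.Adj D.verts
  no : ¬ IsOre4 D
  ih : IHp D.verts.card

theorem exists_out {D : Dgr} {R : Finset ℕ} (hR : R ⊆ D.verts) (hne : R ≠ D.verts) :
    ∃ w ∈ D.verts, w ∉ R := by
  by_contra hh
  push Not at hh
  exact hne (Finset.Subset.antisymm hR hh)

theorem Ctx.ext_full {D : Dgr} (c : Ctx D) {R : Finset ℕ} (hR : R ⊆ D.verts)
    (h4 : 4 ≤ R.card) (h15 : pt D.Adj R ≤ 15) (φ : ℕ → Fin 3) (f : ℕ → ℕ)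
    (hf : ∀ u v, u ∈ R → v ∈ R → D.Adj u v → φ u = φ v → f u < f v) :
    ∃ N W, Ext D R φ N W ∧ pt W.Adj W.verts ≤ 4 ∧ (4 ≤ pt W.Adj W.verts → IsOre4 W) ∧
      R ∪ YY W N = D.verts := by
  obtain ⟨N, W, hE, hc⟩ := exists_ext c.crit hR (Finset.card_pos.1 (by omega)) φ f hf
  obtain ⟨hW, hO⟩ := c.ih W hE.crit (by omega)
  refine ⟨N, W, hE, hW, hO, ?_⟩
  have hcl := hE.card_le
  have hfin : pt D.Adj (R ∪ YY W N) ≤ pt D.Adj R - 6 := by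
    rcases hE.cases with h | h | h <;> omega
  by_contra hV
  have := P1 c.crit c.ih c.p4 (R := R ∪ YY W N) (Finset.union_subset hR (fun x hx => by
    rw [mem_YY] at hx
    exact (hE.low x hx.1 hx.2).1)) (Finset.card_pos.1 (by
      have := Finset.card_le_card (Finset.subset_union_left : R ⊆ R ∪ YY W N)
      omega)) hV
  omega

theorem Ctx.add_crit {D : Dgr} (c : Ctx D) {R : Finset ℕ} (hR : R ⊆ D.verts) (hne : R ≠ D.verts)
    (F : Finset (ℕ × ℕ)) (hF : ∀ p ∈ F, p.1 ∈ R ∧ p.2 ∈ R ∧ p.1 ≠ p.2)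
    (hn : ¬ Col (fun a b => (D.Adj a b ∧ a ∈ R ∧ b ∈ R) ∨ (a, b) ∈ F)) :
    ∃ K, Crit K ∧ K.verts ⊆ R ∧ (∀ a b, K.Adj a b → D.Adj a b ∨ (a, b) ∈ F) ∧
      pt D.Adj K.verts ≤ pt K.Adj K.verts + 3 * F.card ∧ pt K.Adj K.verts ≤ 4 ∧
      (4 ≤ pt K.Adj K.verts → IsOre4 K) ∧ 4 ≤ K.verts.card ∧ 10 ≤ pt D.Adj K.verts := by
  obtain ⟨K, hK, hs, ha⟩ := exists_crit R (fun a b => D.Adj a b ∨ (a, b) ∈ F) (by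
    refine fun h => hn (h.mono ?_)
    rintro u v (⟨h, hu, hv⟩ | h)
    · exact ⟨hu, hv, fun e => D.adj_irrefl v (e ▸ h), Or.inl h⟩
    · obtain ⟨h1, h2, h3⟩ := hF _ h
      exact ⟨h1, h2, h3, Or.inr h⟩)
  have hlt : R.card < D.verts.card := Finset.card_lt_card
    (Finset.ssubset_iff_subset_ne.2 ⟨hR, hne⟩)
  have hle := Finset.card_le_card hs
  obtain ⟨i1, i2⟩ := c.ih K hK (by omega)
  refine ⟨K, hK, hs, ha, pt_le_add F (fun u _ v _ h => ha u v h), i1, i2, hK.four_le, ?_⟩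
  refine P1 c.crit c.ih c.p4 (hs.trans hR) hK.nonempty ?_
  intro e
  rw [e] at hle
  omega

set_option maxHeartbeats 4000000 in
theorem Ctx.P2 {D : Dgr} (c : Ctx D) {R0 : Finset ℕ} (hR0 : R0 ⊆ D.verts) (hne0 : R0 ≠ D.verts)
    (h40 : 4 ≤ R0.card) : 11 ≤ pt D.Adj R0 := by
  by_contra hlt
  push Not at hlt
  set F := D.verts.powerset.filter (fun S => S ≠ D.verts ∧ 4 ≤ S.card ∧ pt D.Adj S ≤ 10) with hF
  have hmF : ∀ S, S ∈ F ↔ S ⊆ D.verts ∧ S ≠ D.verts ∧ 4 ≤ S.card ∧ pt D.Adj S ≤ 10 := by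
    intro S
    rw [hF, Finset.mem_filter, Finset.mem_powerset]
  obtain ⟨R, hRF, hmin⟩ := Finset.exists_min_image F (fun S => S.card)
    ⟨R0, (hmF R0).2 ⟨hR0, hne0, h40, by omega⟩⟩
  obtain ⟨hR, hne, h4, h10⟩ := (hmF R).1 hRF
  have hlt : R.card < D.verts.card := Finset.card_lt_card
    (Finset.ssubset_iff_subset_ne.2 ⟨hR, hne⟩)
  have hnoS : ∀ S ⊆ R, 4 ≤ S.card → pt D.Adj S ≤ 10 → S = R := by
    intro S hS h4S h10S
    have hle := Finset.card_le_card hS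
    have := hmin S ((hmF S).2 ⟨hS.trans hR, fun e => by rw [e] at hle; omega, h4S, h10S⟩)
    exact Finset.eq_of_subset_of_card_le hS this
  have hRne : R.Nonempty := Finset.card_pos.1 (by omega)
  have hp10 : pt D.Adj R = 10 := le_antisymm h10 (P1 c.crit c.ih c.p4 hR hRne hne)
  have cl1 : ∀ (φ : ℕ → Fin 3) (f : ℕ → ℕ),
      (∀ u v, u ∈ R → v ∈ R → D.Adj u v → φ u = φ v → f u < f v) →
      ∃ N W, Ext D R φ N W ∧ IsOre4 W ∧ R ∪ YY W N = D.verts ∧ (XX W N).card = 1 ∧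
        (arO D.Adj R (R ∪ YY W N)).card ≤ (arO W.Adj (XX W N) W.verts).card := by
    intro φ f hf
    obtain ⟨N, W, hE, hW, hO, hV⟩ := c.ext_full hR h4 (by omega) φ f hf
    have hcl := hE.card_le
    have hp := c.p4
    rw [← hV] at hp
    rcases hE.cases with h | h | h
    · exact ⟨N, W, hE, hO (by omega), hV, h.1, by omega⟩
    · omega
    · omega
  have cl2 : ∀ (φ : ℕ → Fin 3) (f : ℕ → ℕ),
      (∀ u v, u ∈ R → v ∈ R → D.Adj u v → φ u = φ v → f u < f v) →
      ∀ u v, Bd D R u → Bd D R v → φ u = φ v := by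
    intro φ f hf u v hu hv
    obtain ⟨N, W, hE, hO, hV, hX, he⟩ := cl1 φ f hf
    exact hE.same he hV hX hu hv
  obtain ⟨u, v, huv, hu, hv⟩ := c.crit.two_bd hR hne (by omega)
  -- the digon side
  obtain ⟨K, hK, hKs, hKa, hKp, hK4, hKO, hKc, -⟩ := c.add_crit hR hne {(u, v), (v, u)} (by
    intro p hp
    rw [Finset.mem_insert, Finset.mem_singleton] at hp
    rcases hp with rfl | rfl
    · exact ⟨hu.1, hv.1, huv⟩
    · exact ⟨hv.1, hu.1, huv.symm⟩) (by
    rintro ⟨φ, f, hf⟩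
    have e := cl2 φ f (fun a b ha hb hab => hf a b (Or.inl ⟨hab, ha, hb⟩)) u v hu hv
    have h1 := hf u v (Or.inr (by simp)) e
    have h2 := hf v u (Or.inr (by simp)) e.symm
    omega)
  have hF2 : ({(u, v), (v, u)} : Finset (ℕ × ℕ)).card = 2 := by
    rw [Finset.card_pair]
    intro e
    exact huv (Prod.ext_iff.1 e).1
  rw [hF2] at hKp
  have hKR : K.verts = R := hnoS _ hKs hKc (by push_cast at hKp; omega)
  have hKp4 : pt K.Adj K.verts = 4 := by
    rw [hKR] at hKp hK4 ⊢
    push_cast at hKp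
    omega
  have hKore : IsOre4 K := hKO hKp4.ge
  obtain ⟨hKb, -, -, -⟩ := ore_facts hKore
  have hKsub : ar K.Adj R ⊆ ar D.Adj R ∪ {(u, v), (v, u)} := by
    rintro ⟨a, b⟩ hab
    rw [mem_ar] at hab
    rw [Finset.mem_union, mem_ar]
    rcases hKa a b hab.2.2 with h | h
    · exact Or.inl ⟨hab.1, hab.2.1, h⟩
    · exact Or.inr h
  have hcardK : (ar K.Adj R).card = (ar D.Adj R).card + 2 := by
    rw [hKR] at hKp4
    unfold pt at hKp4 hp10
    omega
  have hun := Finset.card_union_add_card_inter (ar D.Adj R) {(u, v), (v, u)}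
  have hKle := Finset.card_le_card hKsub
  have hKeq : ar K.Adj R = ar D.Adj R ∪ {(u, v), (v, u)} :=
    Finset.eq_of_subset_of_card_le hKsub (by omega)
  have hinter : ar D.Adj R ∩ {(u, v), (v, u)} = ∅ := by
    rw [← Finset.card_eq_zero]
    omega
  have hKadj : ∀ a b, K.Adj a b ↔ ((D.Adj a b ∧ a ∈ R ∧ b ∈ R) ∨ (a = u ∧ b = v) ∨ (a = v ∧ b = u)) := by
    intro a b
    have h1 : (a, b) ∈ ar K.Adj R ↔ (a, b) ∈ ar D.Adj R ∪ {(u, v), (v, u)} := by rw [hKeq]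
    rw [mem_ar, Finset.mem_union, mem_ar] at h1
    simp only [Finset.mem_insert, Finset.mem_singleton, Prod.mk.injEq] at h1
    have h2 : K.Adj a b → a ∈ R ∧ b ∈ R := fun h => hKR ▸ K.adj_mem h
    tauto
  have hna : ∀ a b, D.Adj a b → a ∈ R → b ∈ R → ¬ (a = u ∧ b = v) ∧ ¬ (a = v ∧ b = u) := by
    intro a b hab ha hb
    have : (a, b) ∉ ar D.Adj R ∩ {(u, v), (v, u)} := by rw [hinter]; exact Finset.notMem_empty _
    rw [Finset.mem_inter, mem_ar] at this
    simp only [Finset.mem_insert, Finset.mem_singleton, Prod.mk.injEq] at this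
    tauto
  have hhK : ∀ a b, hh K u v a b ↔ (D.Adj a b ∧ a ∈ R ∧ b ∈ R) := by
    intro a b
    unfold hh
    rw [hKadj]
    constructor
    · rintro ⟨h1 | h1 | h1, h2, h3⟩
      · exact h1
      · exact absurd h1 h2
      · exact absurd h1 h3
    · intro h
      exact ⟨Or.inl h, hna a b h.1 h.2.1 h.2.2⟩
  have cl3 : ∀ w, Bd D R w → w = u ∨ w = v := by
    intro w hw
    by_contra hcon
    push Not at hcon
    obtain ⟨S, hS, hSne, hS4, hS10⟩ := FT c.ih _ K rfl hK hKb hKp4 (by rw [hKR]; exact hlt) u v w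
      ((hKadj u v).2 (by simp)) (hKR ▸ hw.1) hcon.1 hcon.2 (by
        intro φ hφ
        refine cl2 φ (fun _ => 0) ?_ u w hu hw
        intro a b ha hb hab e
        exact absurd e (hφ a b ((hhK a b).2 ⟨hab, ha, hb⟩)))
    rw [hKR] at hS hSne
    apply hSne
    apply hnoS S hS hS4
    rw [pt_congr (A := hh K u v) (B := D.Adj)]
    · exact hS10
    · intro a ha b hb
      rw [hhK]
      exact ⟨fun h => h.1, fun h => ⟨h, hS ha, hS hb⟩⟩
  have cl4 : ∀ a b, a ∈ R → b ∈ R → a ≠ b →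
      Col (fun x y => (D.Adj x y ∧ x ∈ R ∧ y ∈ R) ∨ (x, y) ∈ ({(a, b)} : Finset (ℕ × ℕ))) := by
    intro a b ha hb hab
    by_contra hcon
    obtain ⟨K', -, -, -, hp, h4, -, -, h10⟩ := c.add_crit hR hne {(a, b)} (by
      intro p hp
      rw [Finset.mem_singleton] at hp
      subst hp
      exact ⟨ha, hb, hab⟩) hcon
    rw [Finset.card_singleton] at hp
    push_cast at hp
    omega
  obtain ⟨o, ho, hoR⟩ := exists_out hR hne
  obtain ⟨φ, f, hf⟩ := c.crit.col_on ho hoR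
  obtain ⟨N, W, hE, hO, hV, hX, he⟩ := cl1 φ f (fun a b ha hb h => hf a b ⟨h, ha, hb⟩)
  obtain ⟨z, hz⟩ := Finset.card_eq_one.1 hX
  obtain ⟨hWb, -, hWn, -⟩ := ore_facts hO
  have hzX : z ∈ W.verts ∧ N ≤ z := by rw [← mem_XX, hz]; exact Finset.mem_singleton_self z
  have hzu : ∀ x ∈ W.verts, N ≤ x → x = z := by
    intro x h1 h2
    have : x ∈ XX W N := mem_XX.2 ⟨h1, h2⟩
    rw [hz, Finset.mem_singleton] at this
    exact this
  have hDz : ∀ a ∈ D.verts, a ≠ z := fun a ha => by have := hE.lt a ha; omega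
  have hBdl : ∀ a b, D.Adj a b → a ∈ R → b ∉ R → Bd D R a := fun a b hab ha hb =>
    ⟨ha, b, (D.adj_mem hab).2, hb, Or.inl hab⟩
  have hBdr : ∀ a b, D.Adj a b → a ∉ R → b ∈ R → Bd D R b := fun a b hab ha hb =>
    ⟨hb, a, (D.adj_mem hab).1, ha, Or.inr hab⟩
  have a1 : ∀ a b, D.Adj a b → a ∈ R → b ∉ R → W.Adj z b ∧ lab R φ N a = z := by
    intro a b hab ha hb
    have h1 := hE.surj he hV hab (fun h => hb h.2)
    rw [lab_out hb] at h1
    have := hzu _ (W.adj_mem h1).1 (by rw [lab_in ha]; omega)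
    rw [this] at h1
    exact ⟨h1, this⟩
  have a2 : ∀ a b, D.Adj a b → a ∉ R → b ∈ R → W.Adj a z ∧ lab R φ N b = z := by
    intro a b hab ha hb
    have h1 := hE.surj he hV hab (fun h => ha h.1)
    rw [lab_out ha] at h1
    have := hzu _ (W.adj_mem h1).2 (by rw [lab_in hb]; omega)
    rw [this] at h1
    exact ⟨h1, this⟩
  have a3 : ∀ a b, a ∉ R → b ∉ R → (D.Adj a b → W.Adj a b) := by
    intro a b ha hb h
    have h1 := hE.surj he hV h (fun h => ha h.1)
    rwa [lab_out ha, lab_out hb] at h1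
  have a3' : ∀ a b, W.Adj a b → a ≠ z → b ≠ z → D.Adj a b ∧ a ∉ R ∧ b ∉ R := by
    intro a b h haz hbz
    have ha : ¬ N ≤ a := fun h' => haz (hzu a (W.adj_mem h).1 h')
    have hb : ¬ N ≤ b := fun h' => hbz (hzu b (W.adj_mem h).2 h')
    obtain ⟨a', b', hab, -, ea, eb⟩ := hE.adj a b h (fun h => ha h.1)
    have ha' : a' ∉ R := by
      intro h'
      rw [lab_in h'] at ea
      omega
    have hb' : b' ∉ R := by
      intro h'
      rw [lab_in h'] at eb
      omega
    rw [lab_out ha'] at ea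
    rw [lab_out hb'] at eb
    subst ea eb
    exact ⟨hab, ha', hb'⟩
  have a4 : ∀ w, W.Adj z w → w ∉ R ∧ (D.Adj u w ∨ D.Adj v w) := by
    intro w h
    have hwz : w ≠ z := fun e => W.adj_irrefl z (e ▸ h)
    have hw : ¬ N ≤ w := fun h' => hwz (hzu w (W.adj_mem h).2 h')
    obtain ⟨a', b', hab, hn, ea, eb⟩ := hE.adj z w h (fun h => hw h.2)
    have hb' : b' ∉ R := by
      intro h'
      rw [lab_in h'] at eb
      omega
    rw [lab_out hb'] at eb
    subst eb
    have ha' : a' ∈ R := by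
      by_contra h'
      rw [lab_out h'] at ea
      exact hDz a' (D.adj_mem hab).1 ea
    refine ⟨hb', ?_⟩
    rcases cl3 a' (hBdl _ _ hab ha' hb') with rfl | rfl
    · exact Or.inl hab
    · exact Or.inr hab
  have a4' : ∀ w, W.Adj w z → w ∉ R ∧ (D.Adj w u ∨ D.Adj w v) := by
    intro w h
    have hwz : w ≠ z := fun e => W.adj_irrefl z (e ▸ h)
    have hw : ¬ N ≤ w := fun h' => hwz (hzu w (W.adj_mem h).1 h')
    obtain ⟨b', a', hab, hn, eb, ea⟩ := hE.adj w z h (fun h => hw h.1)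
    have hb' : b' ∉ R := by
      intro h'
      rw [lab_in h'] at eb
      omega
    rw [lab_out hb'] at eb
    subst eb
    have ha' : a' ∈ R := by
      by_contra h'
      rw [lab_out h'] at ea
      exact hDz a' (D.adj_mem hab).2 ea
    refine ⟨hb', ?_⟩
    rcases cl3 a' (hBdr _ _ hab hb' ha') with rfl | rfl
    · exact Or.inl hab
    · exact Or.inr hab
  have a5 : ∀ a b w, a ∈ R → b ∈ R → w ∉ R → D.Adj a w → D.Adj b w → a = b := by
    intro a b w ha hb hw h1 h2
    exact (hE.inj he hV h1 (fun h => hw h.2) h2 (fun h => hw h.2)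
      ((a1 a w h1 ha hw).2.trans (a1 b w h2 hb hw).2.symm) rfl).1
  have a5' : ∀ a b w, a ∈ R → b ∈ R → w ∉ R → D.Adj w a → D.Adj w b → a = b := by
    intro a b w ha hb hw h1 h2
    exact (hE.inj he hV h1 (fun h => hw h.1) h2 (fun h => hw h.1) rfl
      ((a2 w a h1 hw ha).2.trans (a2 w b h2 hw hb).2.symm)).2
  have nomis : ∀ p q w, Bd D R p → Bd D R q → p ≠ q → (∀ x, Bd D R x → x = p ∨ x = q) → w ∉ R →
      D.Adj p w → D.Adj w q → False := by
    intro p q w hp hq hpq hall hw h1 h2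
    have hzw := (a1 p w h1 hp.1 hw).1
    have hB := (hE.crit.col_lt (B := fun a b => W.Adj a b ∧ ¬ (a = z ∧ b = w) ∧ ¬ (a = w ∧ b = z))
      (fun a b h => h.1) hzw (by tauto)).pc (by
        intro a b h
        exact ⟨hWb h.1, by tauto, by tauto⟩)
    obtain ⟨ψ, hψ⟩ := hB
    have hψe : ψ z = ψ w := by
      by_contra hcon
      apply hWn
      refine ⟨ψ, fun a b hab => ?_⟩
      by_cases e1 : a = z ∧ b = w
      · rw [e1.1, e1.2]; exact hcon
      by_cases e2 : a = w ∧ b = z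
      · rw [e2.1, e2.2]; exact Ne.symm hcon
      exact hψ a b ⟨hab, e1, e2⟩
    obtain ⟨φ', f', hf'⟩ := cl4 p q hp.1 hq.1 hpq
    have hf1 : ∀ a b, a ∈ R → b ∈ R → D.Adj a b → φ' a = φ' b → f' a < f' b :=
      fun a b ha hb hab => hf' a b (Or.inl ⟨hab, ha, hb⟩)
    have hpqe := cl2 φ' f' hf1 p q hp hq
    have hlt' := hf' p q (Or.inr (by simp)) hpqe
    obtain ⟨σ, hσ⟩ := perm_to (φ' p) (ψ z)
    have hσB : ∀ x, Bd D R x → σ (φ' x) = ψ z := fun x hx => by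
      rw [cl2 φ' f' hf1 x p hx hp, hσ]
    apply c.crit.1
    refine ⟨fun a => if a ∈ R then σ (φ' a) else ψ a, fun a => if a ∈ R then 2 * f' a else 2 * f' p + 1, ?_⟩
    intro a b hab hc
    by_cases ha : a ∈ R <;> by_cases hb : b ∈ R
    · simp only [ha, hb, if_true] at hc ⊢
      have := hf1 a b ha hb hab (σ.injective hc)
      omega
    · simp only [ha, hb, if_true, if_false] at hc ⊢
      have hBa := hBdl a b hab ha hb
      rw [hσB a hBa] at hc
      have hzb := (a1 a b hab ha hb).1
      have hbz : b ≠ z := fun e => W.adj_irrefl z (e ▸ hzb)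
      by_cases hbw : b = w
      · subst hbw
        have := a5 a p b ha hp.1 hb hab h1
        subst this
        omega
      · exact absurd hc (hψ z b ⟨hzb, fun e => hbw e.2, fun e => hbz e.2⟩)
    · simp only [ha, hb, if_true, if_false] at hc ⊢
      have hBb := hBdr a b hab ha hb
      rw [hσB b hBb] at hc
      have haz := (a2 a b hab ha hb).1
      have haz' : a ≠ z := fun e => W.adj_irrefl z (e ▸ haz)
      by_cases haw : a = w
      · subst haw
        have := a5' b q a hb hq.1 ha hab h2
        subst this
        omega
      · exact absurd hc (hψ a z ⟨haz, fun e => haz' e.1, fun e => haw e.1⟩)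
    · simp only [ha, hb, if_false] at hc ⊢
      exact absurd hc (hψ a b ⟨a3 a b ha hb hab, fun e => hDz a (D.adj_mem hab).1 e.1,
        fun e => hDz b (D.adj_mem hab).2 e.2⟩)
  have cl3' : ∀ w, Bd D R w → w = v ∨ w = u := fun w hw => (cl3 w hw).symm
  have d1 : ∀ w, w ∉ R → D.Adj u w → D.Adj w u := by
    intro w hw h
    rcases (a4' w (hWb (a1 u w h hu.1 hw).1)).2 with h' | h'
    · exact h'
    · exact (nomis u v w hu hv huv cl3 hw h h').elim
  have d2 : ∀ w, w ∉ R → D.Adj v w → D.Adj w v := by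
    intro w hw h
    rcases (a4' w (hWb (a1 v w h hv.1 hw).1)).2 with h' | h'
    · exact (nomis v u w hv hu huv.symm cl3' hw h h').elim
    · exact h'
  have d1' : ∀ w, w ∉ R → D.Adj w u → D.Adj u w := by
    intro w hw h
    rcases (a4 w (hWb (a2 w u h hw hu.1).1)).2 with h' | h'
    · exact h'
    · exact (nomis v u w hv hu huv.symm cl3' hw h' h).elim
  have d2' : ∀ w, w ∉ R → D.Adj w v → D.Adj v w := by
    intro w hw h
    rcases (a4 w (hWb (a2 w v h hw hv.1).1)).2 with h' | h'
    · exact (nomis u v w hu hv huv cl3 hw h' h).elim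
    · exact h'
  have hWv : ∀ w ∈ W.verts, w ≠ z → w ∈ D.verts ∧ w ∉ R := by
    intro w hw hwz
    exact hE.low w hw (fun h => hwz (hzu w hw h))
  apply c.no
  refine IsOre4.comp K W D hKore hO ⟨hKb, hWb, ?_, u, v, z, {w | w ∉ R ∧ D.Adj u w}, {w | w ∉ R ∧ D.Adj v w},
    hKR ▸ hu.1, hKR ▸ hv.1, huv, (hKadj u v).2 (by simp), hzX.1, ?_, ?_, ?_, ?_, ?_, ?_⟩
  · rw [hKR, Finset.disjoint_left]
    intro a ha haW
    exact (hWv a haW (hDz a (hR ha))).2 ha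
  · ext w
    simp only [Set.mem_union, Set.mem_setOf_eq]
    constructor
    · rintro (⟨h1, h2⟩ | ⟨h1, h2⟩)
      · exact (a1 _ _ h2 hu.1 h1).1
      · exact (a1 _ _ h2 hv.1 h1).1
    · intro h
      have := a4 w h
      tauto
  · rw [Set.disjoint_left]
    rintro w ⟨h1, h2⟩ ⟨_, h3⟩
    exact huv (a5 u v w hu.1 hv.1 h1 h2 h3)
  · obtain ⟨-, w, -, hw, h | h⟩ := hu
    · exact ⟨w, hw, h⟩
    · exact ⟨w, hw, d1' w hw h⟩
  · obtain ⟨-, w, -, hw, h | h⟩ := hv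
    · exact ⟨w, hw, h⟩
    · exact ⟨w, hw, d2' w hw h⟩
  · rw [hKR]
    ext w
    rw [Finset.mem_union, Finset.mem_erase]
    constructor
    · intro hw
      by_cases hwR : w ∈ R
      · exact Or.inl hwR
      · right
        refine ⟨hDz w hw, ?_⟩
        rw [← hV, Finset.mem_union] at hw
        rcases hw with hw | hw
        · exact absurd hw hwR
        · exact (mem_YY.1 hw).1
    · rintro (h | h)
      · exact hR h
      · exact (hWv w h.2 h.1).1
  · intro a b
    have e1 : (K.Adj a b ∧ ¬(a = u ∧ b = v) ∧ ¬(a = v ∧ b = u)) ↔ (D.Adj a b ∧ a ∈ R ∧ b ∈ R) := hhK a b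
    rw [e1]
    simp only [Set.mem_setOf_eq]
    constructor
    · intro hab
      by_cases ha : a ∈ R <;> by_cases hb : b ∈ R
      · exact Or.inl ⟨hab, ha, hb⟩
      · have hW1 := (a1 a b hab ha hb).1
        rcases cl3 a (hBdl a b hab ha hb) with rfl | rfl
        · exact Or.inr (Or.inr (Or.inl ⟨rfl, ⟨hb, hab⟩, hW1⟩))
        · exact Or.inr (Or.inr (Or.inr (Or.inr (Or.inl ⟨rfl, ⟨hb, hab⟩, hW1⟩))))
      · have hW1 := (a2 a b hab ha hb).1
        rcases cl3 b (hBdr a b hab ha hb) with rfl | rfl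
        · exact Or.inr (Or.inr (Or.inr (Or.inl ⟨rfl, ⟨ha, d1' a ha hab⟩, hW1⟩)))
        · exact Or.inr (Or.inr (Or.inr (Or.inr (Or.inr ⟨rfl, ⟨ha, d2' a ha hab⟩, hW1⟩))))
      · exact Or.inr (Or.inl ⟨a3 a b ha hb hab, hDz a (D.adj_mem hab).1, hDz b (D.adj_mem hab).2⟩)
    · rintro (h | h | ⟨rfl, h, -⟩ | ⟨rfl, h, -⟩ | ⟨rfl, h, -⟩ | ⟨rfl, h, -⟩)
      · exact h.1
      · exact (a3' a b h.1 h.2.1 h.2.2).1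
      · exact h.2
      · exact d1 a h.1 h.2
      · exact h.2
      · exact d2 a h.1 h.2

/-- (A): adding a digon inside a proper subset keeps it colourable -/
theorem Ctx.A {D : Dgr} (c : Ctx D) {R : Finset ℕ} (hR : R ⊆ D.verts) (hne : R ≠ D.verts)
    {u v : ℕ} (hu : u ∈ R) (hv : v ∈ R) (huv : u ≠ v) :
    ∃ (φ : ℕ → Fin 3) (f : ℕ → ℕ), (∀ a b, a ∈ R → b ∈ R → D.Adj a b → φ a = φ b → f a < f b) ∧
      φ u ≠ φ v := by
  by_contra hcon
  obtain ⟨K, hK, hKs, hKa, hKp, hK4, hKO, hKc, -⟩ := c.add_crit hR hne {(u, v), (v, u)} (by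
    intro p hp
    rw [Finset.mem_insert, Finset.mem_singleton] at hp
    rcases hp with rfl | rfl
    · exact ⟨hu, hv, huv⟩
    · exact ⟨hv, hu, huv.symm⟩) (by
    rintro ⟨φ, f, hf⟩
    apply hcon
    refine ⟨φ, f, fun a b ha hb hab => hf a b (Or.inl ⟨hab, ha, hb⟩), fun e => ?_⟩
    have h1 := hf u v (Or.inr (by simp)) e
    have h2 := hf v u (Or.inr (by simp)) e.symm
    omega)
  have hF2 : ({(u, v), (v, u)} : Finset (ℕ × ℕ)).card ≤ 2 := Finset.card_le_two
  have hlt : R.card < D.verts.card := Finset.card_lt_card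
    (Finset.ssubset_iff_subset_ne.2 ⟨hR, hne⟩)
  have hle := Finset.card_le_card hKs
  have := c.P2 (hKs.trans hR) (fun e => by rw [e] at hle; omega) hKc
  omega

theorem Ctx.P3 {D : Dgr} (c : Ctx D) {R : Finset ℕ} (hR : R ⊆ D.verts) (hne : R ≠ D.verts)
    (h4 : 4 ≤ R.card) : 12 ≤ pt D.Adj R := by
  by_contra hlt
  have h11 := c.P2 hR hne h4
  obtain ⟨u, v, huv, hu, hv⟩ := c.crit.two_bd hR hne (by omega)
  obtain ⟨φ, f, hf, hφ⟩ := c.A hR hne hu.1 hv.1 huv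
  obtain ⟨N, W, hE, hW, hO, hV⟩ := c.ext_full hR h4 (by omega) φ f hf
  have hcl := hE.card_le
  have hp := c.p4
  rw [← hV] at hp
  rcases hE.cases with h | h | h
  · by_cases he : (arO D.Adj R (R ∪ YY W N)).card ≤ (arO W.Adj (XX W N) W.verts).card
    · exact hφ (hE.same he hV h.1 hu hv)
    · omega
  · omega
  · omega

end Pf
end PfSection

noncomputable section PfSection
open scoped Classical
namespace Pf
open Dgr

theorem ar_rev (D : Dgr) (S : Finset ℕ) : (ar (rev D).Adj S).card = (ar D.Adj S).card := by
  apply Finset.card_bij (fun p _ => (p.2, p.1))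
  · rintro ⟨a, b⟩ h
    rw [mem_ar] at h ⊢
    exact ⟨h.2.1, h.1, h.2.2⟩
  · rintro ⟨a, b⟩ _ ⟨a', b'⟩ _ h
    simp only [Prod.mk.injEq] at h ⊢
    exact h.symm
  · rintro ⟨a, b⟩ h
    refine ⟨(b, a), ?_, rfl⟩
    rw [mem_ar] at h ⊢
    exact ⟨h.2.1, h.1, h.2.2⟩

theorem pt_rev (D : Dgr) (S : Finset ℕ) : pt (rev D).Adj S = pt D.Adj S := by
  unfold pt
  rw [ar_rev]

theorem Ctx.rev {D : Dgr} (c : Ctx D) : Ctx (rev D) where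
  crit := c.crit.rev
  p4 := by
    have := c.p4
    rw [← pt_rev] at this
    exact this
  no := by
    intro h
    have hb := (ore_facts h).1
    apply c.no
    have : Pf.rev D = D := dgr_ext rfl (fun u v => ⟨fun h => hb h, fun h => hb (u := v) (v := u) h⟩)
    rw [this] at h
    exact h
  ih := c.ih

theorem Ctx.five {D : Dgr} (c : Ctx D) : 5 ≤ D.verts.card := by
  have h := c.crit.four_le
  by_contra h5
  exact c.no (IsOre4.k4 D (c.crit.k4 (by omega)))

/-- a colouring of the subdigraph induced on `R` -/
def CO (D : Dgr) (R : Finset ℕ) (φ : ℕ → Fin 3) : Prop :=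
  ∃ f : ℕ → ℕ, ∀ a b, a ∈ R → b ∈ R → D.Adj a b → φ a = φ b → f a < f b

theorem CO.ext {D : Dgr} {R : Finset ℕ} {φ : ℕ → Fin 3} (h : CO D R φ) {x : ℕ} (hx : x ∉ R) (α : Fin 3)
    (hα : (∀ b ∈ R, D.Adj x b → φ b ≠ α) ∨ (∀ b ∈ R, D.Adj b x → φ b ≠ α)) :
    CO D (insert x R) (Function.update φ x α) := by
  obtain ⟨f, hf⟩ := h
  have hne : ∀ a ∈ R, a ≠ x := fun a ha e => hx (e ▸ ha)
  rcases hα with hα | hα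
  · refine ⟨fun a => if a = x then R.sup f + 1 else f a, ?_⟩
    intro a b ha hb hab hc
    rw [Finset.mem_insert] at ha hb
    rcases ha with rfl | ha <;> rcases hb with rfl | hb
    · exact absurd hab (D.adj_irrefl _)
    · rw [Function.update_self, Function.update_of_ne (hne b hb)] at hc
      exact absurd hc.symm (hα b hb hab)
    · simp only [hne a ha, if_true, if_false]
      exact Nat.lt_succ_of_le (Finset.le_sup ha)
    · rw [Function.update_of_ne (hne a ha), Function.update_of_ne (hne b hb)] at hc
      simp only [hne a ha, hne b hb, if_false]
      exact hf a b ha hb hab hc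
  · refine ⟨fun a => if a = x then 0 else f a + 1, ?_⟩
    intro a b ha hb hab hc
    rw [Finset.mem_insert] at ha hb
    rcases ha with rfl | ha <;> rcases hb with rfl | hb
    · exact absurd hab (D.adj_irrefl _)
    · simp only [hne b hb, if_true, if_false]
      omega
    · rw [Function.update_self, Function.update_of_ne (hne a ha)] at hc
      exact absurd hc (hα a ha hab)
    · rw [Function.update_of_ne (hne a ha), Function.update_of_ne (hne b hb)] at hc
      simp only [hne a ha, hne b hb, if_false]
      have := hf a b ha hb hab hc
      omega

theorem CO.col {D : Dgr} {φ : ℕ → Fin 3} (h : CO D D.verts φ) : Col D.Adj := by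
  obtain ⟨f, hf⟩ := h
  exact ⟨φ, f, fun a b hab => hf a b (D.adj_mem hab).1 (D.adj_mem hab).2 hab⟩

theorem third {S : Finset ℕ} (h : S.card = 3) {v w : ℕ} (hv : v ∈ S) (hw : w ∈ S) (hvw : v ≠ w) :
    ∃ a, a ≠ v ∧ a ≠ w ∧ S = {v, w, a} := by
  have h1 : ((S.erase v).erase w).card = 1 := by
    rw [Finset.card_erase_of_mem (Finset.mem_erase.2 ⟨hvw.symm, hw⟩), Finset.card_erase_of_mem hv, h]
  obtain ⟨a, ha⟩ := Finset.card_eq_one.1 h1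
  have h2 : a ∈ (S.erase v).erase w := by rw [ha]; exact Finset.mem_singleton_self a
  rw [Finset.mem_erase, Finset.mem_erase] at h2
  refine ⟨a, h2.2.1, h2.1, ?_⟩
  ext x
  have h3 : x ∈ (S.erase v).erase w ↔ x = a := by rw [ha, Finset.mem_singleton]
  rw [Finset.mem_erase, Finset.mem_erase] at h3
  simp only [Finset.mem_insert, Finset.mem_singleton]
  by_cases e1 : x = v
  · subst e1; simp [hv]
  by_cases e2 : x = w
  · subst e2; simp [hw]
  tauto

set_option maxRecDepth 100000 in
theorem colours4 : ∀ c a a' b b' : Fin 3, ¬ (a = a' ∧ a = b ∧ a = b') →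
    ∃ α β : Fin 3, α ≠ β ∧ α ≠ c ∧ β ≠ c ∧ (α ≠ a ∨ α ≠ a') ∧ (β ≠ b ∨ β ≠ b') := by
  decide

theorem Ctx.P4 {D : Dgr} (c : Ctx D) {u v w : ℕ} (uv : D.Adj u v) (vu : D.Adj v u) (uw : D.Adj u w)
    (wu : D.Adj w u) (vw : D.Adj v w) (wv : D.Adj w v) (h1 : (outN D u).card = 3)
    (h2 : (inN D u).card = 3) (h3 : (outN D v).card = 3) (h4 : (inN D v).card = 3) : False := by
  have ne : ∀ {x y}, D.Adj x y → x ≠ y := fun {x y} h e => D.adj_irrefl y (e ▸ h)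
  obtain ⟨a, av, aw, ha⟩ := third h1 (mem_outN.2 uv) (mem_outN.2 uw) (ne vw)
  obtain ⟨a', av', aw', ha'⟩ := third h2 (mem_inN.2 vu) (mem_inN.2 wu) (ne vw)
  obtain ⟨b, bu, bw, hb⟩ := third h3 (mem_outN.2 vu) (mem_outN.2 vw) (ne uw)
  obtain ⟨b', bu', bw', hb'⟩ := third h4 (mem_inN.2 uv) (mem_inN.2 wv) (ne uw)
  have oa : ∀ x, D.Adj u x ↔ x = v ∨ x = w ∨ x = a := fun x => by rw [← mem_outN, ha]; simp
  have oa' : ∀ x, D.Adj x u ↔ x = v ∨ x = w ∨ x = a' := fun x => by rw [← mem_inN, ha']; simp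
  have ob : ∀ x, D.Adj v x ↔ x = u ∨ x = w ∨ x = b := fun x => by rw [← mem_outN, hb]; simp
  have ob' : ∀ x, D.Adj x v ↔ x = u ∨ x = w ∨ x = b' := fun x => by rw [← mem_inN, hb']; simp
  have ua : D.Adj u a := (oa a).2 (by simp)
  have au : D.Adj a' u := (oa' a').2 (by simp)
  have vb : D.Adj v b := (ob b).2 (by simp)
  have bv : D.Adj b' v := (ob' b').2 (by simp)
  set R := (D.verts.erase u).erase v with hR
  have mR : ∀ x, x ∈ R ↔ x ≠ v ∧ x ≠ u ∧ x ∈ D.verts := fun x => by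
    rw [hR, Finset.mem_erase, Finset.mem_erase]
  have hRs : R ⊆ D.verts := fun x hx => ((mR x).1 hx).2.2
  have hRne : R ≠ D.verts := by
    intro e
    have : u ∈ R := e ▸ (D.adj_mem uv).1
    exact ((mR u).1 this).2.1 rfl
  have aR : a ∈ R := (mR a).2 ⟨av, (ne ua).symm, (D.adj_mem ua).2⟩
  have aR' : a' ∈ R := (mR a').2 ⟨av', ne au, (D.adj_mem au).1⟩
  have bR : b ∈ R := (mR b).2 ⟨(ne vb).symm, bu, (D.adj_mem vb).2⟩
  have bR' : b' ∈ R := (mR b').2 ⟨ne bv, bu', (D.adj_mem bv).1⟩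
  by_cases hall : a = a' ∧ a = b ∧ a = b'
  · obtain ⟨e1, e2, e3⟩ := hall
    have hp := pt_five (A := D.Adj) (a := w) (b := u) (c := v) (d := a) (ne wu) (ne wv) aw.symm (ne uv)
      (ne ua) av.symm wu uw wv vw uv vu ua (e1 ▸ au) (e2 ▸ vb) (e3 ▸ bv)
    have hcard : ({w, u, v, a} : Finset ℕ).card = 4 := by
      rw [Finset.card_insert_of_notMem, Finset.card_insert_of_notMem, Finset.card_pair]
      · exact av.symm
      · simp [ne uv, ne ua]
      · simp [ne wu, ne wv, aw.symm]
    have := c.P2 (R0 := {w, u, v, a}) (by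
      intro x hx
      simp only [Finset.mem_insert, Finset.mem_singleton] at hx
      rcases hx with rfl | rfl | rfl | rfl
      · exact (D.adj_mem wu).1
      · exact (D.adj_mem uv).1
      · exact (D.adj_mem uv).2
      · exact (D.adj_mem ua).2) (fun e => by
        have := c.five
        rw [← e, hcard] at this
        omega) hcard.ge
    omega
  · obtain ⟨φ, f, hf, hφ⟩ : ∃ (φ : ℕ → Fin 3) (f : ℕ → ℕ),
        (∀ a b, a ∈ R → b ∈ R → D.Adj a b → φ a = φ b → f a < f b) ∧
        ¬ (φ a = φ a' ∧ φ a = φ b ∧ φ a = φ b') := by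
      by_cases e1 : a = a'
      · by_cases e2 : a = b
        · obtain ⟨φ, f, hf, hφ⟩ := c.A hRs hRne aR bR' (fun e => hall ⟨e1, e2, e⟩)
          exact ⟨φ, f, hf, fun h => hφ h.2.2⟩
        · obtain ⟨φ, f, hf, hφ⟩ := c.A hRs hRne aR bR e2
          exact ⟨φ, f, hf, fun h => hφ h.2.1⟩
      · obtain ⟨φ, f, hf, hφ⟩ := c.A hRs hRne aR aR' e1
        exact ⟨φ, f, hf, fun h => hφ h.1⟩
    obtain ⟨α, β, hαβ, hαc, hβc, hα, hβ⟩ := colours4 (φ w) _ _ _ _ hφ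
    have huR : u ∉ R := fun h => ((mR u).1 h).2.1 rfl
    have s1 := CO.ext (D := D) (R := R) (φ := φ) ⟨f, hf⟩ huR α (by
      rcases hα with h | h
      · left
        intro x hx hux e
        rcases (oa x).1 hux with rfl | rfl | rfl
        · exact ((mR _).1 hx).1 rfl
        · exact hαc e.symm
        · exact h e.symm
      · right
        intro x hx hux e
        rcases (oa' x).1 hux with rfl | rfl | rfl
        · exact ((mR _).1 hx).1 rfl
        · exact hαc e.symm
        · exact h e.symm)
    have hvR : v ∉ insert u R := by
      rw [Finset.mem_insert]
      rintro (h | h)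
      · exact ne vu h
      · exact ((mR v).1 h).1 rfl
    have hup : ∀ x, x ≠ u → Function.update φ u α x = φ x := fun x hx => Function.update_of_ne hx _ _
    have s2 := s1.ext hvR β (by
      rcases hβ with h | h
      · left
        intro x hx hux e
        rcases (ob x).1 hux with rfl | rfl | rfl
        · rw [Function.update_self] at e; exact hαβ e
        · rw [hup _ (ne wu)] at e; exact hβc e.symm
        · rw [hup _ bu] at e; exact h e.symm
      · right
        intro x hx hux e
        rcases (ob' x).1 hux with rfl | rfl | rfl
        · rw [Function.update_self] at e; exact hαβ e
        · rw [hup _ (ne wu)] at e; exact hβc e.symm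
        · rw [hup _ bu'] at e; exact h e.symm)
    have : insert v (insert u R) = D.verts := by
      ext x
      rw [Finset.mem_insert, Finset.mem_insert, mR]
      constructor
      · rintro (rfl | rfl | h)
        · exact (D.adj_mem uv).2
        · exact (D.adj_mem uv).1
        · exact h.2.2
      · tauto
    rw [this] at s2
    exact c.crit.1 s2.col

theorem Ctx.P5 {D : Dgr} (c : Ctx D) {R : Finset ℕ} (hR : R ⊆ D.verts) (hn : R.card + 2 ≤ D.verts.card)
    (h4 : 4 ≤ R.card) : 13 ≤ pt D.Adj R := by
  have hne : R ≠ D.verts := fun e => by rw [e] at hn; omega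
  by_contra hlt
  have h11 := c.P3 hR hne h4
  obtain ⟨u, v, huv, hu, hv⟩ := c.crit.two_bd hR hne (by omega)
  obtain ⟨φ, f, hf, hφ⟩ := c.A hR hne hu.1 hv.1 huv
  obtain ⟨N, W, hE, hW, hO, hV⟩ := c.ext_full hR h4 (by omega) φ f hf
  have hcl := hE.card_le
  have hp := c.p4
  rw [← hV] at hp
  rcases hE.cases with h | h | ⟨hX, h, h6⟩
  · by_cases he : (arO D.Adj R (R ∪ YY W N)).card ≤ (arO W.Adj (XX W N) W.verts).card
    · exact hφ (hE.same he hV h.1 hu hv)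
    · omega
  · omega
  · have he : (arO D.Adj R (R ∪ YY W N)).card ≤ (arO W.Adj (XX W N) W.verts).card := by omega
    have hore : IsOre4 W := hO (by omega)
    have hX6 : (ar W.Adj (XX W N)).card = 6 := by omega
    obtain ⟨hWb, -, -, -⟩ := ore_facts hore
    have hXs : XX W N ⊆ W.verts := Finset.filter_subset _ _
    have hXo : ar W.Adj (XX W N) = (XX W N).offDiag := by
      apply Finset.eq_of_subset_of_card_le
      · rintro ⟨a, b⟩ hab
        rw [mem_ar] at hab
        rw [Finset.mem_offDiag]
        exact ⟨hab.1, hab.2.1, fun e => W.adj_irrefl b (by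
          have h : W.Adj a b := hab.2.2
          rwa [show a = b from e] at h)⟩
      · rw [Finset.offDiag_card, hX, hX6]
    have hT : Tri W (XX W N) := by
      refine ⟨hX, hXs, fun a ha b hb hab => ?_⟩
      have : (a, b) ∈ ar W.Adj (XX W N) := by
        rw [hXo, Finset.mem_offDiag]
        exact ⟨ha, hb, hab⟩
      exact (mem_ar.1 this).2.2
    have hlow : ∀ x ∈ W.verts, x ∉ XX W N → ¬ N ≤ x ∧ x ∈ D.verts ∧ x ∉ R := by
      intro x hx hxX
      have : ¬ N ≤ x := fun h => hxX (mem_XX.2 ⟨hx, h⟩)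
      exact ⟨this, hE.low x hx this⟩
    have hadj : ∀ a b, W.Adj a b → a ∉ XX W N → b ∉ XX W N → D.Adj a b := by
      intro a b hab ha hb
      have ha2 := (hlow a (W.adj_mem hab).1 ha).1
      have hb2 := (hlow b (W.adj_mem hab).2 hb).1
      obtain ⟨a', b', hab', -, ea, eb⟩ := hE.adj a b hab (fun h => ha2 h.1)
      have ha' : a' ∉ R := by
        intro h'
        rw [lab_in h'] at ea
        omega
      have hb' : b' ∉ R := by
        intro h'
        rw [lab_in h'] at eb
        omega
      rw [lab_out ha'] at ea
      rw [lab_out hb'] at eb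
      subst ea eb
      exact hab'
    rcases L9 hore _ hT with h4W | ⟨S, hS, hd, h4S, h10⟩ | ⟨T, hT, hd⟩
    · have e1 : (XX W N).card + (YY W N).card = W.verts.card := by
        unfold XX YY
        exact Finset.card_filter_add_card_filter_not _
      have e2 := Finset.card_union_le R (YY W N)
      rw [hV] at e2
      omega
    · have hdS : ∀ a ∈ S, a ∉ XX W N := fun a ha => Finset.disjoint_left.1 hd ha
      have hSD : S ⊆ D.verts := fun a ha => (hlow a (hS ha) (hdS a ha)).2.1
      have := c.P2 hSD (by
        intro e
        have : u ∈ S := e ▸ hR hu.1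
        exact (hlow u (hS this) (hdS u this)).2.2 hu.1) h4S
      have := pt_mono (A := W.Adj) (B := D.Adj) (S := S) (fun a ha b hb hab => hadj a b hab (hdS a ha) (hdS b hb))
      omega
    · have hdT : ∀ a ∈ T, a ∉ XX W N := fun a ha => Finset.disjoint_left.1 hd ha
      have hTo : ∀ a ∈ T, (outN D a).card = 3 := by
        intro a ha
        have haR := (hlow a (hT.sub ha) (hdT a ha)).2
        refine le_antisymm ?_ (c.crit.out_ge haR.1)
        rw [← hT.deg a ha]
        apply Finset.card_le_card_of_injOn (lab R φ N)
        · intro b hb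
          have hb := mem_outN.1 hb
          have := hE.surj he hV hb (fun h => haR.2 h.1)
          rw [lab_out haR.2] at this
          exact mem_outN.2 this
        · intro b hb b' hb' e
          exact (hE.inj he hV (mem_outN.1 hb) (fun h => haR.2 h.1) (mem_outN.1 hb') (fun h => haR.2 h.1) rfl e).2
      have hTi : ∀ a ∈ T, (inN D a).card = 3 := by
        intro a ha
        have haR := (hlow a (hT.sub ha) (hdT a ha)).2
        refine le_antisymm ?_ (c.crit.in_ge haR.1)
        rw [← hT.deg a ha]
        apply Finset.card_le_card_of_injOn (lab R φ N)
        · intro b hb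
          have hb := mem_inN.1 hb
          have := hE.surj he hV hb (fun h => haR.2 h.2)
          rw [lab_out haR.2] at this
          exact mem_outN.2 (hWb this)
        · intro b hb b' hb' e
          exact (hE.inj he hV (mem_inN.1 hb) (fun h => haR.2 h.2) (mem_inN.1 hb') (fun h => haR.2 h.2) e rfl).1
      obtain ⟨x, y, z, hxy, hxz, hyz, rfl⟩ := Finset.card_eq_three.1 hT.card
      have hx : x ∈ ({x, y, z} : Finset ℕ) := by simp
      have hy : y ∈ ({x, y, z} : Finset ℕ) := by simp
      have hz : z ∈ ({x, y, z} : Finset ℕ) := by simp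
      have key : ∀ a ∈ ({x, y, z} : Finset ℕ), ∀ b ∈ ({x, y, z} : Finset ℕ), a ≠ b → D.Adj a b :=
        fun a ha b hb hab => hadj a b (hT.adj a ha b hb hab) (hdT a ha) (hdT b hb)
      exact c.P4 (key x hx y hy hxy) (key y hy x hx hxy.symm) (key x hx z hz hxz) (key z hz x hx hxz.symm)
        (key y hy z hz hyz) (key z hz y hy hyz.symm) (hTo x hx) (hTi x hx) (hTo y hy) (hTi y hy)

end Pf
end PfSection

noncomputable section PfSection
open scoped Classical
namespace Pf
open Dgr

theorem adj_ne {D : Dgr} {x y : ℕ} (h : D.Adj x y) : x ≠ y := fun e => D.adj_irrefl y (e ▸ h)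

theorem Ctx.no5 {D : Dgr} (c : Ctx D) {w u v a : ℕ} (wa : w ≠ a) (wu : D.Adj w u) (uw : D.Adj u w)
    (wv : D.Adj w v) (vw : D.Adj v w) (uv : D.Adj u v) (vu : D.Adj v u) (ua : D.Adj u a) (au : D.Adj a u)
    (va : D.Adj v a) (av : D.Adj a v) : False := by
  have hp := pt_five (A := D.Adj) (a := w) (b := u) (c := v) (d := a) (adj_ne wu) (adj_ne wv) wa (adj_ne uv)
    (adj_ne ua) (adj_ne va) wu uw wv vw uv vu ua au va av
  have hcard : ({w, u, v, a} : Finset ℕ).card = 4 := by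
    rw [Finset.card_insert_of_notMem, Finset.card_insert_of_notMem, Finset.card_pair]
    · exact adj_ne va
    · simp [adj_ne uv, adj_ne ua]
    · simp [adj_ne wu, adj_ne wv, wa]
  have := c.P2 (R0 := {w, u, v, a}) (by
    intro x hx
    simp only [Finset.mem_insert, Finset.mem_singleton] at hx
    rcases hx with rfl | rfl | rfl | rfl
    · exact (D.adj_mem wu).1
    · exact (D.adj_mem uv).1
    · exact (D.adj_mem uv).2
    · exact (D.adj_mem ua).2) (fun e => by
      have := c.five
      rw [← e, hcard] at this
      omega) hcard.ge
  omega

/-- final step: colour `x` last -/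
theorem Ctx.fin_x {D : Dgr} (c : Ctx D) {x y p q : ℕ} {R : Finset ℕ}
    (mR : ∀ v, v ∈ R ↔ v ≠ y ∧ v ≠ x ∧ v ∈ D.verts)
    (ox : ∀ v, D.Adj x v ↔ v = y ∨ v = p ∨ v = q) {φ : ℕ → Fin 3} {α : Fin 3} (hp : φ p ≠ α) (hq : φ q ≠ α)
    (hy : φ y ≠ α) (h : CO D (insert y R) φ) : False := by
  have xy : D.Adj x y := (ox y).2 (by simp)
  have h1 := h.ext (x := x) (by
    rw [Finset.mem_insert, mR]
    have := adj_ne xy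
    tauto) α (Or.inl (by
      intro b hb hxb
      rcases (ox b).1 hxb with rfl | rfl | rfl
      · exact hy
      · exact hp
      · exact hq))
  have : insert x (insert y R) = D.verts := by
    ext v
    rw [Finset.mem_insert, Finset.mem_insert, mR]
    constructor
    · rintro (rfl | rfl | h)
      · exact (D.adj_mem xy).1
      · exact (D.adj_mem xy).2
      · exact h.2.2
    · tauto
  rw [this] at h1
  exact c.crit.1 h1.col

theorem get2 {S : Finset ℕ} (h : S.card = 3) {y : ℕ} (hy : y ∈ S) :
    ∃ p q, p ≠ y ∧ q ≠ y ∧ p ≠ q ∧ ∀ v, v ∈ S ↔ v = y ∨ v = p ∨ v = q := by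
  have h1 : (S.erase y).card = 2 := by rw [Finset.card_erase_of_mem hy, h]
  obtain ⟨p, q, hpq, he⟩ := Finset.card_eq_two.1 h1
  have hm : ∀ v, v ∈ S.erase y ↔ v = p ∨ v = q := fun v => by rw [he]; simp
  have hp := (Finset.mem_erase.1 ((hm p).2 (by simp))).1
  have hq := (Finset.mem_erase.1 ((hm q).2 (by simp))).1
  refine ⟨p, q, hp, hq, hpq, fun v => ?_⟩
  have := hm v
  rw [Finset.mem_erase] at this
  by_cases e : v = y
  · subst e; simp [hy]
  · tauto

theorem colours6 : ∀ p q : Fin 3, ∃ α : Fin 3, p ≠ α ∧ q ≠ α := by decide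

theorem colours7 : ∀ α r s : Fin 3, (∃ β : Fin 3, β ≠ α ∧ r ≠ β ∧ s ≠ β) ∨ (r ≠ α ∧ s ≠ r) := by decide

theorem Ctx.P6 {D : Dgr} (c : Ctx D) {x y r : ℕ} (xy : D.Adj x y) (hx : (outN D x).card = 3)
    (hy : (inN D y).card = 3) (ry : D.Adj r y) (hrx : r ≠ x) : D.Adj y r := by
  by_contra hyr
  obtain ⟨s, hsx, hsr, hin⟩ := third hy (mem_inN.2 xy) (mem_inN.2 ry) hrx.symm
  have iy : ∀ v, D.Adj v y ↔ v = x ∨ v = r ∨ v = s := fun v => by rw [← mem_inN, hin]; simp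
  obtain ⟨p, q, py, qy, pq, ox⟩ := get2 hx (mem_outN.2 xy)
  simp only [mem_outN] at ox
  have xp : D.Adj x p := (ox p).2 (by simp)
  have xq : D.Adj x q := (ox q).2 (by simp)
  set R := (D.verts.erase x).erase y with hR
  have mR : ∀ v, v ∈ R ↔ v ≠ y ∧ v ≠ x ∧ v ∈ D.verts := fun v => by
    rw [hR, Finset.mem_erase, Finset.mem_erase]
  have hRs : R ⊆ D.verts := fun v hv => ((mR v).1 hv).2.2
  have pR : p ∈ R := (mR p).2 ⟨py, (adj_ne xp).symm, (D.adj_mem xp).2⟩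
  have qR : q ∈ R := (mR q).2 ⟨qy, (adj_ne xq).symm, (D.adj_mem xq).2⟩
  have rR : r ∈ R := (mR r).2 ⟨adj_ne ry, hrx, (D.adj_mem ry).1⟩
  have hyR : y ∉ R := fun h => ((mR y).1 h).1 rfl
  have hneR : ∀ v ∈ R, v ≠ y := fun v hv => ((mR v).1 hv).1
  have hncol : ¬ Col (fun a b => a ∈ R ∧ b ∈ R ∧ a ≠ b ∧ (D.Adj a b ∨ (a = r ∧ D.Adj y b))) := by
    rintro ⟨φ, f, hf⟩
    have hfD : ∀ a b, a ∈ R → b ∈ R → D.Adj a b → φ a = φ b → f a < f b :=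
      fun a b ha hb hab => hf a b ⟨ha, hb, adj_ne hab, Or.inl hab⟩
    obtain ⟨α, hpα, hqα⟩ := colours6 (φ p) (φ q)
    rcases colours7 α (φ r) (φ s) with ⟨β, h1, h2, h3⟩ | ⟨h1, h2⟩
    · have s1 := CO.ext (D := D) (R := R) (φ := φ) ⟨f, hfD⟩ hyR β (Or.inr (by
        intro b hb hby
        rcases (iy b).1 hby with rfl | rfl | rfl
        · exact absurd rfl ((mR _).1 hb).2.1
        · exact h2
        · exact h3))
      refine c.fin_x mR ox (α := α) ?_ ?_ ?_ s1
      · rw [Function.update_of_ne py]; exact hpα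
      · rw [Function.update_of_ne qy]; exact hqα
      · rw [Function.update_self]; exact h1
    · have s1 : CO D (insert y R) (Function.update φ y (φ r)) := by
        refine ⟨fun a => if a = y then 2 * f r + 1 else 2 * f a, ?_⟩
        intro a b ha hb hab hc
        rw [Finset.mem_insert] at ha hb
        rcases ha with rfl | ha <;> rcases hb with rfl | hb
        · exact absurd hab (D.adj_irrefl _)
        · rw [Function.update_self, Function.update_of_ne (hneR b hb)] at hc
          simp only [hneR b hb, if_true, if_false]
          have := hf r b ⟨rR, hb, fun e => hyr (e ▸ hab), Or.inr ⟨rfl, hab⟩⟩ hc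
          omega
        · rw [Function.update_self, Function.update_of_ne (hneR a ha)] at hc
          simp only [hneR a ha, if_true, if_false]
          rcases (iy a).1 hab with rfl | rfl | rfl
          · exact absurd rfl ((mR _).1 ha).2.1
          · omega
          · exact absurd hc h2
        · rw [Function.update_of_ne (hneR a ha), Function.update_of_ne (hneR b hb)] at hc
          simp only [hneR a ha, hneR b hb, if_false]
          have := hfD a b ha hb hab hc
          omega
      refine c.fin_x mR ox (α := α) ?_ ?_ ?_ s1
      · rw [Function.update_of_ne py]; exact hpα
      · rw [Function.update_of_ne qy]; exact hqα
      · rw [Function.update_self]; exact h1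
  obtain ⟨K, hK, hKs, hKa⟩ := exists_crit R _ hncol
  have hlt : K.verts.card < D.verts.card := by
    apply Finset.card_lt_card
    refine ⟨hKs.trans hRs, fun h => hyR (hKs (h (D.adj_mem xy).2))⟩
  have hK4 := (c.ih K hK hlt).1
  have hKn : K.verts ≠ D.verts := fun e => by rw [e] at hlt; omega
  by_cases hrK : r ∈ K.verts
  · have h1 := pt_le_add (A := K.Adj) (B := D.Adj) (S := K.verts)
      ((K.verts.filter (fun b => D.Adj y b)).image (fun b => (r, b))) (by
        intro a ha b hb hab
        rcases hKa a b hab with h | h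
        · exact Or.inl h
        · right
          rw [Finset.mem_image]
          exact ⟨b, Finset.mem_filter.2 ⟨hb, h.2⟩, by rw [h.1]⟩)
    have h2 : ((K.verts.filter (fun b => D.Adj y b)).image (fun b => (r, b))).card ≤
      (K.verts.filter (fun b => D.Adj y b)).card := Finset.card_image_le
    have hyK : y ∉ K.verts := fun h => hyR (hKs h)
    have h3 := pt_insert D.adj_irrefl hyK
    have h4 : 0 < (K.verts.filter (fun b => D.Adj b y)).card :=
      Finset.card_pos.2 ⟨r, Finset.mem_filter.2 ⟨hrK, ry⟩⟩
    have h5 : K.verts.card ≤ (insert y K.verts).card := Finset.card_le_card (Finset.subset_insert _ _)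
    have h6 := hK.four_le
    have h7 := c.P3 (R := insert y K.verts) (Finset.insert_subset (D.adj_mem xy).2 (hKs.trans hRs)) (by
      intro e
      have : x ∈ insert y K.verts := e ▸ (D.adj_mem xy).1
      rw [Finset.mem_insert] at this
      rcases this with h | h
      · exact adj_ne xy h
      · exact ((mR x).1 (hKs h)).2.1 rfl) (by omega)
    omega
  · have h1 := pt_mono (A := K.Adj) (B := D.Adj) (S := K.verts) (by
      intro a ha b hb hab
      rcases hKa a b hab with h | h
      · exact h
      · exact absurd (h.1 ▸ ha) hrK)
    have := c.P3 (hKs.trans hRs) hKn hK.four_le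
    omega

theorem Ctx.P6' {D : Dgr} (c : Ctx D) {x y r : ℕ} (xy : D.Adj x y) (hx : (outN D x).card = 3)
    (hy : (inN D y).card = 3) (xr : D.Adj x r) (hry : r ≠ y) : D.Adj r x :=
  c.rev.P6 (x := y) (y := x) (r := r) xy hy hx xr hry

theorem colours8 : ∀ a b : Fin 3, ∃ β : Fin 3, β ≠ a ∧ b ≠ β := by decide

set_option maxHeartbeats 4000000 in
theorem Ctx.P7 {D : Dgr} (c : Ctx D) {x y r s : ℕ} (xy : D.Adj x y) (hx : (outN D x).card = 3)
    (hy : (inN D y).card = 3) (ry : D.Adj r y) (hrx : r ≠ x) (sy : D.Adj s y) (hsx : s ≠ x)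
    (hrs : r ≠ s) : D.Adj r s ∧ D.Adj s r := by
  by_contra hno
  have yr := c.P6 xy hx hy ry hrx
  have ys := c.P6 xy hx hy sy hsx
  have iy : ∀ v, D.Adj v y → v = x ∨ v = r ∨ v = s := by
    obtain ⟨s', hsx', hsr', hin⟩ := third hy (mem_inN.2 xy) (mem_inN.2 ry) hrx.symm
    have : s ∈ inN D y := mem_inN.2 sy
    rw [hin] at this
    simp only [Finset.mem_insert, Finset.mem_singleton] at this
    have hs : s = s' := by
      rcases this with h | h | h
      · exact absurd h hsx
      · exact absurd h.symm hrs
      · exact h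
    intro v hv
    have hv := mem_inN.2 hv
    rw [hin] at hv
    simp only [Finset.mem_insert, Finset.mem_singleton] at hv
    rw [hs]
    exact hv
  obtain ⟨p, q, py, qy, pq, ox⟩ := get2 hx (mem_outN.2 xy)
  simp only [mem_outN] at ox
  have xp : D.Adj x p := (ox p).2 (by simp)
  have xq : D.Adj x q := (ox q).2 (by simp)
  set R := (D.verts.erase x).erase y with hR
  have mR : ∀ v, v ∈ R ↔ v ≠ y ∧ v ≠ x ∧ v ∈ D.verts := fun v => by
    rw [hR, Finset.mem_erase, Finset.mem_erase]
  have hRs : R ⊆ D.verts := fun v hv => ((mR v).1 hv).2.2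
  have rR : r ∈ R := (mR r).2 ⟨adj_ne ry, hrx, (D.adj_mem ry).1⟩
  have sR : s ∈ R := (mR s).2 ⟨adj_ne sy, hsx, (D.adj_mem sy).1⟩
  have hyR : y ∉ R := fun h => ((mR y).1 h).1 rfl
  obtain ⟨π, hπs, hπn⟩ : ∃ π : ℕ → ℕ, π s = r ∧ ∀ v, v ≠ s → π v = v :=
    ⟨fun v => if v = s then r else v, if_pos rfl, fun v hv => if_neg hv⟩
  have hπr : π r = r := hπn r hrs
  have hπmem : ∀ v ∈ R, π v ∈ R.erase s := by
    intro v hv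
    by_cases e : v = s
    · rw [e, hπs]; exact Finset.mem_erase.2 ⟨hrs, rR⟩
    · rw [hπn v e]; exact Finset.mem_erase.2 ⟨e, hv⟩
  have hπeq : ∀ a b, a ≠ b → π a = π b → (a = r ∧ b = s) ∨ (a = s ∧ b = r) := by
    intro a b hab e
    by_cases ha : a = s
    · have hb : b ≠ s := fun h => hab (ha.trans h.symm)
      rw [ha, hπs, hπn b hb] at e
      exact Or.inr ⟨ha, e.symm⟩
    · by_cases hb : b = s
      · rw [hb, hπs, hπn a ha] at e
        exact Or.inl ⟨e, hb⟩
      · rw [hπn a ha, hπn b hb] at e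
        exact absurd e hab
  have hncol : ¬ Col (fun a b => a ∈ R.erase s ∧ b ∈ R.erase s ∧ a ≠ b ∧
      (∃ a' b', a' ∈ R ∧ b' ∈ R ∧ D.Adj a' b' ∧ π a' = a ∧ π b' = b)) := by
    rintro ⟨φ, f, hf⟩
    have hco : CO D R (fun v => φ (π v)) := by
      refine ⟨fun v => 2 * f (π v) + if (v = s ∧ D.Adj r s) ∨ (v = r ∧ D.Adj s r) then 1 else 0, ?_⟩
      intro a b ha hb hab e
      by_cases hπ : π a = π b
      · rcases hπeq a b (adj_ne hab) hπ with ⟨rfl, rfl⟩ | ⟨rfl, rfl⟩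
        · have : ¬ D.Adj b a := fun h => hno ⟨hab, h⟩
          simp only [hπ]
          simp [hab, this, hrs]
        · have : ¬ D.Adj b a := fun h => hno ⟨h, hab⟩
          simp only [hπ]
          simp [hab, this, hrs.symm]
      · have := hf (π a) (π b) ⟨hπmem a ha, hπmem b hb, hπ, a, b, ha, hb, hab, rfl, rfl⟩ e
        simp only
        split_ifs <;> omega
    obtain ⟨α, hpα, hqα⟩ := colours6 (φ (π p)) (φ (π q))
    obtain ⟨β, hβ1, hβ2⟩ := colours8 α (φ r)
    have s1 := hco.ext hyR β (Or.inr (by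
      intro b hb hby
      rcases iy b hby with rfl | rfl | rfl
      · exact absurd rfl ((mR _).1 hb).2.1
      · rw [hπr]; exact hβ2
      · rw [hπs]; exact hβ2))
    refine c.fin_x mR ox (α := α) ?_ ?_ ?_ s1
    · rw [Function.update_of_ne py]; exact hpα
    · rw [Function.update_of_ne qy]; exact hqα
    · rw [Function.update_self]; exact hβ1
  obtain ⟨K, hK, hKs, hKa⟩ := exists_crit (R.erase s) _ hncol
  have hsK : s ∉ K.verts := fun h => (Finset.mem_erase.1 (hKs h)).1 rfl
  have hKR : K.verts ⊆ R := hKs.trans (Finset.erase_subset _ _)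
  have hyK : y ∉ K.verts := fun h => hyR (hKR h)
  have hlt : K.verts.card < D.verts.card := by
    apply Finset.card_lt_card
    refine ⟨hKR.trans hRs, fun h => hyK (h (D.adj_mem xy).2)⟩
  obtain ⟨hK4, hKO⟩ := c.ih K hK hlt
  have hKn : K.verts ≠ D.verts := fun e => by rw [e] at hlt; omega
  have hKc := hK.four_le
  have hKD : ∀ a b, K.Adj a b → a ≠ r → b ≠ r → D.Adj a b := by
    intro a b hab ha hb
    obtain ⟨a', b', -, -, h, ea, eb⟩ := hKa a b hab
    have h1 : a' ≠ s := fun e => by rw [e, hπs] at ea; exact ha ea.symm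
    have h2 : b' ≠ s := fun e => by rw [e, hπs] at eb; exact hb eb.symm
    rw [hπn _ h1] at ea
    rw [hπn _ h2] at eb
    rwa [← ea, ← eb]
  by_cases hrK : r ∈ K.verts
  swap
  · have h1 := pt_mono (A := K.Adj) (B := D.Adj) (S := K.verts) (by
      intro a ha b hb hab
      exact hKD a b hab (fun e => hrK (e ▸ ha)) (fun e => hrK (e ▸ hb)))
    have := c.P3 (hKR.trans hRs) hKn hK.four_le
    omega
  set S := insert s K.verts with hS
  have hScard : S.card = K.verts.card + 1 := Finset.card_insert_of_notMem hsK
  have hSR : S ⊆ R := Finset.insert_subset sR hKR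
  have hKim : ar K.Adj K.verts ⊆ (ar D.Adj S).image (fun e => (π e.1, π e.2)) := by
    rintro ⟨a, b⟩ hab
    rw [mem_ar] at hab
    obtain ⟨a', b', -, -, h, ea, eb⟩ := hKa a b hab.2.2
    have key : ∀ a a', a ∈ K.verts → π a' = a → a' ∈ S := by
      intro a a' ha e
      rw [hS, Finset.mem_insert]
      by_cases h : a' = s
      · exact Or.inl h
      · rw [hπn _ h] at e
        exact Or.inr (e ▸ ha)
    rw [Finset.mem_image]
    refine ⟨(a', b'), mem_ar.2 ⟨key a a' hab.1 ea, key b b' hab.2.1 eb, h⟩, ?_⟩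
    simp [ea, eb]
  have hle1 := Finset.card_le_card hKim
  have hle2 : ((ar D.Adj S).image (fun e => (π e.1, π e.2))).card ≤ (ar D.Adj S).card := Finset.card_image_le
  have hyS : y ∉ S := fun h => hyR (hSR h)
  have hrS : r ∈ S := Finset.mem_insert_of_mem hrK
  have hsS : s ∈ S := Finset.mem_insert_self _ _
  have hins := pt_insert D.adj_irrefl hyS
  have h2sub : ∀ P : ℕ → Prop, P r → P s → 2 ≤ (S.filter P).card := by
    intro P h1 h2
    have : ({r, s} : Finset ℕ) ⊆ S.filter P := by
      intro v hv
      rw [Finset.mem_insert, Finset.mem_singleton] at hv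
      rcases hv with rfl | rfl
      · exact Finset.mem_filter.2 ⟨hrS, h1⟩
      · exact Finset.mem_filter.2 ⟨hsS, h2⟩
    have h3 := Finset.card_le_card this
    rwa [Finset.card_pair hrs] at h3
  have ho2 := h2sub (fun v => D.Adj y v) yr ys
  have hi2 := h2sub (fun v => D.Adj v y) ry sy
  have hyScard : (insert y S).card = S.card + 1 := Finset.card_insert_of_notMem hyS
  have hxyS : x ∉ insert y S := by
    rw [Finset.mem_insert]
    rintro (h | h)
    · exact adj_ne xy h
    · exact ((mR x).1 (hSR h)).2.1 rfl
  have hyssub : insert y S ⊆ D.verts := Finset.insert_subset (D.adj_mem xy).2 (hSR.trans hRs)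
  have hysne : insert y S ≠ D.verts := fun e => hxyS (e ▸ (D.adj_mem xy).1)
  have h12 := c.P3 hyssub hysne (by omega)
  have hptS : pt D.Adj S ≤ pt K.Adj K.verts + 10 := by
    unfold pt
    omega
  have e12 : pt D.Adj (insert y S) = 12 := by omega
  have eK : pt K.Adj K.verts = 4 := by omega
  have eo : (S.filter (fun v => D.Adj y v)).card = 2 := by omega
  have ei : (S.filter (fun v => D.Adj v y)).card = 2 := by omega
  have ear : (ar D.Adj S).card ≤ (ar K.Adj K.verts).card := by
    unfold pt at *
    omega
  have hKore : IsOre4 K := hKO eK.ge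
  obtain ⟨hKb, -, -, -⟩ := ore_facts hKore
  have hVn : ¬ (insert y S).card + 2 ≤ D.verts.card := by
    intro h
    have := c.P5 hyssub h (by omega)
    omega
  have hV : insert x (insert y S) = D.verts := by
    apply Finset.eq_of_subset_of_card_le (Finset.insert_subset (D.adj_mem xy).1 hyssub)
    rw [Finset.card_insert_of_notMem hxyS]
    omega
  have hVm : ∀ v, v ∈ D.verts ↔ v = x ∨ v = y ∨ v ∈ S := fun v => by
    rw [← hV, Finset.mem_insert, Finset.mem_insert]
  -- out-neighbours of y inside S are r and s
  have hSo : S.filter (fun v => D.Adj y v) = {r, s} := by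
    symm
    apply Finset.eq_of_subset_of_card_le
    · intro v hv
      rw [Finset.mem_insert, Finset.mem_singleton] at hv
      rcases hv with rfl | rfl
      · exact Finset.mem_filter.2 ⟨hrS, yr⟩
      · exact Finset.mem_filter.2 ⟨hsS, ys⟩
    · rw [eo, Finset.card_pair hrs]
  have oy : ∀ v, D.Adj y v → v = x ∨ v = r ∨ v = s := by
    intro v hv
    rcases (hVm v).1 (D.adj_mem hv).2 with h | h | h
    · exact Or.inl h
    · exact absurd h.symm (adj_ne hv)
    · right
      have : v ∈ S.filter (fun v => D.Adj y v) := Finset.mem_filter.2 ⟨h, hv⟩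
      rw [hSo] at this
      simpa using this
  have yx : D.Adj y x := by
    by_contra h
    have h1 : outN D y ⊆ {r, s} := by
      intro v hv
      rw [mem_outN] at hv
      rcases oy v hv with rfl | h' | h'
      · exact absurd hv h
      · simp [h']
      · simp [h']
    have h2 := Finset.card_le_card h1
    have h3 := c.crit.out_ge (D.adj_mem xy).2
    have := Finset.card_le_two (a := r) (b := s)
    omega
  -- degree of x
  have hinx := pt_insert D.adj_irrefl hxyS
  rw [hV] at hinx
  have hp4 := c.p4
  have hVx : ∀ v, v ∈ D.verts → v ≠ x → v ∈ insert y S := by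
    intro v hv hvx
    rw [← hV, Finset.mem_insert] at hv
    exact hv.resolve_left hvx
  have hxo : (insert y S).filter (fun v => D.Adj x v) = outN D x := by
    ext v
    rw [Finset.mem_filter, mem_outN]
    exact ⟨fun h => h.2, fun h => ⟨hVx v (D.adj_mem h).2 (adj_ne h).symm, h⟩⟩
  have hxi : (insert y S).filter (fun v => D.Adj v x) = inN D x := by
    ext v
    rw [Finset.mem_filter, mem_inN]
    exact ⟨fun h => h.2, fun h => ⟨hVx v (D.adj_mem h).1 (adj_ne h), h⟩⟩
  rw [hxo, hxi, hx] at hinx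
  have hin3 : (inN D x).card = 3 := by
    have := c.crit.in_ge (D.adj_mem xy).1
    omega
  have px := c.P6' xy hx hy xp py
  have qx := c.P6' xy hx hy xq qy
  have ix : ∀ v, D.Adj v x → v = y ∨ v = p ∨ v = q := by
    intro v hv
    have h1 : outN D x ⊆ inN D x := by
      intro v hv
      rw [mem_outN, ox] at hv
      rw [mem_inN]
      rcases hv with rfl | rfl | rfl
      · exact yx
      · exact px
      · exact qx
    have h2 := Finset.eq_of_subset_of_card_le h1 (by omega)
    rw [← ox, ← mem_outN, h2, mem_inN]
    exact hv
  -- injectivity of the merge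
  have himeq : ar K.Adj K.verts = (ar D.Adj S).image (fun e => (π e.1, π e.2)) :=
    Finset.eq_of_subset_of_card_le hKim (by omega)
  have hinj : Set.InjOn (fun e : ℕ × ℕ => (π e.1, π e.2)) (ar D.Adj S) := by
    rw [← Finset.card_image_iff]
    omega
  have hsurj : ∀ a b, a ∈ S → b ∈ S → D.Adj a b → K.Adj (π a) (π b) := by
    intro a b ha hb hab
    have : (π a, π b) ∈ ar K.Adj K.verts := by
      rw [himeq, Finset.mem_image]
      exact ⟨(a, b), mem_ar.2 ⟨ha, hb, hab⟩, rfl⟩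
    exact (mem_ar.1 this).2.2
  rcases L8 hKore r with ⟨S', hS', hrS', h4S', h10S'⟩ | ⟨T, hT, hrT⟩
  · have h1 := pt_mono (A := K.Adj) (B := D.Adj) (S := S') (by
      intro a ha b hb hab
      exact hKD a b hab (fun e => hrS' (e ▸ ha)) (fun e => hrS' (e ▸ hb)))
    have := c.P2 (hS'.trans (hKR.trans hRs)) (fun e => hyK (hS' (e ▸ (D.adj_mem xy).2))) h4S'
    omega
  · have hTr : ∀ t ∈ T, t ≠ r := fun t ht e => hrT (e ▸ ht)
    have hTs : ∀ t ∈ T, t ≠ s := fun t ht e => hsK (e ▸ hT.sub ht)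
    have hTS : ∀ t ∈ T, t ∈ S := fun t ht => Finset.mem_insert_of_mem (hT.sub ht)
    have hTx : ∀ t ∈ T, t ≠ x := fun t ht => ((mR t).1 (hSR (hTS t ht))).2.1
    have hTy : ∀ t ∈ T, t ≠ y := fun t ht => ((mR t).1 (hSR (hTS t ht))).1
    have hTadj : ∀ a ∈ T, ∀ b ∈ T, a ≠ b → D.Adj a b := fun a ha b hb hab =>
      hKD a b (hT.adj a ha b hb hab) (hTr a ha) (hTr b hb)
    have hTo : ∀ t ∈ T, t ≠ p → t ≠ q → (outN D t).card = 3 := by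
      intro t ht h1 h2
      have htV : t ∈ D.verts := hRs (hSR (hTS t ht))
      refine le_antisymm ?_ (c.crit.out_ge htV)
      rw [← hT.deg t ht]
      have hb' : ∀ b, D.Adj t b → b ∈ S := by
        intro b hb
        rcases (hVm b).1 (D.adj_mem hb).2 with rfl | rfl | h
        · rcases ix t hb with h | h | h
          · exact absurd h (hTy t ht)
          · exact absurd h h1
          · exact absurd h h2
        · rcases iy t hb with h | h | h
          · exact absurd h (hTx t ht)
          · exact absurd h (hTr t ht)
          · exact absurd h (hTs t ht)
        · exact h
      apply Finset.card_le_card_of_injOn π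
      · intro b hb
        have hb := mem_outN.1 hb
        have := hsurj t b (hTS t ht) (hb' b hb) hb
        rw [hπn t (hTs t ht)] at this
        exact mem_outN.2 this
      · intro b hb b2 hb2 e
        have hb := mem_outN.1 hb
        have hb2 := mem_outN.1 hb2
        have := hinj (mem_ar.2 ⟨hTS t ht, hb' b hb, hb⟩ : (t, b) ∈ ar D.Adj S)
          (mem_ar.2 ⟨hTS t ht, hb' b2 hb2, hb2⟩ : (t, b2) ∈ ar D.Adj S) (by simp [e])
        exact (Prod.mk.injEq _ _ _ _ ▸ this).2
    have hTi : ∀ t ∈ T, t ≠ p → t ≠ q → (inN D t).card = 3 := by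
      intro t ht h1 h2
      have htV : t ∈ D.verts := hRs (hSR (hTS t ht))
      refine le_antisymm ?_ (c.crit.in_ge htV)
      rw [← hT.deg t ht]
      have hb' : ∀ b, D.Adj b t → b ∈ S := by
        intro b hb
        rcases (hVm b).1 (D.adj_mem hb).1 with rfl | rfl | h
        · rcases (ox t).1 hb with h | h | h
          · exact absurd h (hTy t ht)
          · exact absurd h h1
          · exact absurd h h2
        · rcases oy t hb with h | h | h
          · exact absurd h (hTx t ht)
          · exact absurd h (hTr t ht)
          · exact absurd h (hTs t ht)
        · exact h
      apply Finset.card_le_card_of_injOn π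
      · intro b hb
        have hb := mem_inN.1 hb
        have := hsurj b t (hb' b hb) (hTS t ht) hb
        rw [hπn t (hTs t ht)] at this
        exact mem_outN.2 (hKb this)
      · intro b hb b2 hb2 e
        have hb := mem_inN.1 hb
        have hb2 := mem_inN.1 hb2
        have := hinj (mem_ar.2 ⟨hb' b hb, hTS t ht, hb⟩ : (b, t) ∈ ar D.Adj S)
          (mem_ar.2 ⟨hb' b2 hb2, hTS t ht, hb2⟩ : (b2, t) ∈ ar D.Adj S) (by simp [e])
        exact (Prod.mk.injEq _ _ _ _ ▸ this).1
    obtain ⟨t1, t2, t3, h12', h13, h23, rfl⟩ := Finset.card_eq_three.1 hT.card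
    have m1 : t1 ∈ ({t1, t2, t3} : Finset ℕ) := by simp
    have m2 : t2 ∈ ({t1, t2, t3} : Finset ℕ) := by simp
    have m3 : t3 ∈ ({t1, t2, t3} : Finset ℕ) := by simp
    have hxd : ∀ t, (t = p ∨ t = q) → D.Adj x t ∧ D.Adj t x := by
      rintro t (rfl | rfl)
      · exact ⟨xp, px⟩
      · exact ⟨xq, qx⟩
    -- two vertices of T neighbours of x
    have two : ∀ a b d, a ∈ ({t1, t2, t3} : Finset ℕ) → b ∈ ({t1, t2, t3} : Finset ℕ) →
        d ∈ ({t1, t2, t3} : Finset ℕ) → a ≠ b → a ≠ d → b ≠ d →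
        (a = p ∨ a = q) → (b = p ∨ b = q) → False := by
      intro a b d ha hb hd hab had hbd h1 h2
      exact c.no5 (hTx d hd).symm (hxd a h1).1 (hxd a h1).2 (hxd b h2).1 (hxd b h2).2
        (hTadj a ha b hb hab) (hTadj b hb a ha hab.symm) (hTadj a ha d hd had) (hTadj d hd a ha had.symm)
        (hTadj b hb d hd hbd) (hTadj d hd b hb hbd.symm)
    have two' : ∀ a b d, a ∈ ({t1, t2, t3} : Finset ℕ) → b ∈ ({t1, t2, t3} : Finset ℕ) →
        d ∈ ({t1, t2, t3} : Finset ℕ) → a ≠ b → a ≠ d → b ≠ d →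
        ¬ (a = p ∨ a = q) → ¬ (b = p ∨ b = q) → False := by
      intro a b d ha hb hd hab had hbd h1 h2
      rw [not_or] at h1 h2
      exact c.P4 (hTadj a ha b hb hab) (hTadj b hb a ha hab.symm) (hTadj a ha d hd had) (hTadj d hd a ha had.symm)
        (hTadj b hb d hd hbd) (hTadj d hd b hb hbd.symm) (hTo a ha h1.1 h1.2) (hTi a ha h1.1 h1.2)
        (hTo b hb h2.1 h2.2) (hTi b hb h2.1 h2.2)
    by_cases k1 : t1 = p ∨ t1 = q <;> by_cases k2 : t2 = p ∨ t2 = q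
    · exact two t1 t2 t3 m1 m2 m3 h12' h13 h23 k1 k2
    · by_cases k3 : t3 = p ∨ t3 = q
      · exact two t1 t3 t2 m1 m3 m2 h13 h12' h23.symm k1 k3
      · exact two' t2 t3 t1 m2 m3 m1 h23 h12'.symm h13.symm k2 k3
    · by_cases k3 : t3 = p ∨ t3 = q
      · exact two t2 t3 t1 m2 m3 m1 h23 h12'.symm h13.symm k2 k3
      · exact two' t1 t3 t2 m1 m3 m2 h13 h12' h23.symm k1 k3
    · exact two' t1 t2 t3 m1 m2 m3 h12' h13 h23 k1 k2

end Pf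
end PfSection

noncomputable section PfSection
open scoped Classical
namespace Pf
open Dgr

theorem Ctx.P8 {D : Dgr} (c : Ctx D) {y x1 x2 : ℕ} (hy : (inN D y).card = 3) (h1 : D.Adj x1 y)
    (h2 : D.Adj x2 y) (d1 : (outN D x1).card = 3) (d2 : (outN D x2).card = 3) (hne : x1 ≠ x2) : False := by
  obtain ⟨x3, n1, n2, hin⟩ := third hy (mem_inN.2 h1) (mem_inN.2 h2) hne
  have h3 : D.Adj x3 y := by
    rw [← mem_inN, hin]
    simp
  have e1 := c.P6 h2 d2 hy h1 hne
  have e2 := c.P6 h1 d1 hy h2 hne.symm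
  have e3 := c.P6 h1 d1 hy h3 n1
  have f1 := c.P7 h1 d1 hy h2 hne.symm h3 n1 n2.symm
  have f2 := c.P7 h2 d2 hy h1 hne h3 n2 n1.symm
  exact c.no5 (w := x1) (u := x3) (v := y) (a := x2) hne f2.1 f2.2 h1 e1 h3 e3 f1.2 f1.1 e2 h2

theorem ar_sum (D : Dgr) : (ar D.Adj D.verts).card = ∑ u ∈ D.verts, (outN D u).card := by
  rw [Finset.card_eq_sum_card_fiberwise (f := Prod.fst) (t := D.verts)]
  · apply Finset.sum_congr rfl
    intro u hu
    apply Finset.card_bij (fun p _ => p.2)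
    · rintro ⟨a, b⟩ h
      rw [Finset.mem_filter, mem_ar] at h
      rw [mem_outN, ← h.2]
      exact h.1.2.2
    · rintro ⟨a, b⟩ h ⟨a', b'⟩ h' e
      rw [Finset.mem_filter] at h h'
      exact Prod.ext (h.2.trans h'.2.symm) e
    · intro b hb
      rw [mem_outN] at hb
      exact ⟨(u, b), Finset.mem_filter.2 ⟨mem_ar.2 ⟨hu, (D.adj_mem hb).2, hb⟩, rfl⟩, rfl⟩
  · rintro ⟨a, b⟩ h
    exact (mem_ar.1 h).1

theorem Ctx.finish {D : Dgr} (c : Ctx D)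
    (hOI : (D.verts.filter (fun v => (outN D v).card = 3)).card ≤
      (D.verts.filter (fun v => (inN D v).card = 3)).card) : False := by
  set O := D.verts.filter (fun v => (outN D v).card = 3) with hO
  set P := D.verts.filter (fun v => ¬ (outN D v).card = 3) with hP
  set I := D.verts.filter (fun v => (inN D v).card = 3) with hI
  have hOP : O.card + P.card = D.verts.card := Finset.card_filter_add_card_filter_not _
  have hsum := ar_sum D
  rw [← Finset.sum_filter_add_sum_filter_not D.verts (fun v => (outN D v).card = 3)] at hsum
  change _ = ∑ v ∈ O, (outN D v).card + ∑ v ∈ P, (outN D v).card at hsum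
  have hs1 : ∑ v ∈ O, (outN D v).card = 3 * O.card := by
    rw [Finset.sum_congr rfl (fun v hv => (Finset.mem_filter.1 hv).2), Finset.sum_const, smul_eq_mul, mul_comm]
  have hs2 : P.card * 4 ≤ ∑ v ∈ P, (outN D v).card := by
    rw [← smul_eq_mul]
    apply Finset.card_nsmul_le_sum
    intro v hv
    obtain ⟨hv, hn⟩ := Finset.mem_filter.1 hv
    have := c.crit.out_ge hv
    omega
  have hdc := Finset.sum_card_bipartiteAbove_eq_sum_card_bipartiteBelow (s := P) (t := I)
    (fun u v => D.Adj u v)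
  have hs3 : ∑ u ∈ P, (I.bipartiteAbove (fun u v => D.Adj u v) u).card ≤ ∑ v ∈ P, (outN D v).card := by
    apply Finset.sum_le_sum
    intro u _
    apply Finset.card_le_card
    intro v hv
    rw [Finset.mem_bipartiteAbove] at hv
    exact mem_outN.2 hv.2
  have hs4 : I.card * 2 ≤ ∑ v ∈ I, (P.bipartiteBelow (fun u v => D.Adj u v) v).card := by
    rw [← smul_eq_mul]
    apply Finset.card_nsmul_le_sum
    intro y hy
    have hy3 := (Finset.mem_filter.1 hy).2
    have hsp : (inN D y).card ≤ ((inN D y).filter (fun v => (outN D v).card = 3)).card +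
        (P.bipartiteBelow (fun u v => D.Adj u v) y).card := by
      rw [← Finset.card_filter_add_card_filter_not (s := inN D y) (fun v => (outN D v).card = 3)]
      apply Nat.add_le_add_left
      apply Finset.card_le_card
      intro u hu
      rw [Finset.mem_filter, mem_inN] at hu
      rw [Finset.mem_bipartiteBelow]
      exact ⟨Finset.mem_filter.2 ⟨(D.adj_mem hu.1).1, hu.2⟩, hu.1⟩
    have h1 : ((inN D y).filter (fun v => (outN D v).card = 3)).card ≤ 1 := by
      rw [Finset.card_le_one]
      intro a ha b hb
      rw [Finset.mem_filter, mem_inN] at ha hb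
      by_contra hab
      exact c.P8 hy3 ha.1 hb.1 ha.2 hb.2 hab
    omega
  have hp := c.p4
  unfold pt at hp
  omega

theorem all_crit : ∀ m, IHp m := by
  intro m
  induction m using Nat.strong_induction_on with
  | _ m IH =>
    intro K hK hlt
    have key : 4 ≤ pt K.Adj K.verts → IsOre4 K := by
      intro h4
      by_contra hno
      have c : Ctx K := ⟨hK, h4, hno, IH _ hlt⟩
      rcases le_total (K.verts.filter (fun v => (outN K v).card = 3)).card
        (K.verts.filter (fun v => (inN K v).card = 3)).card with h | h
      · exact c.finish h
      · exact c.rev.finish h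
    refine ⟨?_, key⟩
    by_contra hcon
    have := (ore_facts (key (by omega))).2.1
    omega

end Pf
end PfSection

/-- every 4-dicritical digraph on `n` vertices has at least
`(10/3)n − 4/3` arcs, with equality iff it is 4-Ore; if it is not 4-Ore, it has
at least `(10/3)n − 1` arcs. -/
theorem stmt_15 (D : Dgr) (hD : Dgr.Dicritical 4 D) :
    (10 : ℝ) / 3 * (D.nV : ℝ) - 4/3 ≤ (D.nA : ℝ) ∧
    ((D.nA : ℝ) = 10 / 3 * (D.nV : ℝ) - 4/3 ↔ IsOre4 D) ∧
    (¬ IsOre4 D → (10 : ℝ) / 3 * (D.nV : ℝ) - 1 ≤ (D.nA : ℝ)) := by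
  classical
  have hc := Pf.crit_of_dicritical hD
  have hall := Pf.all_crit (D.verts.card + 1) D hc (by omega)
  have hA := Pf.ar_nA D
  have hV : D.nV = D.verts.card := rfl
  have hpt : Pf.pt D.Adj D.verts = 10 * (D.nV : ℤ) - 3 * (D.nA : ℤ) := by
    rw [hA, hV]
    rfl
  rw [hpt] at hall
  obtain ⟨h1, h2⟩ := hall
  have h3 : IsOre4 D → 10 * (D.nV : ℤ) - 3 * (D.nA : ℤ) = 4 := by
    intro h
    rw [← hpt]
    exact (Pf.ore_facts h).2.1
  have r1 : 10 * (D.nV : ℝ) - 3 * (D.nA : ℝ) ≤ 4 := by exact_mod_cast h1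
  refine ⟨by linarith, ⟨?_, ?_⟩, ?_⟩
  · intro h
    have e : 10 * (D.nV : ℝ) - 3 * (D.nA : ℝ) = 4 := by linarith
    have e' : 10 * (D.nV : ℤ) - 3 * (D.nA : ℤ) = 4 := by exact_mod_cast e
    exact h2 e'.ge
  · intro h
    have e : 10 * (D.nV : ℝ) - 3 * (D.nA : ℝ) = 4 := by exact_mod_cast h3 h
    linarith
  · intro h
    have e : 10 * (D.nV : ℤ) - 3 * (D.nA : ℤ) ≤ 3 := by
      by_contra hcon
      exact h (h2 (by omega))
    have e' : 10 * (D.nV : ℝ) - 3 * (D.nA : ℝ) ≤ 3 := by exact_mod_cast e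
    linarith
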